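/- Let n ≥ 2 be an integer and let μ be a Borel probability measure on the circle ℝ/ℤ (identified with [0,1)) which is invariant and ergodic under the map T_n(x) = n·x mod 1, and which is exact dimensional of some dimension κ > 0. Then for μ-almost every x, the number x is well approximable: for every ε > 0 there exist m ∈ ℤ and a positive integer k with |k·x − m| < ε/k. -/

import Mathlib

open MeasureTheory Filter

/-- A real number `x` is well approximable: for every `ε > 0` there are `m ∈ ℤ` and a
positive integer `k` with `|k·x − m| < ε/k`. -/
def IsWA (x : ℝ) : Prop :=
  ∀ ε : ℝ, 0 < ε → ∃ (m : ℤ) (k : ℕ), 0 < k ∧ |(k : ℝ) * x - (m : ℝ)| < ε / (k : ℝ)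

/-- A measure `μ` is exact dimensional of dimension `κ`: for `μ`-a.e. `x`,
`log μ(B(x,r))/log r → κ` as `r → 0⁺`. -/
def ExactDimensional {X : Type*} [MetricSpace X] [MeasurableSpace X]
    (μ : Measure X) (κ : ℝ) : Prop :=
  ∀ᵐ x ∂μ, Tendsto (fun r : ℝ => Real.log (μ (Metric.ball x r)).toReal / Real.log r)
    (nhdsWithin 0 (Set.Ioi 0)) (nhds κ)

set_option linter.unusedSectionVars false

section ErgodicAverages

variable {α : Type*} [MeasurableSpace α] {μ : Measure α} {T : α → α} {f : α → ℝ}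

lemma integrable_birkhoffSum (hT : MeasurePreserving T μ μ) (hf : Integrable f μ) (k : ℕ) :
    Integrable (birkhoffSum T f k) μ := by
  have : birkhoffSum T f k = ∑ i ∈ Finset.range k, f ∘ T^[i] := by
    ext x; simp [birkhoffSum]
  rw [this]
  exact integrable_finsetSum' _ fun i _ => (hT.iterate i).integrable_comp_of_integrable hf

lemma measurable_birkhoffSum (hT : Measurable T) (hf : Measurable f) (k : ℕ) :
    Measurable (birkhoffSum T f k) := by
  have : birkhoffSum T f k = fun x => ∑ i ∈ Finset.range k, f (T^[i] x) := by
    ext x; simp [birkhoffSum]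
  rw [this]
  exact Finset.measurable_sum _ fun i _ => hf.comp (hT.iterate i)

/-- The maximum of the first `n + 1` Birkhoff sums, including the empty one. -/
noncomputable def birkhoffMax (T : α → α) (f : α → ℝ) (n : ℕ) (x : α) : ℝ :=
  (Finset.range (n + 1)).sup' Finset.nonempty_range_add_one fun k => birkhoffSum T f k x

lemma birkhoffMax_nonneg (n : ℕ) (x : α) : 0 ≤ birkhoffMax T f n x := by
  refine (Finset.le_sup'_iff _).2 ⟨0, by simp, by simp⟩

lemma birkhoffMax_pos_iff (n : ℕ) (x : α) :
    0 < birkhoffMax T f n x ↔ ∃ k ≤ n, 0 < birkhoffSum T f k x := by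
  rw [birkhoffMax, Finset.lt_sup'_iff]
  simp

lemma measurable_birkhoffMax (hT : Measurable T) (hf : Measurable f) (n : ℕ) :
    Measurable (birkhoffMax T f n) := by
  have : birkhoffMax T f n =
      (Finset.range (n + 1)).sup' Finset.nonempty_range_add_one fun k => birkhoffSum T f k := by
    ext x; rw [birkhoffMax, Finset.sup'_apply]
  rw [this]
  exact Finset.measurable_sup' _ fun k _ => measurable_birkhoffSum hT hf k

lemma integrable_birkhoffMax (hT : MeasurePreserving T μ μ) (hf : Integrable f μ)
    (hfm : Measurable f) (n : ℕ) : Integrable (birkhoffMax T f n) μ := by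
  refine Integrable.mono' (g := fun x => ∑ k ∈ Finset.range (n + 1), |birkhoffSum T f k x|)
    (integrable_finsetSum _ fun k _ => (integrable_birkhoffSum hT hf k).abs)
    (measurable_birkhoffMax hT.measurable hfm n).aestronglyMeasurable (ae_of_all _ fun x => ?_)
  rw [Real.norm_of_nonneg (birkhoffMax_nonneg n x)]
  refine Finset.sup'_le _ _ fun k hk => (le_abs_self _).trans ?_
  exact Finset.single_le_sum (f := fun k => |birkhoffSum T f k x|) (fun _ _ => abs_nonneg _) hk

lemma birkhoffMax_le (n : ℕ) (x : α) (hx : 0 < birkhoffMax T f n x) :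
    birkhoffMax T f n x ≤ f x + birkhoffMax T f n (T x) := by
  obtain ⟨k, hk, hkx⟩ := Finset.exists_mem_eq_sup' (s := Finset.range (n + 1)) Finset.nonempty_range_add_one
    fun k => birkhoffSum T f k x
  have hx' : birkhoffMax T f n x = birkhoffSum T f k x := hkx
  rw [hx'] at hx ⊢
  obtain _ | k := k
  · simp at hx
  · rw [birkhoffSum_succ']
    gcongr
    refine Finset.le_sup' (fun k => birkhoffSum T f k (T x)) ?_
    simp at hk ⊢; omega

/-- Maximal ergodic theorem. -/
theorem setIntegral_nonneg_of_birkhoffSum_pos (hT : MeasurePreserving T μ μ)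
    (hf : Integrable f μ) (hfm : Measurable f) :
    0 ≤ ∫ x in {x | ∃ k, 0 < birkhoffSum T f k x}, f x ∂μ := by
  set E : ℕ → Set α := fun n => {x | 0 < birkhoffMax T f n x} with hE
  have hEm : ∀ n, MeasurableSet (E n) := fun n =>
    measurableSet_lt measurable_const (measurable_birkhoffMax hT.measurable hfm n)
  have hmono : Monotone E := by
    intro m n hmn x hx
    simp only [hE, Set.mem_ofPred_eq, birkhoffMax_pos_iff] at hx ⊢
    obtain ⟨k, hk, h⟩ := hx
    exact ⟨k, hk.trans hmn, h⟩
  have hU : {x | ∃ k, 0 < birkhoffSum T f k x} = ⋃ n, E n := by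
    ext x
    simp only [hE, Set.mem_ofPred_eq, Set.mem_iUnion, birkhoffMax_pos_iff]
    exact ⟨fun ⟨k, h⟩ => ⟨k, k, le_rfl, h⟩, fun ⟨_, k, _, h⟩ => ⟨k, h⟩⟩
  rw [hU]
  refine ge_of_tendsto' (tendsto_setIntegral_of_monotone hEm hmono hf.integrableOn) fun n => ?_
  have hM := integrable_birkhoffMax hT hf hfm n
  have hMT : Integrable (fun x => birkhoffMax T f n (T x)) μ := hT.integrable_comp_of_integrable hM
  have h1 : ∫ x in E n, birkhoffMax T f n x ∂μ = ∫ x, birkhoffMax T f n x ∂μ := by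
    refine setIntegral_eq_integral_of_forall_compl_eq_zero fun x hx => ?_
    exact le_antisymm (not_lt.1 hx) (birkhoffMax_nonneg n x)
  have h2 : ∫ x in E n, birkhoffMax T f n (T x) ∂μ ≤ ∫ x, birkhoffMax T f n (T x) ∂μ :=
    setIntegral_le_integral hMT (ae_of_all _ fun x => birkhoffMax_nonneg n (T x))
  have h3 : ∫ x, birkhoffMax T f n (T x) ∂μ = ∫ x, birkhoffMax T f n x ∂μ := by
    conv_rhs => rw [← hT.map_eq]
    rw [integral_map hT.measurable.aemeasurable]
    exact (measurable_birkhoffMax hT.measurable hfm n).aestronglyMeasurable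
  have h4 : ∫ x in E n, (birkhoffMax T f n x - birkhoffMax T f n (T x)) ∂μ ≤
      ∫ x in E n, f x ∂μ := by
    refine setIntegral_mono_on (hM.sub hMT).integrableOn hf.integrableOn (hEm n) fun x hx => ?_
    have := birkhoffMax_le n x hx
    linarith
  rw [integral_sub hM.integrableOn hMT.integrableOn] at h4
  linarith

/-- The set of points that visit `B` with frequency more than `c` up to some time. -/
def frequentSet (T : α → α) (B : Set α) (c : ℝ) : Set α :=
  {x | ∃ k : ℕ, c * k < birkhoffSum T (B.indicator 1) k x}

lemma birkhoffSum_sub_const (f : α → ℝ) (c : ℝ) (k : ℕ) (x : α) :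
    birkhoffSum T (fun y => f y - c) k x = birkhoffSum T f k x - c * k := by
  simp [birkhoffSum, Finset.sum_sub_distrib, mul_comm]

lemma measurableSet_frequentSet (hT : Measurable T) {B : Set α} (hB : MeasurableSet B) (c : ℝ) :
    MeasurableSet (frequentSet T B c) := by
  have : frequentSet T B c = ⋃ k : ℕ, {x | c * k < birkhoffSum T (B.indicator 1) k x} := by
    ext; simp [frequentSet]
  rw [this]
  exact .iUnion fun k => measurableSet_lt measurable_const
    (measurable_birkhoffSum hT (measurable_one.indicator hB) k)

/-- Weak type maximal inequality for indicator functions. -/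
theorem measureReal_frequentSet_le [IsFiniteMeasure μ] (hT : MeasurePreserving T μ μ) {B : Set α}
    (hB : MeasurableSet B) (c : ℝ) :
    c * μ.real (frequentSet T B c) ≤ μ.real B := by
  have hi : Integrable (B.indicator (1 : α → ℝ)) μ :=
    (integrable_const (1 : ℝ)).indicator hB
  have h := setIntegral_nonneg_of_birkhoffSum_pos (f := fun y => B.indicator (1 : α → ℝ) y - c) hT
    (hi.sub (integrable_const c)) ((measurable_one.indicator hB).sub_const c)
  have hE : {x | ∃ k, 0 < birkhoffSum T (fun y => B.indicator (1 : α → ℝ) y - c) k x} =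
      frequentSet T B c := by
    ext x; simp only [birkhoffSum_sub_const, sub_pos, frequentSet]
  rw [hE, integral_sub hi.integrableOn (integrable_const c), setIntegral_const,
    integral_indicator_one hB, smul_eq_mul] at h
  have : (μ.restrict (frequentSet T B c)).real B ≤ μ.real B :=
    ENNReal.toReal_mono (measure_ne_top _ _) (Measure.restrict_apply_le _ _)
  linarith

/-- The points whose Birkhoff averages oscillate strictly across `[a, b]`. -/
def oscillationSet (T : α → α) (f : α → ℝ) (a b : ℝ) : Set α :=
  {x | (∃ a' : ℚ, a' < a ∧ ∃ᶠ N in atTop, birkhoffAverage ℝ T f N x < a') ∧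
    ∃ b' : ℚ, b < b' ∧ ∃ᶠ N in atTop, b' < birkhoffAverage ℝ T f N x}

lemma tendsto_birkhoffAverage_sub (C : ℝ) (hC : ∀ x, |f x| ≤ C) (x : α) :
    Tendsto (fun N => birkhoffAverage ℝ T f N (T x) - birkhoffAverage ℝ T f N x) atTop (nhds 0) := by
  refine tendsto_birkhoffAverage_apply_sub_birkhoffAverage ℝ ?_
  exact isBounded_iff_forall_norm_le.2 ⟨C, by rintro _ ⟨n, rfl⟩; exact hC _⟩

lemma measurable_birkhoffAverage (hT : Measurable T) (hf : Measurable f) (k : ℕ) :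
    Measurable (birkhoffAverage ℝ T f k) := by
  have : birkhoffAverage ℝ T f k = fun x => (k : ℝ)⁻¹ * birkhoffSum T f k x := by
    ext x; simp [birkhoffAverage]
  rw [this]
  exact (measurable_birkhoffSum hT hf k).const_mul _

lemma measurableSet_frequently {p : ℕ → α → Prop} (hp : ∀ N, MeasurableSet {x | p N x}) :
    MeasurableSet {x | ∃ᶠ N in atTop, p N x} := by
  have : {x | ∃ᶠ N in atTop, p N x} = ⋂ m : ℕ, ⋃ N : ℕ, ⋃ _ : m ≤ N, {x | p N x} := by
    ext x; simp [frequently_atTop]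
  rw [this]
  exact .iInter fun m => .iUnion fun N => .iUnion fun _ => hp N

lemma measurableSet_oscillationSet (hT : Measurable T) (hf : Measurable f) (a b : ℝ) :
    MeasurableSet (oscillationSet T f a b) := by
  have h := measurable_birkhoffAverage hT hf
  have : oscillationSet T f a b =
      (⋃ a' : ℚ, ⋃ _ : (a' : ℝ) < a, {x | ∃ᶠ N in atTop, birkhoffAverage ℝ T f N x < a'}) ∩
      ⋃ b' : ℚ, ⋃ _ : b < (b' : ℝ), {x | ∃ᶠ N in atTop, b' < birkhoffAverage ℝ T f N x} := by
    ext x; simp [oscillationSet]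
  rw [this]
  refine .inter (.iUnion fun a' => .iUnion fun _ => ?_) (.iUnion fun b' => .iUnion fun _ => ?_)
  · exact measurableSet_frequently fun N => measurableSet_lt (h N) measurable_const
  · exact measurableSet_frequently fun N => measurableSet_lt measurable_const (h N)

lemma frequently_lt_of_tendsto_sub {u v : ℕ → ℝ} (h : Tendsto (fun N => u N - v N) atTop (nhds 0))
    {a b : ℝ} (hab : a < b) (hu : ∃ᶠ N in atTop, u N < a) : ∃ᶠ N in atTop, v N < b := by
  have h' : ∀ᶠ N in atTop, a - b < u N - v N := h.eventually (lt_mem_nhds (by linarith))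
  exact (hu.and_eventually h').mono fun N ⟨h1, h2⟩ => by linarith

lemma oscillation_of_tendsto_sub {u v : ℕ → ℝ} (h : Tendsto (fun N => u N - v N) atTop (nhds 0))
    {a b : ℝ} (hu : (∃ a' : ℚ, a' < a ∧ ∃ᶠ N in atTop, u N < a') ∧
      ∃ b' : ℚ, b < b' ∧ ∃ᶠ N in atTop, b' < u N) :
    (∃ a' : ℚ, a' < a ∧ ∃ᶠ N in atTop, v N < a') ∧
      ∃ b' : ℚ, b < b' ∧ ∃ᶠ N in atTop, b' < v N := by
  obtain ⟨⟨a', ha, hfa⟩, ⟨b', hb, hfb⟩⟩ := hu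
  obtain ⟨a1, h1, h2⟩ := exists_rat_btwn ha
  obtain ⟨b1, h3, h4⟩ := exists_rat_btwn hb
  refine ⟨⟨a1, h2, frequently_lt_of_tendsto_sub h h1 hfa⟩, ⟨b1, h3, ?_⟩⟩
  have h' : Tendsto (fun N => -u N - -v N) atTop (nhds 0) := by
    have := h.neg; simp only [neg_zero] at this
    exact this.congr fun N => by ring
  have := frequently_lt_of_tendsto_sub h' (neg_lt_neg h4) (hfb.mono fun N h => neg_lt_neg h)
  exact this.mono fun N h => neg_lt_neg_iff.1 h

lemma preimage_oscillationSet (C : ℝ) (hC : ∀ x, |f x| ≤ C) (a b : ℝ) :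
    T ⁻¹' oscillationSet T f a b = oscillationSet T f a b := by
  ext x
  have h := tendsto_birkhoffAverage_sub (T := T) C hC x
  refine ⟨fun hx => oscillation_of_tendsto_sub h hx, fun hx => oscillation_of_tendsto_sub ?_ hx⟩
  have := h.neg; simp only [neg_zero] at this
  exact this.congr fun N => by ring

lemma exists_birkhoffSum_pos_of_frequently {b b' : ℝ} (hb : b < b') {x : α}
    (h : ∃ᶠ N in atTop, b' < birkhoffAverage ℝ T f N x) :
    ∃ k, 0 < birkhoffSum T (fun y => f y - b) k x := by
  obtain ⟨N, hN, hN0⟩ := (h.and_eventually (eventually_gt_atTop 0)).exists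
  refine ⟨N, ?_⟩
  rw [birkhoffSum_sub_const]
  have hN' : (0 : ℝ) < N := by exact_mod_cast hN0
  have : b < (N : ℝ)⁻¹ * birkhoffSum T f N x := hb.trans (by simpa [birkhoffAverage] using hN)
  rw [inv_mul_eq_div, lt_div_iff₀ hN'] at this
  linarith

lemma measure_oscillationSet [IsFiniteMeasure μ] (hT : MeasurePreserving T μ μ)
    (hfm : Measurable f) (C : ℝ) (hC : ∀ x, |f x| ≤ C) {a b : ℝ} (hab : a < b) :
    μ (oscillationSet T f a b) = 0 := by
  set E := oscillationSet T f a b with hEdef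
  have hEm : MeasurableSet E := measurableSet_oscillationSet hT.measurable hfm a b
  have hTE : MeasurePreserving T (μ.restrict E) (μ.restrict E) := by
    have := hT.restrict_preimage hEm
    rwa [preimage_oscillationSet C hC] at this
  have hf : Integrable f (μ.restrict E) :=
    Integrable.of_bound hfm.aestronglyMeasurable C (ae_of_all _ hC)
  have key : ∀ (g : α → ℝ), Measurable g → Integrable g (μ.restrict E) →
      (∀ x ∈ E, ∃ k, 0 < birkhoffSum T g k x) → 0 ≤ ∫ x in E, g x ∂μ := by
    intro g hgm hg hx
    have h := setIntegral_nonneg_of_birkhoffSum_pos hTE hg hgm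
    have hm : MeasurableSet {x | ∃ k, 0 < birkhoffSum T g k x} := by
      have : {x | ∃ k, 0 < birkhoffSum T g k x} = ⋃ k, {x | 0 < birkhoffSum T g k x} := by
        ext; simp
      rw [this]
      exact .iUnion fun k => measurableSet_lt measurable_const
        (measurable_birkhoffSum hT.measurable hgm k)
    have hx' : {x | ∃ k, 0 < birkhoffSum T g k x} ∩ E = E := Set.inter_eq_right.2 hx
    rwa [Measure.restrict_restrict hm, hx'] at h
  have h1 : 0 ≤ ∫ x in E, (f x - b) ∂μ :=
    key _ (hfm.sub_const b) (hf.sub (integrable_const b)) fun x hx => by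
      obtain ⟨b', hb, h⟩ := hx.2
      exact exists_birkhoffSum_pos_of_frequently hb h
  have h2 : 0 ≤ ∫ x in E, (-f x - -a) ∂μ :=
    key _ (hfm.neg.sub_const (-a)) (hf.fun_neg.sub (integrable_const (-a))) fun x hx => by
      obtain ⟨a', ha, h⟩ := hx.1
      refine exists_birkhoffSum_pos_of_frequently (b' := -a') (neg_lt_neg ha) (h.mono fun N h => ?_)
      have : birkhoffAverage ℝ T (fun y => -f y) N x = -birkhoffAverage ℝ T f N x := by
        simp [birkhoffAverage, birkhoffSum]
      rw [this]; exact neg_lt_neg h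
  rw [integral_sub hf (integrable_const b), setIntegral_const, smul_eq_mul] at h1
  rw [integral_sub hf.fun_neg (integrable_const (-a)), setIntegral_const, integral_neg, smul_eq_mul] at h2
  have h3 : 0 ≤ μ.real E := measureReal_nonneg
  have h4 : μ.real E = 0 := by nlinarith
  exact (measureReal_eq_zero_iff).1 h4

lemma abs_birkhoffAverage_le (C : ℝ) (hC : ∀ x, |f x| ≤ C) (N : ℕ) (x : α) :
    |birkhoffAverage ℝ T f N x| ≤ C := by
  have hC0 : 0 ≤ C := (abs_nonneg _).trans (hC x)
  rcases Nat.eq_zero_or_pos N with rfl | hN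
  · simpa using hC0
  have hN' : (0 : ℝ) < N := by exact_mod_cast hN
  have h : |birkhoffSum T f N x| ≤ N * C := by
    refine (Finset.abs_sum_le_sum_abs _ _).trans ((Finset.sum_le_sum fun i _ => hC _).trans ?_)
    simp
  rw [birkhoffAverage, smul_eq_mul, abs_mul, abs_of_pos (inv_pos.2 hN'), inv_mul_le_iff₀ hN']
  exact h

/-- Birkhoff's pointwise ergodic theorem for bounded functions. -/
theorem ae_exists_tendsto_birkhoffAverage [IsFiniteMeasure μ] (hT : MeasurePreserving T μ μ)
    (hfm : Measurable f) (C : ℝ) (hC : ∀ x, |f x| ≤ C) :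
    ∀ᵐ x ∂μ, ∃ l, Tendsto (fun N => birkhoffAverage ℝ T f N x) atTop (nhds l) := by
  have h : ∀ᵐ x ∂μ, ∀ a b : ℚ, a < b → x ∉ oscillationSet T f a b := by
    simp only [ae_all_iff]
    intro a b hab
    exact measure_eq_zero_iff_ae_notMem.1
      (measure_oscillationSet hT hfm C hC (by exact_mod_cast hab))
  filter_upwards [h] with x hx
  refine tendsto_of_no_upcrossings (s := Set.range ((↑) : ℚ → ℝ)) Rat.denseRange_cast ?_ ?_ ?_
  · rintro _ ⟨a, rfl⟩ _ ⟨b, rfl⟩ hab ⟨h1, h2⟩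
    obtain ⟨a1, h3, h4⟩ := exists_rat_btwn hab
    obtain ⟨b1, h5, h6⟩ := exists_rat_btwn h4
    exact hx a1 b1 (by exact_mod_cast h5) ⟨⟨a, h3, h1⟩, ⟨b, h6, h2⟩⟩
  · exact isBoundedUnder_of ⟨C, fun N => (abs_le.1 (abs_birkhoffAverage_le C hC N x)).2⟩
  · exact isBoundedUnder_of ⟨-C, fun N => (abs_le.1 (abs_birkhoffAverage_le C hC N x)).1⟩

end ErgodicAverages

section LatticeSpace

open Matrix Topology

/-- The group `SL(2, ℝ)`. -/
abbrev SLR := SpecialLinearGroup (Fin 2) ℝ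

/-- The subgroup of integer matrices of `SL(2, ℝ)`. -/
def integerSubgroup : Subgroup SLR := (SpecialLinearGroup.map (Int.castRingHom ℝ)).range

/-- The set of all integer matrices. -/
def integerMatrices : Set (Matrix (Fin 2) (Fin 2) ℝ) :=
  Set.range fun M : Matrix (Fin 2) (Fin 2) ℤ => M.map ((↑) : ℤ → ℝ)

lemma isClosed_of_subset_integerMatrices {A : Set (Matrix (Fin 2) (Fin 2) ℝ)}
    (hA : A ⊆ integerMatrices) : IsClosed A := by
  have he : IsClosedEmbedding fun M : Matrix (Fin 2) (Fin 2) ℤ => M.map ((↑) : ℤ → ℝ) := by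
    refine ⟨(Int.isClosedEmbedding_coe_real.isEmbedding).matrix_map, ?_⟩
    have : Set.range (fun M : Matrix (Fin 2) (Fin 2) ℤ => M.map ((↑) : ℤ → ℝ)) =
        ⋂ i, ⋂ j, {M : Matrix (Fin 2) (Fin 2) ℝ | M i j ∈ Set.range ((↑) : ℤ → ℝ)} := by
      ext M
      simp only [Set.mem_range, Set.mem_iInter, Set.mem_ofPred_eq]
      constructor
      · rintro ⟨N, rfl⟩ i j
        exact ⟨N i j, rfl⟩
      · intro h
        choose N hN using h
        exact ⟨fun i j => N i j, by ext i j; exact hN i j⟩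
    rw [this]
    refine isClosed_iInter fun i => isClosed_iInter fun j => ?_
    exact Int.isClosedEmbedding_coe_real.isClosed_range.preimage
      ((continuous_apply j).comp (continuous_apply i))
  obtain ⟨B, rfl⟩ := Set.subset_range_iff_exists_image_eq.1 hA
  exact he.isClosedMap _ (isClosed_discrete B)

lemma mem_integerSubgroup_iff {g : SLR} :
    g ∈ integerSubgroup ↔ (g : Matrix (Fin 2) (Fin 2) ℝ) ∈ integerMatrices := by
  constructor
  · rintro ⟨γ, rfl⟩
    exact ⟨γ, rfl⟩
  · rintro ⟨M, hM⟩
    have hdet : M.det = 1 := by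
      have h1 : ((M.det : ℤ) : ℝ) = 1 := by
        rw [← g.det_coe, ← hM]
        simp [Matrix.det_fin_two]
      exact_mod_cast h1
    exact ⟨⟨M, hdet⟩, by ext i j; exact congrFun (congrFun hM i) j⟩

lemma isClosed_integerSubgroup : IsClosed (integerSubgroup : Set SLR) := by
  have : (integerSubgroup : Set SLR) = Subtype.val ⁻¹' integerMatrices := by
    ext g; exact mem_integerSubgroup_iff
  rw [this]
  exact (isClosed_of_subset_integerMatrices subset_rfl).preimage continuous_subtype_val

instance : LocallyCompactSpace (Matrix (Fin 2) (Fin 2) ℝ) :=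
  inferInstanceAs (LocallyCompactSpace (Fin 2 → Fin 2 → ℝ))

instance : SecondCountableTopology (Matrix (Fin 2) (Fin 2) ℝ) :=
  inferInstanceAs (SecondCountableTopology (Fin 2 → Fin 2 → ℝ))

instance : LocallyCompactSpace SLR :=
  SpecialLinearGroup.isClosedEmbedding_val.locallyCompactSpace

instance : SecondCountableTopology SLR :=
  SpecialLinearGroup.isClosedEmbedding_val.isEmbedding.secondCountableTopology

/-- The space of unimodular lattices in the plane. -/
def LatticeSpace : Type := SLR ⧸ integerSubgroup

namespace LatticeSpace

/-- The lattice spanned by the columns of a matrix. -/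
def mk (g : SLR) : LatticeSpace := QuotientGroup.mk g

instance : TopologicalSpace LatticeSpace :=
  inferInstanceAs (TopologicalSpace (SLR ⧸ integerSubgroup))

instance : MulAction SLR LatticeSpace :=
  inferInstanceAs (MulAction SLR (SLR ⧸ integerSubgroup))

instance : ContinuousSMul SLR LatticeSpace :=
  inferInstanceAs (ContinuousSMul SLR (SLR ⧸ integerSubgroup))

instance : T2Space LatticeSpace := by
  have := isClosed_integerSubgroup
  exact inferInstanceAs (T2Space (SLR ⧸ integerSubgroup))

instance : LocallyCompactSpace LatticeSpace :=
  inferInstanceAs (LocallyCompactSpace (SLR ⧸ integerSubgroup))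

instance : SecondCountableTopology LatticeSpace :=
  inferInstanceAs (SecondCountableTopology (SLR ⧸ integerSubgroup))

instance : MeasurableSpace LatticeSpace := borel _

instance : BorelSpace LatticeSpace := ⟨rfl⟩

lemma isOpenQuotientMap_mk : IsOpenQuotientMap mk := QuotientGroup.isOpenQuotientMap_mk

lemma continuous_mk : Continuous mk := isOpenQuotientMap_mk.continuous

lemma mk_surjective : Function.Surjective mk := isOpenQuotientMap_mk.surjective

@[simp] lemma smul_mk (g h : SLR) : g • mk h = mk (g * h) := rfl

lemma mk_eq_mk_iff {g h : SLR} : mk g = mk h ↔ g⁻¹ * h ∈ integerSubgroup :=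
  QuotientGroup.eq

lemma mk_mul_of_mem (g : SLR) {γ : SLR} (hγ : γ ∈ integerSubgroup) : mk (g * γ) = mk g := by
  rw [eq_comm, mk_eq_mk_iff]; simpa using hγ

/-- The squared length of the lattice vector with integer coordinates `p, q` in the basis
given by the columns of `g`. -/
def sqLength (g : SLR) (p q : ℤ) : ℝ :=
  (g 0 0 * p + g 0 1 * q) ^ 2 + (g 1 0 * p + g 1 1 * q) ^ 2

lemma continuous_entry (i j : Fin 2) : Continuous fun g : SLR => g i j :=
  continuous_subtype_val.matrix_elem i j

lemma continuous_sqLength (p q : ℤ) : Continuous fun g : SLR => sqLength g p q := by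
  have := continuous_entry
  unfold sqLength
  exact ((((this 0 0).mul_const _).add ((this 0 1).mul_const _)).pow 2).add
    ((((this 1 0).mul_const _).add ((this 1 1).mul_const _)).pow 2)

/-- The lattices whose nonzero vectors have squared length at least `δ`. -/
def thick (δ : ℝ) : Set LatticeSpace :=
  {x | ∀ g, mk g = x → ∀ p q : ℤ, (p ≠ 0 ∨ q ≠ 0) → δ ≤ sqLength g p q}

lemma det_eq (g : SLR) : g 0 0 * g 1 1 - g 0 1 * g 1 0 = 1 := by
  have := g.det_coe; rwa [Matrix.det_fin_two] at this

lemma mul_apply_fin_two (g h : SLR) (i j : Fin 2) :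
    (g * h) i j = g i 0 * h 0 j + g i 1 * h 1 j := by
  simp [Matrix.mul_apply, Fin.sum_univ_two]

lemma mk_mem_thick_iff {δ : ℝ} {g : SLR} :
    mk g ∈ thick δ ↔ ∀ p q : ℤ, (p ≠ 0 ∨ q ≠ 0) → δ ≤ sqLength g p q := by
  refine ⟨fun h => h g rfl, fun h g' hg' p q hpq => ?_⟩
  obtain ⟨γ, hγ⟩ := mk_eq_mk_iff.1 hg'.symm
  have hg : g' = g * SpecialLinearGroup.map (Int.castRingHom ℝ) γ := by rw [hγ]; group
  have hd : γ 0 0 * γ 1 1 - γ 0 1 * γ 1 0 = 1 := by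
    have := γ.det_coe; rwa [Matrix.det_fin_two] at this
  have h' := h (γ 0 0 * p + γ 0 1 * q) (γ 1 0 * p + γ 1 1 * q) (by
    by_contra! hc
    have hp : p = 0 := by linear_combination (γ 1 1) * hc.1 - (γ 0 1) * hc.2 - p * hd
    have hq : q = 0 := by linear_combination (γ 0 0) * hc.2 - (γ 1 0) * hc.1 - q * hd
    tauto)
  refine h'.trans (le_of_eq ?_)
  subst hg
  simp only [sqLength, mul_apply_fin_two]
  simp
  ring

lemma isClosed_thick (δ : ℝ) : IsClosed (thick δ) := by
  rw [← isOpenQuotientMap_mk.isQuotientMap.isClosed_preimage]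
  have : mk ⁻¹' thick δ =
      ⋂ p : ℤ, ⋂ q : ℤ, ⋂ _ : p ≠ 0 ∨ q ≠ 0, {g : SLR | δ ≤ sqLength g p q} := by
    ext g; simp only [Set.mem_preimage, mk_mem_thick_iff, Set.mem_iInter, Set.mem_ofPred_eq]
  rw [this]
  exact isClosed_iInter fun p => isClosed_iInter fun q => isClosed_iInter fun _ =>
    isClosed_le continuous_const (continuous_sqLength p q)

lemma thick_anti {δ δ' : ℝ} (h : δ ≤ δ') : thick δ' ⊆ thick δ :=
  fun _ hx g hg p q hpq => h.trans (hx g hg p q hpq)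

/-- The matrices whose entries are bounded by `C`. -/
def boundedMatrices (C : ℝ) : Set SLR := {g | ∀ i j, |g i j| ≤ C}

lemma isCompact_boundedMatrices (C : ℝ) : IsCompact (boundedMatrices C) := by
  have h : IsCompact (Set.univ.pi fun _ : Fin 2 => Set.univ.pi fun _ : Fin 2 => Set.Icc (-C) C) :=
    isCompact_univ_pi fun _ => isCompact_univ_pi fun _ => isCompact_Icc
  have he : {M : Matrix (Fin 2) (Fin 2) ℝ | ∀ i j, |M i j| ≤ C} =
      Set.univ.pi fun _ : Fin 2 => Set.univ.pi fun _ : Fin 2 => Set.Icc (-C) C := by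
    ext M
    simp only [abs_le]
    exact ⟨fun h i _ j _ => h i j, fun h i j => h i trivial j trivial⟩
  rw [← he] at h
  exact SpecialLinearGroup.isClosedEmbedding_val.isCompact_preimage h

open UpperHalfPlane in
/-- Every unimodular lattice has a reduced basis. -/
lemma exists_reduced (g : SLR) : ∃ g', mk g' = mk g ∧
    |g' 0 0 * g' 0 1 + g' 1 0 * g' 1 1| ≤ (g' 0 1 ^ 2 + g' 1 1 ^ 2) / 2 ∧
    g' 0 1 ^ 2 + g' 1 1 ^ 2 ≤ 2 := by
  obtain ⟨γ, hγ⟩ := ModularGroup.exists_smul_mem_fd (g.transpose • UpperHalfPlane.I)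
  set γ' : SLR := SpecialLinearGroup.map (Int.castRingHom ℝ) γ with hγ'
  set h : SLR := γ' * g.transpose with hh
  have hz : γ • (g.transpose • UpperHalfPlane.I) = h • UpperHalfPlane.I := by
    rw [hh, mul_smul]; rfl
  rw [hz] at hγ
  have hd := det_eq h
  set r := h 1 0 ^ 2 + h 1 1 ^ 2 with hr
  have hr0 : 0 < r := by
    rcases eq_or_ne (h 1 0) 0 with h0 | h0
    · have : h 1 1 ≠ 0 := by rintro h1; simp [h0, h1] at hd
      positivity
    · positivity
  have hc : ((h • UpperHalfPlane.I : UpperHalfPlane) : ℂ) =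
      ⟨(h 0 0 * h 1 0 + h 0 1 * h 1 1) / r, 1 / r⟩ := by
    rw [coe_specialLinearGroup_apply, div_eq_iff]
    · apply Complex.ext
      · simp
        field_simp
        rw [hr]
        linear_combination (-h 1 0) * hd
      · simp
        field_simp
        rw [hr]
        linear_combination (h 1 1) * hd
    · intro h0
      have h1 := congrArg Complex.re h0
      have h2 := congrArg Complex.im h0
      simp at h1 h2
      simp [h1, h2] at hr
      exact hr0.ne' hr
  obtain ⟨h1, h2⟩ := hγ
  rw [← UpperHalfPlane.coe_re, hc] at h2
  rw [hc, Complex.normSq_mk] at h1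
  simp only at h1 h2
  refine ⟨h.transpose, ?_, ?_, ?_⟩
  · have : h.transpose = g * γ'.transpose := by
      ext i j; simp [hh, Matrix.mul_apply, mul_comm]
    rw [this]
    refine mk_mul_of_mem _ ⟨γ.transpose, ?_⟩
    ext i j; simp [hγ']
  · simp only [SpecialLinearGroup.coe_transpose, Matrix.transpose_apply]
    rw [← hr]
    rw [abs_div, abs_of_pos hr0, div_le_iff₀ hr0] at h2
    linarith
  · simp only [SpecialLinearGroup.coe_transpose, Matrix.transpose_apply]
    rw [← hr]
    have h3 : (h 0 0 * h 1 0 + h 0 1 * h 1 1) / r * ((h 0 0 * h 1 0 + h 0 1 * h 1 1) / r) ≤ 1 / 4 := by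
      have := abs_le.1 h2
      nlinarith
    have h4 : 3 / 4 ≤ 1 / r * (1 / r) := by linarith
    have h5 : 3 / 4 * (r * r) ≤ 1 := by
      calc 3 / 4 * (r * r) ≤ 1 / r * (1 / r) * (r * r) := by gcongr
        _ = 1 := by field_simp
    nlinarith

lemma exists_mem_boundedMatrices {δ : ℝ} (hδ : 0 < δ) {x : LatticeSpace} (hx : x ∈ thick δ) :
    ∃ g ∈ boundedMatrices (2 + 1 / δ), mk g = x := by
  obtain ⟨g, rfl⟩ := mk_surjective x
  obtain ⟨g', h1, h2, h3⟩ := exists_reduced g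
  refine ⟨g', ?_, h1⟩
  rw [← h1, mk_mem_thick_iff] at hx
  have h4 := hx 0 1 (by simp)
  simp only [sqLength, Int.cast_zero, mul_zero, Int.cast_one, mul_one, zero_add] at h4
  have hd := det_eq g'
  set s := g' 0 1 ^ 2 + g' 1 1 ^ 2 with hs
  set t := g' 0 0 ^ 2 + g' 1 0 ^ 2 with ht
  have h5 : t * s = (g' 0 0 * g' 0 1 + g' 1 0 * g' 1 1) ^ 2 + 1 := by
    rw [hs, ht]; linear_combination (g' 0 0 * g' 1 1 - g' 0 1 * g' 1 0 + 1) * hd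
  have h6 : (g' 0 0 * g' 0 1 + g' 1 0 * g' 1 1) ^ 2 ≤ (s / 2) ^ 2 := sq_le_sq' 
    (by linarith [(abs_le.1 h2).1]) (abs_le.1 h2).2
  have hs0 : 0 < s := hδ.trans_le h4
  have h7 : t ≤ s / 4 + 1 / s := by
    have : t * s ≤ (s / 4 + 1 / s) * s := by
      have : (s / 4 + 1 / s) * s = s ^ 2 / 4 + 1 := by field_simp
      rw [this]; linarith
    exact le_of_mul_le_mul_right this hs0
  have h8 : 1 / s ≤ 1 / δ := one_div_le_one_div_of_le hδ h4
  have hδ' : 0 < 1 / δ := by positivity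
  have key : ∀ y : ℝ, y ^ 2 ≤ 2 + 1 / δ → |y| ≤ 2 + 1 / δ := fun y hy => by
    refine abs_le_of_sq_le_sq (hy.trans ?_) (by positivity)
    nlinarith
  intro i j
  fin_cases i <;> fin_cases j <;> refine key _ ?_ <;> simp only [Fin.zero_eta, Fin.mk_one]
  · nlinarith [sq_nonneg (g' 1 0)]
  · nlinarith [sq_nonneg (g' 1 1)]
  · nlinarith [sq_nonneg (g' 0 0)]
  · nlinarith [sq_nonneg (g' 0 1)]

/-- Mahler's compactness criterion. -/
lemma isCompact_thick {δ : ℝ} (hδ : 0 < δ) : IsCompact (thick δ) :=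
  ((isCompact_boundedMatrices (2 + 1 / δ)).image continuous_mk).of_isClosed_subset
    (isClosed_thick δ) fun _ hx => exists_mem_boundedMatrices hδ hx

end LatticeSpace
end LatticeSpace

section LatticeFlow

open Matrix Topology LatticeSpace

/-- Unipotent upper triangular matrices. -/
def unip (s : ℝ) : SLR := ⟨!![1, s; 0, 1], by simp⟩

/-- Diagonal matrices. -/
noncomputable def diagMat (t : ℝ) : SLR :=
  ⟨!![Real.exp t, 0; 0, Real.exp (-t)], by simp [← Real.exp_add]⟩

@[simp] lemma unip_apply_zero_zero (s : ℝ) : unip s 0 0 = 1 := rfl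
@[simp] lemma unip_apply_zero_one (s : ℝ) : unip s 0 1 = s := rfl
@[simp] lemma unip_apply_one_zero (s : ℝ) : unip s 1 0 = 0 := rfl
@[simp] lemma unip_apply_one_one (s : ℝ) : unip s 1 1 = 1 := rfl
@[simp] lemma diagMat_apply_zero_zero (s : ℝ) : diagMat s 0 0 = Real.exp s := rfl
@[simp] lemma diagMat_apply_zero_one (s : ℝ) : diagMat s 0 1 = 0 := rfl
@[simp] lemma diagMat_apply_one_zero (s : ℝ) : diagMat s 1 0 = 0 := rfl
@[simp] lemma diagMat_apply_one_one (s : ℝ) : diagMat s 1 1 = Real.exp (-s) := rfl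

lemma SLR_ext {g h : SLR} (h00 : g 0 0 = h 0 0) (h01 : g 0 1 = h 0 1) (h10 : g 1 0 = h 1 0)
    (h11 : g 1 1 = h 1 1) : g = h := by
  ext i j; fin_cases i <;> fin_cases j <;> assumption

lemma unip_add (s t : ℝ) : unip (s + t) = unip s * unip t := by
  apply SLR_ext <;> simp only [mul_apply_fin_two] <;> simp [add_comm]

@[simp] lemma unip_zero : unip 0 = 1 := by
  apply SLR_ext <;> simp

lemma unip_neg (s : ℝ) : unip (-s) = (unip s)⁻¹ := by
  rw [eq_comm, inv_eq_iff_mul_eq_one, ← unip_add]; simp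

lemma diagMat_add (s t : ℝ) : diagMat (s + t) = diagMat s * diagMat t := by
  apply SLR_ext <;> simp only [mul_apply_fin_two] <;> simp [Real.exp_add, mul_comm]

@[simp] lemma diagMat_zero : diagMat 0 = 1 := by
  apply SLR_ext <;> simp

lemma diagMat_neg (s : ℝ) : diagMat (-s) = (diagMat s)⁻¹ := by
  rw [eq_comm, inv_eq_iff_mul_eq_one, ← diagMat_add]; simp

lemma continuous_of_entries {α : Type*} [TopologicalSpace α] {f : α → SLR}
    (h : ∀ i j, Continuous fun x => f x i j) : Continuous f :=
  continuous_induced_rng.2 (continuous_matrix h)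

lemma continuous_unip : Continuous unip := by
  refine continuous_of_entries fun i j => ?_
  fin_cases i <;> fin_cases j <;> simp [continuous_const, continuous_id']

lemma unip_intCast_mem (m : ℤ) : unip m ∈ integerSubgroup := by
  rw [mem_integerSubgroup_iff]
  refine ⟨!![1, m; 0, 1], ?_⟩
  ext i j; fin_cases i <;> fin_cases j <;> simp [unip]

/-- The expanding diagonal matrix with eigenvalues `√b` and `1 / √b`. -/
noncomputable def dil (b : ℕ) : SLR := diagMat (Real.log b / 2)

lemma dil_zpow (b : ℕ) (k : ℤ) : dil b ^ k = diagMat (k * (Real.log b / 2)) := by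
  have hn : ∀ k : ℕ, dil b ^ k = diagMat (k * (Real.log b / 2)) := by
    intro k
    induction k with
    | zero => simp
    | succ k ih => rw [pow_succ, ih, dil, ← diagMat_add]; push_cast; ring_nf
  obtain ⟨m, rfl | rfl⟩ := k.eq_nat_or_neg
  · simpa using hn m
  · rw [_root_.zpow_neg, zpow_natCast, hn, ← diagMat_neg]; push_cast; ring_nf

lemma exp_mul_log_half {b : ℕ} (hb : 0 < b) (k : ℤ) :
    Real.exp (k * (Real.log b / 2)) * Real.exp (k * (Real.log b / 2)) = (b : ℝ) ^ k := by
  have hb' : (0 : ℝ) < b := by exact_mod_cast hb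
  rw [← Real.exp_add, ← Real.rpow_intCast, Real.rpow_def_of_pos hb']
  ring_nf

lemma dil_zpow_mul_unip {b : ℕ} (hb : 0 < b) (k : ℤ) (s : ℝ) :
    dil b ^ k * unip s = unip ((b : ℝ) ^ k * s) * dil b ^ k := by
  rw [dil_zpow, ← exp_mul_log_half hb]
  apply SLR_ext <;> simp only [mul_apply_fin_two] <;> simp [Real.exp_neg]
  field_simp

lemma dil_zpow_conj {b : ℕ} (hb : 0 < b) (k : ℤ) (g : SLR) :
    (dil b ^ k * g * (dil b ^ k)⁻¹) 0 0 = g 0 0 ∧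
    (dil b ^ k * g * (dil b ^ k)⁻¹) 0 1 = (b : ℝ) ^ k * g 0 1 ∧
    (dil b ^ k * g * (dil b ^ k)⁻¹) 1 0 = ((b : ℝ) ^ k)⁻¹ * g 1 0 ∧
    (dil b ^ k * g * (dil b ^ k)⁻¹) 1 1 = g 1 1 := by
  rw [dil_zpow, ← diagMat_neg, ← exp_mul_log_half hb]
  simp only [mul_apply_fin_two]
  refine ⟨?_, ?_, ?_, ?_⟩ <;> simp [Real.exp_neg] <;> field_simp

/-- The lattices whose forward orbit under `dil b` stays in `thick δ`. -/
def forwardThick (b : ℕ) (δ : ℝ) : Set LatticeSpace :=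
  {x | ∀ k : ℕ, dil b ^ k • x ∈ thick δ}

lemma isClosed_forwardThick (b : ℕ) (δ : ℝ) : IsClosed (forwardThick b δ) := by
  have : forwardThick b δ = ⋂ k : ℕ, (fun x => dil b ^ k • x) ⁻¹' thick δ := by
    ext; simp [forwardThick]
  rw [this]
  exact isClosed_iInter fun k => (isClosed_thick δ).preimage (continuous_const_smul _)

lemma forwardThick_subset (b : ℕ) (δ : ℝ) : forwardThick b δ ⊆ thick δ := fun x hx => by
  simpa using hx 0

lemma isCompact_forwardThick (b : ℕ) {δ : ℝ} (hδ : 0 < δ) : IsCompact (forwardThick b δ) :=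
  (isCompact_thick hδ).of_isClosed_subset (isClosed_forwardThick b δ) (forwardThick_subset b δ)

lemma pow_smul_mem_forwardThick {b : ℕ} {δ : ℝ} {x : LatticeSpace} (hx : x ∈ forwardThick b δ)
    (k : ℕ) : dil b ^ k • x ∈ forwardThick b δ := fun m => by
  rw [← mul_smul, ← pow_add]; exact hx _

lemma sqLength_dil_unip {b : ℕ} (hb : 0 < b) (k : ℤ) (s : ℝ) (g : SLR) (p q : ℤ) :
    sqLength (dil b ^ k * (unip s * g)) p q =
      (b : ℝ) ^ k * ((g 0 0 * p + g 0 1 * q) + s * (g 1 0 * p + g 1 1 * q)) ^ 2 +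
        ((b : ℝ) ^ k)⁻¹ * (g 1 0 * p + g 1 1 * q) ^ 2 := by
  rw [dil_zpow, ← exp_mul_log_half hb]
  simp only [sqLength, mul_apply_fin_two]
  simp [Real.exp_neg]
  field_simp
  ring

lemma exists_hole {b : ℕ} (hb : 2 ≤ b) {δ : ℝ} (hδ : 0 < δ) :
    ∃ R η : ℝ, 0 < R ∧ 0 < η ∧ ∀ x ∈ thick δ, ∃ s₀, |s₀| ≤ R ∧
      ∀ s, |s - s₀| ≤ η → unip s • x ∉ forwardThick b δ := by
  set C : ℝ := 2 + 1 / δ with hC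
  have hC1 : 0 < C := by positivity
  have hb1 : (1 : ℝ) < b := by exact_mod_cast (by omega : 1 < b)
  obtain ⟨k, hk⟩ := pow_unbounded_of_one_lt (2 * C ^ 2 / δ) hb1
  have hbk : 0 < (b : ℝ) ^ k := by positivity
  have hk2 : ((b : ℝ) ^ k)⁻¹ * C ^ 2 < δ / 2 := by
    rw [inv_mul_lt_iff₀ hbk]
    rw [div_lt_iff₀ hδ] at hk
    linarith
  obtain ⟨η, hη0, hη⟩ : ∃ η : ℝ, 0 < η ∧ (b : ℝ) ^ k * (η ^ 2 * C ^ 2) < δ / 2 := by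
    have : Tendsto (fun η : ℝ => (b : ℝ) ^ k * (η ^ 2 * C ^ 2)) (𝓝[>] 0) (𝓝 0) := by
      have h : Continuous fun η : ℝ => (b : ℝ) ^ k * (η ^ 2 * C ^ 2) := by fun_prop
      have := h.tendsto 0
      simp at this
      exact this.mono_left nhdsWithin_le_nhds
    obtain ⟨η, h1, h2⟩ := ((this.eventually (gt_mem_nhds (half_pos hδ))).and
      self_mem_nhdsWithin).exists
    exact ⟨η, h2, h1⟩
  refine ⟨2 * C ^ 2, η, by positivity, hη0, fun x hx => ?_⟩
  obtain ⟨g, hg, rfl⟩ := exists_mem_boundedMatrices hδ hx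
  have key : ∃ p q : ℤ, (p ≠ 0 ∨ q ≠ 0) ∧ |g 0 0 * p + g 0 1 * q| ≤ C ∧
      |g 1 0 * p + g 1 1 * q| ≤ C ∧ 1 / (2 * C) ≤ |g 1 0 * p + g 1 1 * q| := by
    by_contra! hcon
    have h1 := hcon 1 0 (by simp)
      (by simpa only [Int.cast_one, Int.cast_zero, mul_one, mul_zero, add_zero, zero_add] using hg 0 0)
      (by simpa only [Int.cast_one, Int.cast_zero, mul_one, mul_zero, add_zero, zero_add] using hg 1 0)
    have h2 := hcon 0 1 (by simp)
      (by simpa only [Int.cast_one, Int.cast_zero, mul_one, mul_zero, add_zero, zero_add] using hg 0 1)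
      (by simpa only [Int.cast_one, Int.cast_zero, mul_one, mul_zero, add_zero, zero_add] using hg 1 1)
    simp at h1 h2
    have hd := det_eq g
    have h3 : |g 0 0 * g 1 1 - g 0 1 * g 1 0| ≤ |g 0 0| * |g 1 1| + |g 0 1| * |g 1 0| := by
      rw [← abs_mul, ← abs_mul]; exact abs_sub _ _
    rw [hd, abs_one] at h3
    have h4 : |g 0 0| * |g 1 1| ≤ C * |g 1 1| := by gcongr; exact hg 0 0
    have h5 : |g 0 1| * |g 1 0| ≤ C * |g 1 0| := by gcongr; exact hg 0 1
    have h6 : C * |g 1 1| < 1 / 2 := by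
      calc C * |g 1 1| < C * (C⁻¹ * 2⁻¹) := by gcongr
        _ = 1 / 2 := by field_simp
    have h7 : C * |g 1 0| < 1 / 2 := by
      calc C * |g 1 0| < C * (C⁻¹ * 2⁻¹) := by gcongr
        _ = 1 / 2 := by field_simp
    linarith
  obtain ⟨p, q, hpq, h1, h2, h3⟩ := key
  set v := g 0 0 * p + g 0 1 * q with hv
  set w := g 1 0 * p + g 1 1 * q with hw
  have hw0 : 0 < |w| := lt_of_lt_of_le (by positivity) h3
  have hw1 : w ≠ 0 := abs_pos.1 hw0
  refine ⟨-v / w, ?_, fun s hs hmem => ?_⟩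
  · rw [abs_div, abs_neg, div_le_iff₀ hw0]
    calc |v| ≤ C := h1
      _ = 2 * C ^ 2 * (1 / (2 * C)) := by field_simp
      _ ≤ 2 * C ^ 2 * |w| := by gcongr
  · have h4 := hmem k
    rw [smul_mk, smul_mk, mk_mem_thick_iff] at h4
    have h5 := h4 p q hpq
    have h6 := sqLength_dil_unip (by omega : 0 < b) k s g p q
    rw [zpow_natCast, zpow_natCast, ← hv, ← hw] at h6
    rw [h6] at h5
    have h7 : v + s * w = (s - -v / w) * w := by field_simp; ring
    rw [h7, mul_pow] at h5
    have h8 : (s - -v / w) ^ 2 ≤ η ^ 2 := sq_le_sq' (by linarith [(abs_le.1 hs).1]) (abs_le.1 hs).2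
    have h9 : w ^ 2 ≤ C ^ 2 := sq_le_sq' (by linarith [(abs_le.1 h2).1]) (abs_le.1 h2).2
    have h10 : (b : ℝ) ^ k * ((s - -v / w) ^ 2 * w ^ 2) ≤ (b : ℝ) ^ k * (η ^ 2 * C ^ 2) := by
      gcongr
    have h11 : ((b : ℝ) ^ k)⁻¹ * w ^ 2 ≤ ((b : ℝ) ^ k)⁻¹ * C ^ 2 := by gcongr
    linarith

/-- On a horocycle, the lattices with precompact forward orbit have measure zero. -/
lemma volume_unip_mem_forwardThick {b : ℕ} (hb : 2 ≤ b) {δ : ℝ} (hδ : 0 < δ) (x : LatticeSpace) :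
    volume {s : ℝ | unip s • x ∈ forwardThick b δ} = 0 := by
  set S := {s : ℝ | unip s • x ∈ forwardThick b δ} with hS
  have hSc : IsClosed S := (isClosed_forwardThick b δ).preimage
    (continuous_unip.smul continuous_const)
  obtain ⟨R, η, hR, hη, hole⟩ := exists_hole hb hδ
  have hb0 : (0 : ℝ) < b := by exact_mod_cast (by omega : 0 < b)
  have hb1 : (1 : ℝ) < b := by exact_mod_cast (by omega : 1 < b)
  have h := IsUnifLocDoublingMeasure.ae_tendsto_measure_inter_div (μ := (volume : Measure ℝ)) S
    (R / η)
  rw [ae_restrict_iff' hSc.measurableSet] at h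
  refine measure_mono_null (fun s hs => ?_) h
  simp only [Set.mem_compl_iff, Set.mem_ofPred_eq]
  intro hcon
  have hex : ∀ k : ℕ, ∃ s₀, |s₀| ≤ R ∧ ∀ t, |t - s₀| ≤ η →
      unip t • (dil b ^ k • (unip s • x)) ∉ forwardThick b δ := fun k =>
    hole _ (hs k)
  choose c hcR hc using hex
  have hpos : ∀ k : ℕ, 0 < ((b : ℝ) ^ k)⁻¹ := fun k => by positivity
  have hlim : Tendsto (fun k : ℕ => ((b : ℝ) ^ k)⁻¹ * η) atTop (𝓝[>] 0) := by
    refine tendsto_nhdsWithin_iff.2 ⟨?_, Eventually.of_forall fun k => mul_pos (hpos k) hη⟩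
    simpa using (tendsto_inv_atTop_zero.comp (tendsto_pow_atTop_atTop_of_one_lt hb1)).mul_const η
  have h1 := hcon hs (fun k : ℕ => s + ((b : ℝ) ^ k)⁻¹ * c k) (fun k : ℕ => ((b : ℝ) ^ k)⁻¹ * η)
    hlim (Eventually.of_forall fun k => by
      rw [Metric.mem_closedBall, Real.dist_eq]
      have : s - (s + ((b : ℝ) ^ k)⁻¹ * c k) = -(((b : ℝ) ^ k)⁻¹ * c k) := by ring
      rw [this, abs_neg, abs_mul, abs_of_pos (hpos k)]
      have : R / η * (((b : ℝ) ^ k)⁻¹ * η) = ((b : ℝ) ^ k)⁻¹ * R := by field_simp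
      rw [this]
      exact mul_le_mul_of_nonneg_left (hcR k) (hpos k).le)
  have h2 : ∀ k : ℕ, S ∩ Metric.closedBall (s + ((b : ℝ) ^ k)⁻¹ * c k) (((b : ℝ) ^ k)⁻¹ * η) = ∅ := by
    intro k
    rw [Set.eq_empty_iff_forall_notMem]
    rintro t ⟨ht, htb⟩
    refine hc k ((b : ℝ) ^ k * (t - s)) ?_ ?_
    · rw [Metric.mem_closedBall, Real.dist_eq] at htb
      have : (b : ℝ) ^ k * (t - s) - c k = (b : ℝ) ^ k * (t - (s + ((b : ℝ) ^ k)⁻¹ * c k)) := by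
        field_simp; ring
      rw [this, abs_mul, abs_of_pos (by positivity)]
      calc (b : ℝ) ^ k * |t - (s + ((b : ℝ) ^ k)⁻¹ * c k)|
          ≤ (b : ℝ) ^ k * (((b : ℝ) ^ k)⁻¹ * η) := by gcongr
        _ = η := by field_simp
    · have hm := dil_zpow_mul_unip (by omega : 0 < b) k (t - s)
      rw [zpow_natCast, zpow_natCast] at hm
      rw [← mul_smul, ← hm, mul_smul, ← mul_smul _ (unip s), ← unip_add, sub_add_cancel]
      exact pow_smul_mem_forwardThick ht k
  simp only [h2, measure_empty, ENNReal.zero_div] at h1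
  exact zero_ne_one (tendsto_nhds_unique tendsto_const_nhds h1)

end LatticeFlow

section TestFunctions

open Matrix Topology LatticeSpace

/-- Continuous compactly supported functions on the space of lattices. -/
structure IsTest (ψ : LatticeSpace → ℝ) : Prop where
  continuous : Continuous ψ
  hasCompactSupport : HasCompactSupport ψ

lemma IsTest.comp_smul {ψ : LatticeSpace → ℝ} (h : IsTest ψ) (g : SLR) :
    IsTest fun x => ψ (g • x) :=
  ⟨h.continuous.comp (continuous_const_smul g),
    h.hasCompactSupport.comp_homeomorph (Homeomorph.smul g)⟩

lemma IsTest.exists_bound {ψ : LatticeSpace → ℝ} (h : IsTest ψ) : ∃ C, ∀ x, |ψ x| ≤ C :=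
  h.hasCompactSupport.exists_bound_of_continuous h.continuous

lemma IsTest.eventually_abs_sub_lt {ψ : LatticeSpace → ℝ} (hψ : IsTest ψ) {ε : ℝ} (hε : 0 < ε) :
    ∀ᶠ h in 𝓝 (1 : SLR), ∀ x, |ψ (h • x) - ψ x| < ε := by
  obtain ⟨V, hV, hV1⟩ := exists_compact_mem_nhds (1 : SLR)
  have hK : IsCompact ((fun p : SLR × LatticeSpace => p.1⁻¹ • p.2) '' (V ×ˢ tsupport ψ)) :=
    (hV.prod hψ.hasCompactSupport).image (continuous_fst.inv.smul continuous_snd)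
  have hK' := hK.union hψ.hasCompactSupport
  have hc : Continuous fun z : SLR × LatticeSpace => |ψ (z.1 • z.2) - ψ z.2| :=
    ((hψ.continuous.comp continuous_smul).sub (hψ.continuous.comp continuous_snd)).abs
  have := hK'.eventually_forall_of_forall_eventually (x₀ := (1 : SLR))
    (P := fun h x => |ψ (h • x) - ψ x| < ε) fun x _ =>
      hc.continuousAt.eventually (gt_mem_nhds (by simpa using hε))
  filter_upwards [this, hV1] with h hh hhV x
  by_cases hx : x ∈ (fun p : SLR × LatticeSpace => p.1⁻¹ • p.2) '' (V ×ˢ tsupport ψ) ∪ tsupport ψ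
  · exact hh x hx
  · rw [Set.mem_union, not_or] at hx
    have h1 : h • x ∉ tsupport ψ := fun h1 => hx.1 ⟨(h, h • x), ⟨hhV, h1⟩, by simp⟩
    rw [image_eq_zero_of_notMem_tsupport h1, image_eq_zero_of_notMem_tsupport hx.2]
    simpa using hε

lemma exists_dense_tests : ∃ Ψ : ℕ → LatticeSpace → ℝ, (∀ i, IsTest (Ψ i)) ∧
    ∀ ψ, IsTest ψ → ∀ ε > 0, ∃ i, ∀ x, |Ψ i x - ψ x| < ε := by
  let K := CompactExhaustion.choice LatticeSpace
  let S : ℕ → Set C(LatticeSpace, ℝ) := fun n => {ψ | ∀ x ∉ K n, ψ x = 0}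
  have hS0 : ∀ n, Nonempty (S n) := fun n => ⟨0, fun x _ => rfl⟩
  let F : ℕ → ℕ → LatticeSpace → ℝ := fun n m =>
    (TopologicalSpace.denseSeq (S n) m : C(LatticeSpace, ℝ))
  have hF0 : ∀ n m, ∀ x ∉ K n, F n m x = 0 := fun n m => (TopologicalSpace.denseSeq (S n) m).2
  refine ⟨fun i => F i.unpair.1 i.unpair.2, fun i => ⟨ContinuousMap.continuous _,
    HasCompactSupport.intro (K.isCompact i.unpair.1) (hF0 _ _)⟩, fun ψ hψ ε hε => ?_⟩
  obtain ⟨n, hn⟩ := K.exists_superset_of_isCompact hψ.hasCompactSupport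
  let ψ' : S n := ⟨⟨ψ, hψ.continuous⟩, fun x hx =>
    image_eq_zero_of_notMem_tsupport fun h => hx (hn h)⟩
  have hev : ∀ᶠ φ : S n in 𝓝 ψ', ∀ x ∈ K n, |(φ : C(LatticeSpace, ℝ)) x - ψ x| < ε := by
    have hc : Continuous fun φ : S n => (φ : C(LatticeSpace, ℝ)) - ψ'.1 :=
      continuous_subtype_val.sub continuous_const
    have h1 := (hc.tendsto ψ').eventually (ContinuousMap.eventually_mapsTo
      (f := ψ'.1 - ψ'.1) (K.isCompact n) (Metric.isOpen_ball (x := (0 : ℝ)) (ε := ε)) (by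
        intro x _; simpa using hε))
    filter_upwards [h1] with φ hφ x hx
    simpa [ψ'] using hφ hx
  obtain ⟨φ, hφ1, m, rfl⟩ := mem_closure_iff_nhds.1
    (TopologicalSpace.denseRange_denseSeq (S n) ψ') _ hev
  refine ⟨Nat.pair n m, fun x => ?_⟩
  beta_reduce
  rw [Nat.unpair_pair]
  by_cases hx : x ∈ K n
  · exact hφ1 x hx
  · rw [hF0 n m x hx,
      image_eq_zero_of_notMem_tsupport fun h => hx (hn h)]
    simpa using hε

end TestFunctions

section OrbitAverages

open Topology LatticeSpace

/-- The shift on sequences of lattices. -/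
def seqShift (w : ℕ → LatticeSpace) : ℕ → LatticeSpace := fun k => w (k + 1)

lemma measurable_seqShift : Measurable seqShift :=
  measurable_pi_lambda _ fun k => measurable_pi_apply (k + 1)

lemma seqShift_iterate (j k : ℕ) (w : ℕ → LatticeSpace) : seqShift^[j] w k = w (j + k) := by
  induction j generalizing w with
  | zero => simp
  | succ j ih => rw [Function.iterate_succ_apply, ih, seqShift]; congr 1; omega

lemma seqShift_iterate_smul (g : SLR) (j : ℕ) (w : ℕ → LatticeSpace) :
    seqShift^[j] (g • w) = g • seqShift^[j] w := by
  ext k; simp [seqShift_iterate]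

lemma measurable_smul_seq (g : SLR) : Measurable fun w : ℕ → LatticeSpace => g • w :=
  measurable_pi_lambda _ fun k => (continuous_const_smul g).measurable.comp (measurable_pi_apply k)

/-- The average of `ψ` over the first `N` terms of a sequence of lattices. -/
noncomputable def seqAvg (ψ : LatticeSpace → ℝ) (N : ℕ) (w : ℕ → LatticeSpace) : ℝ :=
  birkhoffAverage ℝ seqShift (fun w => ψ (w 0)) N w

lemma seqAvg_eq (ψ : LatticeSpace → ℝ) (N : ℕ) (w : ℕ → LatticeSpace) :
    seqAvg ψ N w = (N : ℝ)⁻¹ * ∑ k ∈ Finset.range N, ψ (w k) := by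
  simp [seqAvg, birkhoffAverage, birkhoffSum, seqShift_iterate]

lemma seqAvg_smul (ψ : LatticeSpace → ℝ) (g : SLR) (N : ℕ) (w : ℕ → LatticeSpace) :
    seqAvg ψ N (g • w) = seqAvg (fun x => ψ (g • x)) N w := by
  simp [seqAvg_eq]

lemma abs_avg_sub_le {N : ℕ} {u v : ℕ → ℝ} {ε : ℝ} (hε : 0 ≤ ε) (h : ∀ k < N, |u k - v k| ≤ ε) :
    |(N : ℝ)⁻¹ * ∑ k ∈ Finset.range N, u k - (N : ℝ)⁻¹ * ∑ k ∈ Finset.range N, v k| ≤ ε := by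
  rw [← mul_sub, ← Finset.sum_sub_distrib, abs_mul, abs_of_nonneg (by positivity)]
  rcases Nat.eq_zero_or_pos N with rfl | hN
  · simpa using hε
  · rw [inv_mul_le_iff₀ (by exact_mod_cast hN)]
    refine (Finset.abs_sum_le_sum_abs _ _).trans ?_
    simpa using Finset.sum_le_card_nsmul (Finset.range N) _ ε fun k hk => h k (Finset.mem_range.1 hk)

lemma abs_seqAvg_sub_le {ψ φ : LatticeSpace → ℝ} {ε : ℝ} (h : ∀ x, |ψ x - φ x| ≤ ε) (N : ℕ)
    (w : ℕ → LatticeSpace) : |seqAvg ψ N w - seqAvg φ N w| ≤ ε := by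
  rw [seqAvg_eq, seqAvg_eq]
  exact abs_avg_sub_le ((abs_nonneg _).trans (h (w 0))) fun k _ => h _

lemma IsTest.measurable_seqAvg {ψ : LatticeSpace → ℝ} (hψ : IsTest ψ) (N : ℕ) :
    Measurable (seqAvg ψ N) :=
  measurable_birkhoffAverage measurable_seqShift
    (hψ.continuous.measurable.comp (measurable_pi_apply 0)) N

/-- The sequences of lattices along which all test functions have an average. -/
def genericSet : Set (ℕ → LatticeSpace) :=
  {w | ∀ ψ, IsTest ψ → ∃ l, Tendsto (fun N => seqAvg ψ N w) atTop (𝓝 l)}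

/-- The limiting average of `ψ` along a sequence of lattices. -/
noncomputable def limAvg (ψ : LatticeSpace → ℝ) (w : ℕ → LatticeSpace) : ℝ :=
  limsup (fun N => seqAvg ψ N w) atTop

lemma IsTest.measurable_limAvg {ψ : LatticeSpace → ℝ} (hψ : IsTest ψ) : Measurable (limAvg ψ) :=
  Measurable.limsup hψ.measurable_seqAvg

lemma tendsto_limAvg {ψ : LatticeSpace → ℝ} (hψ : IsTest ψ) {w : ℕ → LatticeSpace}
    (hw : w ∈ genericSet) : Tendsto (fun N => seqAvg ψ N w) atTop (𝓝 (limAvg ψ w)) := by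
  obtain ⟨l, hl⟩ := hw ψ hψ
  rwa [limAvg, hl.limsup_eq]

lemma limAvg_smul (ψ : LatticeSpace → ℝ) (g : SLR) (w : ℕ → LatticeSpace) :
    limAvg ψ (g • w) = limAvg (fun x => ψ (g • x)) w := by
  simp only [limAvg, seqAvg_smul]

lemma tendsto_seqAvg_seqShift {ψ : LatticeSpace → ℝ} (hψ : IsTest ψ) {w : ℕ → LatticeSpace} {l : ℝ} :
    Tendsto (fun N => seqAvg ψ N (seqShift w)) atTop (𝓝 l) ↔
      Tendsto (fun N => seqAvg ψ N w) atTop (𝓝 l) := by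
  obtain ⟨C, hC⟩ := hψ.exists_bound
  have h := tendsto_birkhoffAverage_sub (T := seqShift) (f := fun w => ψ (w 0)) C (fun w => hC _) w
  constructor
  · intro h1
    have := h1.sub h
    simpa [seqAvg] using this
  · intro h1
    have := h.add h1
    simpa [seqAvg] using this

lemma seqShift_mem_genericSet_iff {w : ℕ → LatticeSpace} :
    seqShift w ∈ genericSet ↔ w ∈ genericSet :=
  forall₂_congr fun _ hψ => exists_congr fun _ => tendsto_seqAvg_seqShift hψ

lemma limAvg_seqShift {ψ : LatticeSpace → ℝ} (hψ : IsTest ψ) {w : ℕ → LatticeSpace}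
    (hw : w ∈ genericSet) : limAvg ψ (seqShift w) = limAvg ψ w :=
  ((tendsto_seqAvg_seqShift hψ).2 (tendsto_limAvg hψ hw)).limsup_eq

lemma limAvg_seqShift_iterate {ψ : LatticeSpace → ℝ} (hψ : IsTest ψ) {w : ℕ → LatticeSpace}
    (hw : w ∈ genericSet) (j : ℕ) : limAvg ψ (seqShift^[j] w) = limAvg ψ w := by
  induction j generalizing w with
  | zero => rfl
  | succ j ih =>
    rw [Function.iterate_succ_apply, ih (seqShift_mem_genericSet_iff.2 hw), limAvg_seqShift hψ hw]

lemma abs_limAvg_sub_le {ψ φ : LatticeSpace → ℝ} (hψ : IsTest ψ) (hφ : IsTest φ) {ε : ℝ}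
    (h : ∀ x, |ψ x - φ x| ≤ ε) {w : ℕ → LatticeSpace} (hw : w ∈ genericSet) :
    |limAvg ψ w - limAvg φ w| ≤ ε :=
  le_of_tendsto ((tendsto_limAvg hψ hw).sub (tendsto_limAvg hφ hw)).abs
    (Eventually.of_forall fun N => abs_seqAvg_sub_le h N w)

lemma exists_limit_of_uniform_approx {a : ℕ → ℝ}
    (h : ∀ ε > 0, ∃ c : ℕ → ℝ, (∃ l, Tendsto c atTop (𝓝 l)) ∧ ∀ N, |c N - a N| ≤ ε) :
    ∃ l, Tendsto a atTop (𝓝 l) := by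
  refine cauchySeq_tendsto_of_complete (Metric.cauchySeq_iff.2 fun ε hε => ?_)
  obtain ⟨c, ⟨l, hl⟩, hc⟩ := h (ε / 4) (by linarith)
  obtain ⟨N, hN⟩ := Metric.cauchySeq_iff.1 hl.cauchySeq (ε / 4) (by linarith)
  refine ⟨N, fun m hm n hn => ?_⟩
  have h1 := hN m hm n hn
  have h2 := hc m
  have h3 := hc n
  rw [Real.dist_eq] at h1 ⊢
  rw [abs_lt] at *
  rw [abs_le] at *
  constructor <;> linarith [h1.1, h1.2, h2.1, h2.2, h3.1, h3.2]

lemma mem_genericSet_iff_of_dense {Ψ : ℕ → LatticeSpace → ℝ} (hΨ : ∀ i, IsTest (Ψ i))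
    (hd : ∀ ψ, IsTest ψ → ∀ ε > 0, ∃ i, ∀ x, |Ψ i x - ψ x| < ε) {w : ℕ → LatticeSpace} :
    w ∈ genericSet ↔ ∀ i, ∃ l, Tendsto (fun N => seqAvg (Ψ i) N w) atTop (𝓝 l) := by
  refine ⟨fun hw i => hw _ (hΨ i), fun hw ψ hψ => exists_limit_of_uniform_approx fun ε hε => ?_⟩
  obtain ⟨i, hi⟩ := hd ψ hψ ε hε
  exact ⟨_, hw i, fun N => abs_seqAvg_sub_le (fun x => (hi x).le) N w⟩

lemma measurableSet_genericSet : MeasurableSet genericSet := by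
  obtain ⟨Ψ, hΨ, hd⟩ := exists_dense_tests
  have : genericSet = ⋂ i, {w | ∃ l, Tendsto (fun N => seqAvg (Ψ i) N w) atTop (𝓝 l)} := by
    ext w; simp [mem_genericSet_iff_of_dense hΨ hd]
  rw [this]
  exact .iInter fun i => measurableSet_exists_tendsto fun N => (hΨ i).measurable_seqAvg N

lemma ae_mem_genericSet {ρ : Measure (ℕ → LatticeSpace)} [IsFiniteMeasure ρ]
    (hρ : MeasurePreserving seqShift ρ ρ) : ∀ᵐ w ∂ρ, w ∈ genericSet := by
  obtain ⟨Ψ, hΨ, hd⟩ := exists_dense_tests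
  simp only [mem_genericSet_iff_of_dense hΨ hd]
  refine ae_all_iff.2 fun i => ?_
  obtain ⟨C, hC⟩ := (hΨ i).exists_bound
  exact ae_exists_tendsto_birkhoffAverage hρ
    ((hΨ i).continuous.measurable.comp (measurable_pi_apply 0)) C fun w => hC _

/-- The times `τ` such that `unip τ` preserves all limiting averages along `w`. -/
noncomputable def avgStab (w : ℕ → LatticeSpace) : AddSubgroup ℝ where
  carrier := {τ | ∀ ψ, IsTest ψ → limAvg (fun x => ψ (unip τ • x)) w = limAvg ψ w}
  zero_mem' ψ hψ := by simp
  add_mem' {σ τ} hσ hτ ψ hψ := by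
    have := hτ _ (hψ.comp_smul (unip σ))
    simp only [unip_add, mul_smul]
    rw [this, hσ ψ hψ]
  neg_mem' {τ} hτ ψ hψ := by
    have := hτ _ (hψ.comp_smul (unip (-τ)))
    simp only [← mul_smul, ← unip_add] at this
    simpa using this.symm

lemma mem_avgStab {w : ℕ → LatticeSpace} {τ : ℝ} : τ ∈ avgStab w ↔
    ∀ ψ, IsTest ψ → limAvg (fun x => ψ (unip τ • x)) w = limAvg ψ w := Iff.rfl

lemma continuous_limAvg_unip {ψ : LatticeSpace → ℝ} (hψ : IsTest ψ) {w : ℕ → LatticeSpace}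
    (hw : w ∈ genericSet) : Continuous fun τ => limAvg (fun x => ψ (unip τ • x)) w := by
  rw [Metric.continuous_iff']
  intro τ ε hε
  have h : Tendsto (fun σ : ℝ => unip (σ - τ)) (𝓝 τ) (𝓝 1) := by
    have := (continuous_unip.comp (continuous_id.sub continuous_const)).tendsto (x := τ)
      (f := fun σ : ℝ => unip (σ - τ))
    simpa using this
  filter_upwards [h.eventually (hψ.eventually_abs_sub_lt (half_pos hε))] with σ hσ
  refine lt_of_le_of_lt (abs_limAvg_sub_le (hψ.comp_smul _) (hψ.comp_smul _) (fun x => ?_) hw)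
    (half_lt_self hε)
  have := (hσ (unip τ • x)).le
  rwa [← mul_smul, ← unip_add, sub_add_cancel] at this

lemma isClosed_avgStab {w : ℕ → LatticeSpace} (hw : w ∈ genericSet) :
    IsClosed (avgStab w : Set ℝ) := by
  have : (avgStab w : Set ℝ) = ⋂ ψ, ⋂ _ : IsTest ψ,
      {τ | limAvg (fun x => ψ (unip τ • x)) w = limAvg ψ w} := by
    ext; simp [mem_avgStab]
  rw [this]
  exact isClosed_iInter fun ψ => isClosed_iInter fun hψ =>
    isClosed_eq (continuous_limAvg_unip hψ hw) continuous_const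

lemma mem_avgStab_iff_of_dense {Ψ : ℕ → LatticeSpace → ℝ} (hΨ : ∀ i, IsTest (Ψ i))
    (hd : ∀ ψ, IsTest ψ → ∀ ε > 0, ∃ i, ∀ x, |Ψ i x - ψ x| < ε) {w : ℕ → LatticeSpace}
    (hw : w ∈ genericSet) {τ : ℝ} : τ ∈ avgStab w ↔
      ∀ i, limAvg (fun x => Ψ i (unip τ • x)) w = limAvg (Ψ i) w := by
  refine ⟨fun h i => h _ (hΨ i), fun h ψ hψ => ?_⟩
  refine eq_of_forall_dist_le fun ε hε => ?_
  obtain ⟨i, hi⟩ := hd ψ hψ (ε / 2) (by linarith)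
  have h1 := abs_limAvg_sub_le (hΨ i) hψ (fun x => (hi x).le) hw
  have h2 := abs_limAvg_sub_le ((hΨ i).comp_smul (unip τ)) (hψ.comp_smul (unip τ))
    (fun x => (hi _).le) hw
  rw [h i] at h2
  rw [Real.dist_eq]
  rw [abs_le] at *
  constructor <;> linarith [h1.1, h1.2, h2.1, h2.2]

lemma mem_avgStab_dil_smul {b : ℕ} (hb : 0 < b) (k : ℕ) {w : ℕ → LatticeSpace} {τ : ℝ}
    (h : τ ∈ avgStab (dil b ^ k • w)) : ((b : ℝ) ^ k)⁻¹ * τ ∈ avgStab w := by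
  intro ψ hψ
  have hb' : (b : ℝ) ^ k ≠ 0 := by positivity
  have h1 := h _ (hψ.comp_smul (dil b ^ k)⁻¹)
  rw [limAvg_smul, limAvg_smul] at h1
  have h2 := dil_zpow_mul_unip hb k (((b : ℝ) ^ k)⁻¹ * τ)
  rw [zpow_natCast, zpow_natCast, mul_inv_cancel_left₀ hb'] at h2
  simp only [← mul_smul, inv_mul_cancel, one_smul] at h1
  rw [← h2] at h1
  simpa using h1

end OrbitAverages

section AverageStabilizer

open Topology LatticeSpace

variable {b : ℕ} {ρ : Measure (ℕ → LatticeSpace)} [IsProbabilityMeasure ρ]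

lemma integral_test_eq_integral_limAvg (hF : MeasurePreserving seqShift ρ ρ)
    {E : Set (ℕ → LatticeSpace)} (hE : MeasurableSet E) (hEF : seqShift ⁻¹' E = E)
    (hEg : E ⊆ genericSet) {ψ : LatticeSpace → ℝ} (hψ : IsTest ψ) :
    ∫ w in E, ψ (w 0) ∂ρ = ∫ w in E, limAvg ψ w ∂ρ := by
  obtain ⟨C, hC⟩ := hψ.exists_bound
  have hFE : MeasurePreserving seqShift (ρ.restrict E) (ρ.restrict E) := by
    have := hF.restrict_preimage hE
    rwa [hEF] at this
  have hm : Measurable fun w : ℕ → LatticeSpace => ψ (w 0) :=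
    hψ.continuous.measurable.comp (measurable_pi_apply 0)
  have hinteg : Integrable (fun w : ℕ → LatticeSpace => ψ (w 0)) (ρ.restrict E) :=
    Integrable.of_bound hm.aestronglyMeasurable C (ae_of_all _ fun w => hC _)
  have havg : ∀ N : ℕ, 0 < N → ∫ w in E, seqAvg ψ N w ∂ρ = ∫ w in E, ψ (w 0) ∂ρ := by
    intro N hN
    have h1 : ∀ k ∈ Finset.range N, ∫ w in E, ψ (seqShift^[k] w 0) ∂ρ = ∫ w in E, ψ (w 0) ∂ρ := by
      intro k _
      have h2 := hFE.iterate k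
      have h3 := integral_map (μ := ρ.restrict E) h2.measurable.aemeasurable
        (f := fun w => ψ (w 0)) (by rw [h2.map_eq]; exact hm.aestronglyMeasurable)
      rw [h2.map_eq] at h3
      exact h3.symm
    have h4 : ∀ w, seqAvg ψ N w = (N : ℝ)⁻¹ * ∑ k ∈ Finset.range N, ψ (seqShift^[k] w 0) := by
      intro w; simp [seqAvg_eq, seqShift_iterate]
    simp only [h4]
    rw [integral_const_mul, integral_finsetSum, Finset.sum_congr rfl h1]
    · simp; field_simp
    · intro k _
      exact (hFE.iterate k).integrable_comp_of_integrable hinteg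
  have hlim : Tendsto (fun N => ∫ w in E, seqAvg ψ N w ∂ρ) atTop (𝓝 (∫ w in E, limAvg ψ w ∂ρ)) := by
    refine tendsto_integral_of_dominated_convergence (fun _ => C)
      (fun N => (hψ.measurable_seqAvg N).aestronglyMeasurable) (integrable_const _)
      (fun N => ae_of_all _ fun w => ?_) ?_
    · exact abs_birkhoffAverage_le C (fun w => hC _) N w
    · exact (ae_restrict_mem hE).mono fun w hw => tendsto_limAvg hψ (hEg hw)
  refine tendsto_nhds_unique (tendsto_const_nhds.congr' ?_) hlim
  filter_upwards [eventually_gt_atTop 0] with N hN using (havg N hN).symm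

lemma measurableSet_avgStab_eq_top :
    MeasurableSet {w | w ∈ genericSet ∧ avgStab w = ⊤} := by
  obtain ⟨Ψ, hΨ, hd⟩ := exists_dense_tests
  have : {w | w ∈ genericSet ∧ avgStab w = ⊤} = genericSet ∩ ⋂ q : ℚ, ⋂ i,
      {w | limAvg (fun x => Ψ i (unip q • x)) w = limAvg (Ψ i) w} := by
    ext w
    simp only [Set.mem_ofPred_eq, Set.mem_inter_iff, Set.mem_iInter]
    refine and_congr_right fun hw => ⟨fun h q i => ?_, fun h => ?_⟩
    · have : (q : ℝ) ∈ avgStab w := by rw [h]; trivial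
      exact this _ (hΨ i)
    · have h1 : Set.range ((↑) : ℚ → ℝ) ⊆ avgStab w := by
        rintro _ ⟨q, rfl⟩
        exact (mem_avgStab_iff_of_dense hΨ hd hw).2 (h q)
      refine (AddSubgroup.eq_top_iff' _).2 fun x => ?_
      exact (isClosed_avgStab hw).closure_subset_iff.2 h1 (Rat.denseRange_cast x)
  rw [this]
  exact measurableSet_genericSet.inter (.iInter fun q => .iInter fun i => measurableSet_eq_fun
    ((hΨ i).comp_smul _).measurable_limAvg (hΨ i).measurable_limAvg)

lemma avgStab_seqShift {w : ℕ → LatticeSpace} (hw : w ∈ genericSet) :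
    avgStab (seqShift w) = avgStab w := by
  ext τ
  simp only [mem_avgStab]
  exact forall₂_congr fun ψ hψ => by
    rw [limAvg_seqShift hψ hw, limAvg_seqShift (hψ.comp_smul _) hw]

instance : T3Space LatticeSpace := inferInstance

instance : TopologicalSpace.MetrizableSpace LatticeSpace :=
  TopologicalSpace.metrizableSpace_of_t3_secondCountable _

instance : SigmaCompactSpace LatticeSpace := inferInstance

lemma measure_regular (ν : Measure LatticeSpace) [IsFiniteMeasure ν] : ν.Regular := by
  let _ := TopologicalSpace.metrizableSpaceMetric LatticeSpace
  infer_instance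

lemma measure_avgStab_eq_top (hb : 2 ≤ b) (hF : MeasurePreserving seqShift ρ ρ)
    (ht : ∀ η : ℝ, 0 < η → ∃ δ > 0, ρ.real {w | w 0 ∉ forwardThick b δ} ≤ η) :
    ρ {w | w ∈ genericSet ∧ avgStab w = ⊤} = 0 := by
  set E := {w | w ∈ genericSet ∧ avgStab w = ⊤} with hEdef
  have hE : MeasurableSet E := measurableSet_avgStab_eq_top
  have hEF : seqShift ⁻¹' E = E := by
    ext w
    simp only [hEdef, Set.mem_preimage, Set.mem_ofPred_eq, seqShift_mem_genericSet_iff]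
    exact and_congr_right fun hw => by rw [avgStab_seqShift hw]
  have hEg : E ⊆ genericSet := fun w hw => hw.1
  have hm0 : Measurable fun w : ℕ → LatticeSpace => w 0 := measurable_pi_apply 0
  set ν : Measure LatticeSpace := (ρ.restrict E).map fun w => w 0 with hν
  have hinv : ∀ τ : ℝ, ν.map (fun x => unip τ • x) = ν := by
    intro τ
    have hmτ : Measurable fun x : LatticeSpace => unip τ • x :=
      (continuous_const_smul _).measurable
    have := measure_regular (ν.map fun x => unip τ • x)
    have := measure_regular ν
    refine Measure.ext_of_integral_eq_on_compactlySupported fun f => ?_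
    have hf : IsTest f := ⟨f.continuous, f.hasCompactSupport⟩
    rw [integral_map hmτ.aemeasurable hf.continuous.aestronglyMeasurable, hν,
      integral_map hm0.aemeasurable (hf.comp_smul _).continuous.aestronglyMeasurable,
      integral_map hm0.aemeasurable hf.continuous.aestronglyMeasurable,
      integral_test_eq_integral_limAvg hF hE hEF hEg hf,
      integral_test_eq_integral_limAvg hF hE hEF hEg (hf.comp_smul (unip τ))]
    refine setIntegral_congr_fun hE fun w hw => ?_
    have : τ ∈ avgStab w := by rw [hw.2]; trivial
    exact this _ hf
  have hzero : ∀ δ : ℝ, 0 < δ → ν (forwardThick b δ) = 0 := by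
    intro δ hδ
    have hK := (isClosed_forwardThick b δ).measurableSet
    have hmeas : MeasurableSet {p : ℝ × LatticeSpace | unip p.1 • p.2 ∈ forwardThick b δ} :=
      ((isClosed_forwardThick b δ).preimage
        ((continuous_unip.comp continuous_fst).smul continuous_snd)).measurableSet
    have h0 : ((volume.restrict (Set.Icc (0 : ℝ) 1)).prod ν)
        {p : ℝ × LatticeSpace | unip p.1 • p.2 ∈ forwardThick b δ} = 0 := by
      rw [Measure.prod_apply_symm hmeas]
      simp only [lintegral_eq_zero_iff (measurable_measure_prodMk_right hmeas)]
      refine ae_of_all _ fun x => ?_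
      exact Measure.restrict_le_self.absolutelyContinuous (volume_unip_mem_forwardThick hb hδ x)
    rw [Measure.prod_apply hmeas] at h0
    have h1 : ∀ τ : ℝ, ν (Prod.mk τ ⁻¹' {p : ℝ × LatticeSpace | unip p.1 • p.2 ∈ forwardThick b δ})
        = ν (forwardThick b δ) := by
      intro τ
      conv_rhs => rw [← hinv τ]
      rw [Measure.map_apply (continuous_const_smul _).measurable hK]
      rfl
    simp only [h1] at h0
    simpa using h0
  by_contra hne
  have hpos : 0 < ρ.real E := ENNReal.toReal_pos hne (measure_ne_top _ _)
  obtain ⟨δ, hδ, hρ⟩ := ht (ρ.real E / 2) (by linarith)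
  have h2 := hzero δ hδ
  rw [hν, Measure.map_apply hm0 (isClosed_forwardThick b δ).measurableSet,
    Measure.restrict_apply (hm0 (isClosed_forwardThick b δ).measurableSet)] at h2
  have h3 : ρ.real E ≤ ρ.real ((fun w => w 0) ⁻¹' forwardThick b δ ∩ E) +
      ρ.real {w | w 0 ∉ forwardThick b δ} := by
    refine (measureReal_mono ?_).trans (measureReal_union_le _ _)
    intro w hw
    by_cases h : w 0 ∈ forwardThick b δ
    · exact Or.inl ⟨h, hw⟩
    · exact Or.inr h
  rw [measureReal_def, measureReal_def, h2, ENNReal.toReal_zero, ← measureReal_def] at h3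
  linarith

end AverageStabilizer

section Displacement

open Topology LatticeSpace

variable {b : ℕ} {ρ : Measure (ℕ → LatticeSpace)} [IsProbabilityMeasure ρ]

/-- The sequences whose first `M` averages move by less than `1 / (M + 1)` under `unip τ`, for
some `τ ∈ K`. -/
def almostStabSet (Ψ : ℕ → LatticeSpace → ℝ) (K : Set ℝ) (M : ℕ) : Set (ℕ → LatticeSpace) :=
  {w | w ∈ genericSet ∧ ∃ τ ∈ K, ∀ i < M,
    |limAvg (fun x => Ψ i (unip τ • x)) w - limAvg (Ψ i) w| < 1 / (M + 1)}

variable {Ψ : ℕ → LatticeSpace → ℝ}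

lemma isOpen_almostStab (hΨ : ∀ i, IsTest (Ψ i)) (M : ℕ) {w : ℕ → LatticeSpace}
    (hw : w ∈ genericSet) : IsOpen {τ : ℝ | ∀ i < M,
      |limAvg (fun x => Ψ i (unip τ • x)) w - limAvg (Ψ i) w| < 1 / (M + 1)} := by
  have : {τ : ℝ | ∀ i < M, |limAvg (fun x => Ψ i (unip τ • x)) w - limAvg (Ψ i) w| < 1 / (M + 1)} =
      ⋂ i ∈ Finset.range M,
        {τ : ℝ | |limAvg (fun x => Ψ i (unip τ • x)) w - limAvg (Ψ i) w| < 1 / (M + 1)} := by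
    ext; simp
  rw [this]
  refine isOpen_biInter_finset fun i _ => ?_
  exact isOpen_lt (((continuous_limAvg_unip (hΨ i) hw).sub continuous_const).abs) continuous_const

lemma measurableSet_almostStabSet (hΨ : ∀ i, IsTest (Ψ i)) (K : Set ℝ) (M : ℕ) :
    MeasurableSet (almostStabSet Ψ K M) := by
  obtain ⟨T, hTK, hTc, hT⟩ :=
    (TopologicalSpace.IsSeparable.of_separableSpace K).exists_countable_dense_subset
  have : almostStabSet Ψ K M = genericSet ∩ ⋃ τ ∈ T, ⋂ i ∈ Finset.range M,
      {w | |limAvg (fun x => Ψ i (unip τ • x)) w - limAvg (Ψ i) w| < 1 / (M + 1)} := by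
    ext w
    simp only [almostStabSet, Set.mem_ofPred_eq, Set.mem_inter_iff, Set.mem_iUnion, Set.mem_iInter,
      Finset.mem_range, exists_prop]
    refine and_congr_right fun hw => ⟨?_, ?_⟩
    · rintro ⟨τ, hτ, h⟩
      obtain ⟨σ, h1, h2⟩ := mem_closure_iff.1 (hT hτ) _ (isOpen_almostStab hΨ M hw) h
      exact ⟨σ, h2, h1⟩
    · rintro ⟨τ, hτ, h⟩
      exact ⟨τ, hTK hτ, h⟩
  rw [this]
  refine measurableSet_genericSet.inter (.biUnion hTc fun τ _ => Finset.measurableSet_biInter _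
    fun i _ => measurableSet_lt ?_ measurable_const)
  exact ((((hΨ i).comp_smul _).measurable_limAvg).sub (hΨ i).measurable_limAvg).abs

lemma almostStabSet_anti (K : Set ℝ) : Antitone (almostStabSet Ψ K) := by
  rintro M N hMN w ⟨hw, τ, hτ, h⟩
  refine ⟨hw, τ, hτ, fun i hi => (h i (hi.trans_le hMN)).trans_le ?_⟩
  gcongr

lemma exists_mem_avgStab_of_forall (hΨ : ∀ i, IsTest (Ψ i))
    (hd : ∀ ψ, IsTest ψ → ∀ ε > 0, ∃ i, ∀ x, |Ψ i x - ψ x| < ε) {K : Set ℝ} (hK : IsCompact K)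
    {w : ℕ → LatticeSpace} (h : ∀ M, w ∈ almostStabSet Ψ K M) :
    w ∈ genericSet ∧ ∃ τ ∈ K, τ ∈ avgStab w := by
  have hw := (h 0).1
  choose τ hτK hτ using fun M => (h M).2
  obtain ⟨σ, hσ, φ, hφ, hlim⟩ := hK.tendsto_subseq hτK
  refine ⟨hw, σ, hσ, (mem_avgStab_iff_of_dense hΨ hd hw).2 fun i => ?_⟩
  have h1 := (((continuous_limAvg_unip (hΨ i) hw).sub
    (continuous_const (y := limAvg (Ψ i) w))).abs.tendsto σ).comp hlim
  have h2 : Tendsto (fun k => (1 : ℝ) / ((φ k : ℕ) + 1)) atTop (𝓝 0) :=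
    tendsto_one_div_add_atTop_nhds_zero_nat.comp hφ.tendsto_atTop
  have h3 := le_of_tendsto_of_tendsto h1 h2 (by
    filter_upwards [hφ.tendsto_atTop.eventually_gt_atTop i] with k hk
    exact (hτ (φ k) i hk).le)
  exact sub_eq_zero.1 (abs_nonpos_iff.1 h3)

lemma ae_avgStab_inter_eq_empty (hb : 2 ≤ b) (hF : MeasurePreserving seqShift ρ ρ)
    (hA : MeasurePreserving (fun w : ℕ → LatticeSpace => dil b • w) ρ ρ)
    (ht : ∀ η : ℝ, 0 < η → ∃ δ > 0, ρ.real {w | w 0 ∉ forwardThick b δ} ≤ η)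
    (hΨ : ∀ i, IsTest (Ψ i)) (hd : ∀ ψ, IsTest ψ → ∀ ε > 0, ∃ i, ∀ x, |Ψ i x - ψ x| < ε)
    {K : Set ℝ} (hK : IsCompact K) (hK0 : (0 : ℝ) ∉ K) :
    ρ (⋂ M, almostStabSet Ψ K M) = 0 := by
  set S := ⋂ M, almostStabSet Ψ K M with hS
  have hSm : MeasurableSet S := .iInter fun M => measurableSet_almostStabSet hΨ K M
  have hSmem : ∀ w ∈ S, w ∈ genericSet ∧ ∃ τ ∈ K, τ ∈ avgStab w := fun w hw =>
    exists_mem_avgStab_of_forall hΨ hd hK (Set.mem_iInter.1 hw)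
  have hb1 : (1 : ℝ) < b := by exact_mod_cast (by omega : 1 < b)
  obtain ⟨C, hC⟩ := hK.isBounded.exists_norm_le
  have hpoinc := hA.conservative.ae_mem_imp_frequently_image_mem hSm.nullMeasurableSet
  have h0 := measure_avgStab_eq_top hb hF ht
  rw [measure_eq_zero_iff_ae_notMem] at h0 ⊢
  filter_upwards [hpoinc, h0] with w hw h0 hwS
  refine h0 ⟨(hSmem w hwS).1, ?_⟩
  have hdense : Dense (avgStab w : Set ℝ) := by
    refine AddSubgroup.dense_of_not_isolated_zero _ fun ε hε => ?_
    have hlim : Tendsto (fun k : ℕ => ((b : ℝ) ^ k)⁻¹ * C) atTop (𝓝 0) := by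
      simpa using (tendsto_inv_atTop_zero.comp (tendsto_pow_atTop_atTop_of_one_lt hb1)).mul_const C
    obtain ⟨k, hk, hkε⟩ := ((hw hwS).and_eventually (hlim.eventually (gt_mem_nhds hε))).exists
    have hit : (fun w : ℕ → LatticeSpace => dil b • w)^[k] w = dil b ^ k • w := by
      rw [smul_iterate]
    rw [hit] at hk
    obtain ⟨-, τ, hτK, hτ⟩ := hSmem _ hk
    have h1 := mem_avgStab_dil_smul (by omega : 0 < b) k hτ
    have hτ0 : τ ≠ 0 := fun h => hK0 (h ▸ hτK)
    have hbk : (0 : ℝ) < ((b : ℝ) ^ k)⁻¹ := by positivity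
    refine ⟨|((b : ℝ) ^ k)⁻¹ * τ|, ?_, abs_pos.2 (mul_ne_zero hbk.ne' hτ0), ?_⟩
    · rcases abs_choice (((b : ℝ) ^ k)⁻¹ * τ) with h | h <;> rw [h]
      · exact h1
      · exact neg_mem h1
    · rw [abs_mul, abs_of_pos hbk]
      exact lt_of_le_of_lt (by gcongr; exact hC τ hτK) hkε
  refine (AddSubgroup.eq_top_iff' _).2 fun x => ?_
  have := (isClosed_avgStab (hSmem w hwS).1).closure_eq
  rw [hdense.closure_eq] at this
  exact this.subset (Set.mem_univ x)

lemma IsTest.exists_finite_net {ψ : LatticeSpace → ℝ} (hψ : IsTest ψ) {K : Set ℝ}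
    (hK : IsCompact K) {ε : ℝ} (hε : 0 < ε) :
    ∃ T : Finset ℝ, ∀ τ ∈ K, ∃ σ ∈ T, ∀ x, |ψ (unip τ • x) - ψ (unip σ • x)| ≤ ε := by
  have hlocal : ∀ σ ∈ K, {τ : ℝ | ∀ x, |ψ (unip τ • x) - ψ (unip σ • x)| ≤ ε} ∈ 𝓝 σ := by
    intro σ _
    have h : Tendsto (fun τ : ℝ => unip (τ - σ)) (𝓝 σ) (𝓝 1) := by
      have := (continuous_unip.comp (continuous_id.sub continuous_const)).tendsto (x := σ)
        (f := fun τ : ℝ => unip (τ - σ))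
      simpa using this
    filter_upwards [h.eventually (hψ.eventually_abs_sub_lt hε)] with τ hτ x
    have := (hτ (unip σ • x)).le
    rwa [← mul_smul, ← unip_add, sub_add_cancel] at this
  obtain ⟨T, -, hT⟩ := hK.elim_nhds_subcover _ hlocal
  refine ⟨T, fun τ hτ => ?_⟩
  obtain ⟨σ, hσ, h⟩ := Set.mem_iUnion₂.1 (hT hτ)
  exact ⟨σ, hσ, h⟩

lemma exists_measureReal_far_le (hF : MeasurePreserving seqShift ρ ρ) {ψ : LatticeSpace → ℝ}
    (hψ : IsTest ψ) {ε η : ℝ} (hε : 0 < ε) (hη : 0 < η) :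
    ∀ᶠ N in atTop, ρ.real {w | ε ≤ |seqAvg ψ N w - limAvg ψ w|} ≤ η := by
  have h1 : TendstoInMeasure ρ (fun N => seqAvg ψ N) atTop (limAvg ψ) :=
    tendstoInMeasure_of_tendsto_ae (fun N => (hψ.measurable_seqAvg N).aestronglyMeasurable)
      ((ae_mem_genericSet hF).mono fun w hw => tendsto_limAvg hψ hw)
  have h2 := tendstoInMeasure_iff_measureReal_dist.1 h1 ε hε
  simp only [Real.dist_eq] at h2
  exact (h2.eventually (gt_mem_nhds hη)).mono fun N hN => hN.le

/-- Outside a set of small measure, a sequence of lattices and one of its shifts do not differ by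
a nearly unipotent displacement along a long block. -/
theorem exists_no_displacement (hb : 2 ≤ b) (hF : MeasurePreserving seqShift ρ ρ)
    (hA : MeasurePreserving (fun w : ℕ → LatticeSpace => dil b • w) ρ ρ)
    (ht : ∀ η : ℝ, 0 < η → ∃ δ > 0, ρ.real {w | w 0 ∉ forwardThick b δ} ≤ η)
    {K : Set ℝ} (hK : IsCompact K) (hK0 : (0 : ℝ) ∉ K) {η : ℝ} (hη : 0 < η) :
    ∃ Z : Set (ℕ → LatticeSpace), MeasurableSet Z ∧ ρ.real Zᶜ ≤ η ∧ ∃ N : ℕ, ∃ U ∈ 𝓝 (1 : SLR),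
      ∀ w ∈ Z, ∀ j, seqShift^[j] w ∈ Z → ∀ h ∈ U, ∀ τ ∈ K,
        ∃ k < N, w (j + k) ≠ (h * unip τ) • w k := by
  obtain ⟨Ψ, hΨ, hd⟩ := exists_dense_tests
  have hlim := tendsto_measure_iInter_atTop (μ := ρ)
    (fun M => (measurableSet_almostStabSet hΨ K M).nullMeasurableSet) (almostStabSet_anti K)
    ⟨0, measure_ne_top _ _⟩
  rw [ae_avgStab_inter_eq_empty hb hF hA ht hΨ hd hK hK0] at hlim
  obtain ⟨M, hM⟩ := (hlim.eventually (gt_mem_nhds (ENNReal.ofReal_pos.2 (half_pos hη)))).exists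
  have hM' : ρ.real (almostStabSet Ψ K M) ≤ η / 2 :=
    ENNReal.toReal_le_of_le_ofReal (half_pos hη).le hM.le
  set ε : ℝ := 1 / (M + 1) with hεdef
  have hε : 0 < ε := by positivity
  choose T hT using fun i => (hΨ i).exists_finite_net hK (show 0 < ε / 16 by positivity)
  let I : Finset (Σ _ : ℕ, ℝ) := (Finset.range M).sigma fun i => insert 0 (T i)
  let F : (Σ _ : ℕ, ℝ) → LatticeSpace → ℝ := fun p x => Ψ p.1 (unip p.2 • x)
  have hFt : ∀ p, IsTest (F p) := fun p => (hΨ p.1).comp_smul _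
  have hc : 0 < η / (2 * (I.card + 1)) := by positivity
  obtain ⟨N, hN⟩ := ((Finset.eventually_all I).2 fun p _ =>
    exists_measureReal_far_le hF (hFt p) (show 0 < ε / 16 by positivity) hc).exists
  let far : (Σ _ : ℕ, ℝ) → Set (ℕ → LatticeSpace) := fun p =>
    {w | ε / 16 ≤ |seqAvg (F p) N w - limAvg (F p) w|}
  have hfar : ∀ p, MeasurableSet (far p) := fun p => measurableSet_le measurable_const
    (((hFt p).measurable_seqAvg N).sub (hFt p).measurable_limAvg).abs
  have hSM := measurableSet_almostStabSet hΨ K M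
  refine ⟨genericSet ∩ (almostStabSet Ψ K M)ᶜ ∩ ⋂ p ∈ I, (far p)ᶜ,
    (measurableSet_genericSet.inter hSM.compl).inter
      (Finset.measurableSet_biInter _ fun p _ => (hfar p).compl), ?_, N,
    {h | ∀ i ∈ Finset.range M, ∀ x, |Ψ i (h • x) - Ψ i x| < ε / 16},
    (Finset.eventually_all _).2 fun i _ => (hΨ i).eventually_abs_sub_lt (by positivity), ?_⟩
  · have h1 : (genericSet ∩ (almostStabSet Ψ K M)ᶜ ∩ ⋂ p ∈ I, (far p)ᶜ)ᶜ ⊆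
        (genericSetᶜ ∪ almostStabSet Ψ K M) ∪ ⋃ p ∈ I, far p := by
      intro w
      simp only [Set.mem_compl_iff, Set.mem_inter_iff, Set.mem_union, Set.mem_iInter,
        Set.mem_iUnion, exists_prop]
      grind
    have h2 : ρ.real genericSetᶜ = 0 := by
      have h : ρ genericSetᶜ = 0 := mem_ae_iff.1 (ae_mem_genericSet hF)
      rw [measureReal_def, h, ENNReal.toReal_zero]
    have h3 : ρ.real (⋃ p ∈ I, far p) ≤ η / 2 := by
      refine (measureReal_biUnion_finset_le _ _).trans ((Finset.sum_le_card_nsmul I _ _ hN).trans ?_)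
      rw [nsmul_eq_mul, mul_div_assoc', div_le_div_iff₀ (by positivity) (by norm_num)]
      nlinarith
    calc _ ≤ _ := measureReal_mono h1
      _ ≤ _ := measureReal_union_le _ _
      _ ≤ (ρ.real genericSetᶜ + ρ.real (almostStabSet Ψ K M)) + ρ.real (⋃ p ∈ I, far p) := by
        gcongr; exact measureReal_union_le _ _
      _ ≤ η := by linarith
  · rintro w ⟨⟨hwg, hwS⟩, hwI⟩ j ⟨⟨hjg, -⟩, hjI⟩ h hU τ hτ
    by_contra! hcon
    obtain ⟨i, hi, hiε⟩ : ∃ i < M,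
        ε ≤ |limAvg (fun x => Ψ i (unip τ • x)) w - limAvg (Ψ i) w| := by
      by_contra! h1
      exact hwS ⟨hwg, τ, hτ, h1⟩
    obtain ⟨σ, hσ, hσx⟩ := hT i τ hτ
    have hmem : ∀ σ ∈ insert 0 (T i), (⟨i, σ⟩ : Σ _ : ℕ, ℝ) ∈ I := fun σ hσ =>
      Finset.mem_sigma.2 ⟨Finset.mem_range.2 hi, hσ⟩
    have a1 := Set.mem_iInter₂.1 hjI ⟨i, 0⟩ (hmem 0 (Finset.mem_insert_self _ _))
    have a4 := Set.mem_iInter₂.1 hwI ⟨i, σ⟩ (hmem σ (Finset.mem_insert_of_mem hσ))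
    simp only [far, F, Set.mem_compl_iff, Set.mem_ofPred_eq, not_le, unip_zero, one_smul] at a1 a4
    rw [limAvg_seqShift_iterate (hΨ i) hwg] at a1
    have a3 := abs_seqAvg_sub_le (fun x => hσx x) N w
    have a5 := abs_limAvg_sub_le ((hΨ i).comp_smul (unip τ)) ((hΨ i).comp_smul (unip σ)) hσx hwg
    have a2 : |seqAvg (Ψ i) N (seqShift^[j] w) - seqAvg (fun x => Ψ i (unip τ • x)) N w| ≤
        ε / 16 := by
      rw [seqAvg_eq, seqAvg_eq]
      refine abs_avg_sub_le (by positivity) fun k hk => ?_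
      rw [seqShift_iterate, hcon k hk, mul_smul]
      exact (hU i (Finset.mem_range.2 hi) _).le
    have : |limAvg (fun x => Ψ i (unip τ • x)) w - limAvg (Ψ i) w| < ε := by
      rw [abs_lt] at *
      rw [abs_le] at *
      constructor <;> linarith [a1.1, a1.2, a2.1, a2.2, a3.1, a3.2, a4.1, a4.2, a5.1, a5.2]
    linarith

end Displacement

section Hecke

open Topology LatticeSpace Matrix

/-- The double coset of `dil b ^ (-k)` with respect to the integer subgroup. -/
def heckeSet (b k : ℕ) : Set SLR :=
  {h | ∃ γ ∈ integerSubgroup, ∃ γ₂ ∈ integerSubgroup, h = γ * (dil b ^ k)⁻¹ * γ₂}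

/-- The Hecke correspondence of index `b ^ k` on the space of lattices. -/
def heckeRel (b k : ℕ) (x y : LatticeSpace) : Prop :=
  ∃ g, LatticeSpace.mk g = x ∧ LatticeSpace.mk (g * (dil b ^ k)⁻¹) = y

lemma heckeRel_mk_iff {b k : ℕ} {g h : SLR} :
    heckeRel b k (LatticeSpace.mk g) (LatticeSpace.mk h) ↔ g⁻¹ * h ∈ heckeSet b k := by
  constructor
  · rintro ⟨g', h1, h2⟩
    exact ⟨g⁻¹ * g', mk_eq_mk_iff.1 h1.symm, _, mk_eq_mk_iff.1 h2, by group⟩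
  · rintro ⟨γ, hγ, γ', hγ', he⟩
    have hh : h = g * γ * (dil b ^ k)⁻¹ * γ' := by
      rw [inv_mul_eq_iff_eq_mul] at he; rw [he]; group
    exact ⟨g * γ, mk_mul_of_mem g hγ, by rw [hh, mk_mul_of_mem _ hγ']⟩

lemma heckeRel.smul {b k : ℕ} {x y : LatticeSpace} (h : heckeRel b k x y) (g : SLR) :
    heckeRel b k (g • x) (g • y) := by
  obtain ⟨g', rfl, rfl⟩ := h
  exact ⟨g * g', rfl, by rw [smul_mk, mul_assoc]⟩

/-- The scaling making the double coset integral. -/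
noncomputable def heckeScale (b k : ℕ) : ℝ := Real.exp (k * (Real.log b / 2))

lemma heckeScale_pos (b k : ℕ) : 0 < heckeScale b k := Real.exp_pos _

lemma heckeScale_mul_self {b : ℕ} (hb : 0 < b) (k : ℕ) :
    heckeScale b k * heckeScale b k = (b : ℝ) ^ k := by
  simpa [heckeScale] using exp_mul_log_half hb k

lemma dil_pow_eq (b k : ℕ) : dil b ^ k = diagMat (k * (Real.log b / 2)) := by
  simpa using dil_zpow b k

lemma scale_smul_mem_integerMatrices {b : ℕ} (hb : 0 < b) {k : ℕ} {h : SLR}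
    (hh : h ∈ heckeSet b k) :
    heckeScale b k • (h : Matrix (Fin 2) (Fin 2) ℝ) ∈ integerMatrices := by
  obtain ⟨γ, ⟨M, rfl⟩, γ', ⟨M', rfl⟩, rfl⟩ := hh
  have h2 := heckeScale_mul_self hb k
  refine ⟨(M : Matrix (Fin 2) (Fin 2) ℤ) * !![1, 0; 0, (b : ℤ) ^ k] * M', ?_⟩
  rw [dil_pow_eq, ← diagMat_neg]
  ext i j
  simp only [Matrix.smul_apply, mul_apply_fin_two]
  simp [Matrix.mul_apply, Fin.sum_univ_two, diagMat]
  have h3 : heckeScale b k * Real.exp (-(k * (Real.log b / 2))) = 1 := by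
    rw [heckeScale, ← Real.exp_add]; simp
  have h4 : Real.exp (k * (Real.log b / 2)) = heckeScale b k := rfl
  rw [h4]
  linear_combination (-(M i 0 : ℝ) * M' 0 j) * h3 - (M i 1 : ℝ) * M' 1 j * h2

lemma isClosed_heckeSet {b : ℕ} (hb : 0 < b) (k : ℕ) : IsClosed (heckeSet b k) := by
  have hc := (heckeScale_pos b k).ne'
  have hcl : IsClosed ((fun h : SLR => heckeScale b k • (h : Matrix (Fin 2) (Fin 2) ℝ)) ''
      heckeSet b k) := isClosed_of_subset_integerMatrices (by
    rintro _ ⟨h, hh, rfl⟩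
    exact scale_smul_mem_integerMatrices hb hh)
  have hcont : Continuous fun h : SLR => heckeScale b k • (h : Matrix (Fin 2) (Fin 2) ℝ) :=
    (continuous_const_smul (heckeScale b k)).comp continuous_subtype_val
  have hinj : Function.Injective fun h : SLR =>
      heckeScale b k • (h : Matrix (Fin 2) (Fin 2) ℝ) := fun g h hgh =>
    Subtype.ext (smul_right_injective _ hc hgh)
  have := hcl.preimage hcont
  rwa [Set.preimage_image_eq _ hinj] at this

lemma isOpenQuotientMap_prodMap_mk : IsOpenQuotientMap (Prod.map LatticeSpace.mk LatticeSpace.mk) :=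
  isOpenQuotientMap_mk.prodMap isOpenQuotientMap_mk

lemma isClosed_heckeRel {b : ℕ} (hb : 0 < b) (k : ℕ) :
    IsClosed {p : LatticeSpace × LatticeSpace | heckeRel b k p.1 p.2} := by
  rw [← isOpenQuotientMap_prodMap_mk.isQuotientMap.isClosed_preimage]
  have : Prod.map LatticeSpace.mk LatticeSpace.mk ⁻¹' {p : LatticeSpace × LatticeSpace | heckeRel b k p.1 p.2} =
      (fun p : SLR × SLR => p.1⁻¹ * p.2) ⁻¹' heckeSet b k := by
    ext p
    exact heckeRel_mk_iff
  rw [this]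
  exact (isClosed_heckeSet hb k).preimage (continuous_fst.inv.mul continuous_snd)

lemma eventually_eq_of_mem_heckeSet {b : ℕ} (hb : 0 < b) {k : ℕ} {h₀ : SLR} :
    ∀ᶠ h in 𝓝 h₀, h ∈ heckeSet b k → h = h₀ := by
  have hcl : IsClosed ((fun h : SLR => heckeScale b k • (h : Matrix (Fin 2) (Fin 2) ℝ)) ''
      (heckeSet b k \ {h₀})) := isClosed_of_subset_integerMatrices (by
    rintro _ ⟨h, hh, rfl⟩
    exact scale_smul_mem_integerMatrices hb hh.1)
  have hcont : Continuous fun h : SLR => heckeScale b k • (h : Matrix (Fin 2) (Fin 2) ℝ) :=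
    (continuous_const_smul (heckeScale b k)).comp continuous_subtype_val
  have hinj : Function.Injective fun h : SLR =>
      heckeScale b k • (h : Matrix (Fin 2) (Fin 2) ℝ) := fun g h hgh =>
    Subtype.ext (smul_right_injective _ (heckeScale_pos b k).ne' hgh)
  have := hcl.preimage hcont
  rw [Set.preimage_image_eq _ hinj] at this
  filter_upwards [this.isOpen_compl.mem_nhds (x := h₀) (by simp)] with h hh hmem
  by_contra hne
  exact hh ⟨hmem, hne⟩

lemma heckeRel_isolated {b : ℕ} (hb : 0 < b) {k : ℕ} {x y : LatticeSpace} :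
    ∀ᶠ p : SLR × LatticeSpace in 𝓝 (1, y), heckeRel b k (p.1 • x) p.2 → p.2 = p.1 • y := by
  obtain ⟨g₀, rfl⟩ := mk_surjective x
  obtain ⟨h₀, rfl⟩ := mk_surjective y
  have hq : IsOpenQuotientMap (Prod.map (id : SLR → SLR) LatticeSpace.mk) :=
    IsOpenQuotientMap.id.prodMap isOpenQuotientMap_mk
  have hmap : 𝓝 ((1 : SLR), LatticeSpace.mk h₀) = map (Prod.map id LatticeSpace.mk) (𝓝 ((1 : SLR), h₀)) :=
    (hq.isOpenMap.map_nhds_eq (x := ((1 : SLR), h₀)) hq.continuous.continuousAt).symm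
  rw [hmap, eventually_map]
  have hc : Tendsto (fun p : SLR × SLR => (p.1 * g₀)⁻¹ * p.2) (𝓝 (1, h₀)) (𝓝 (g₀⁻¹ * h₀)) := by
    have : Continuous fun p : SLR × SLR => (p.1 * g₀)⁻¹ * p.2 := by fun_prop
    simpa using this.tendsto ((1 : SLR), h₀)
  filter_upwards [hc.eventually (eventually_eq_of_mem_heckeSet hb)] with p hp hrel
  have h1 := hp (heckeRel_mk_iff.1 hrel)
  have h2 : p.2 = p.1 * h₀ := by
    rw [inv_mul_eq_iff_eq_mul] at h1; rw [h1]; group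
  simp [h2]

lemma nhds_lattice_eq_map (x : LatticeSpace) : 𝓝 x = map (fun g : SLR => g • x) (𝓝 1) := by
  obtain ⟨g₀, rfl⟩ := mk_surjective x
  rw [← isOpenQuotientMap_mk.isOpenMap.map_nhds_eq isOpenQuotientMap_mk.continuous.continuousAt]
  have h := (Homeomorph.mulRight g₀).map_nhds_eq 1
  simp only [Homeomorph.coe_mulRight, one_mul] at h
  rw [← h, Filter.map_map]
  rfl

/-- Nearby Hecke orbits differ by a small displacement. -/
lemma exists_displacement_of_heckeRel {b : ℕ} (hb : 0 < b) (w : ℕ → LatticeSpace) (N : ℕ)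
    {U : Set SLR} (hU : U ∈ 𝓝 (1 : SLR)) :
    ∀ᶠ w' in 𝓝 w, (∀ k, heckeRel b k (w' 0) (w' k)) → ∃ g ∈ U, ∀ k < N, w' k = g • w k := by
  have h1 : ∀ k : ℕ, ∃ V ∈ 𝓝 (1 : SLR), ∃ V' ∈ 𝓝 (w k), ∀ g ∈ V, ∀ y ∈ V',
      heckeRel b k (g • w 0) y → y = g • w k := by
    intro k
    have := heckeRel_isolated hb (k := k) (x := w 0) (y := w k)
    obtain ⟨V, hV, V', hV', h⟩ := mem_nhds_prod_iff.1 this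
    exact ⟨V, hV, V', hV', fun g hg y hy => h (Set.mk_mem_prod hg hy)⟩
  choose V hV V' hV' h using h1
  have hW : U ∩ ⋂ k ∈ Finset.range N, V k ∈ 𝓝 (1 : SLR) :=
    inter_mem hU ((biInter_finset_mem _).2 fun k _ => hV k)
  have h0 : (fun g : SLR => g • w 0) '' (U ∩ ⋂ k ∈ Finset.range N, V k) ∈ 𝓝 (w 0) := by
    rw [nhds_lattice_eq_map]; exact image_mem_map hW
  have h0' : ∀ᶠ w' in 𝓝 w,
      w' 0 ∈ (fun g : SLR => g • w 0) '' (U ∩ ⋂ k ∈ Finset.range N, V k) :=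
    (continuous_apply 0).continuousAt.eventually h0
  have hk : ∀ᶠ w' in 𝓝 w, ∀ k ∈ Finset.range N, w' k ∈ V' k :=
    (Finset.eventually_all _).2 fun k _ => (continuous_apply k).continuousAt.eventually (hV' k)
  filter_upwards [h0', hk] with w' ⟨g, ⟨hgU, hgV⟩, hg⟩ hk hrel
  refine ⟨g, hgU, fun k hkN => h k g ?_ _ (hk k (Finset.mem_range.2 hkN)) ?_⟩
  · exact Set.mem_iInter₂.1 hgV k (Finset.mem_range.2 hkN)
  · have : g • w 0 = w' 0 := hg
    rw [this]; exact hrel k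

lemma heckeScale_gt_one {b : ℕ} (hb : 2 ≤ b) {k : ℕ} (hk : 0 < k) : 1 < heckeScale b k := by
  rw [heckeScale, Real.one_lt_exp_iff]
  have : 0 < Real.log b := Real.log_pos (by exact_mod_cast (by omega : 1 < b))
  positivity

lemma dil_pow_inv_notMem {b : ℕ} (hb : 2 ≤ b) {k : ℕ} (hk : 0 < k) :
    (dil b ^ k)⁻¹ ∉ integerSubgroup := by
  rw [dil_pow_eq, ← diagMat_neg, mem_integerSubgroup_iff]
  rintro ⟨M, hM⟩
  have h1 : (M 0 0 : ℝ) = Real.exp (-(k * (Real.log b / 2))) := by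
    simpa [diagMat] using congrFun (congrFun hM 0) 0
  have h2 := heckeScale_gt_one hb hk
  rw [heckeScale] at h2
  rw [Real.exp_neg] at h1
  have h3 : (0 : ℝ) < M 0 0 := by rw [h1]; positivity
  have h4 : (M 0 0 : ℝ) < 1 := by rw [h1]; exact inv_lt_one_of_one_lt₀ h2
  norm_cast at h3 h4
  omega

lemma not_heckeRel_self {b : ℕ} (hb : 2 ≤ b) {k : ℕ} (hk : 0 < k) (x : LatticeSpace) :
    ¬ heckeRel b k x x := by
  rintro ⟨g, rfl, h⟩
  rw [eq_comm, mk_eq_mk_iff] at h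
  exact dil_pow_inv_notMem hb hk (by simpa using h)

/-- The lattices containing a nonzero horizontal vector. -/
def horizontalLattices : Set LatticeSpace :=
  {x | ∃ g, LatticeSpace.mk g = x ∧ ∃ p q : ℤ, (p ≠ 0 ∨ q ≠ 0) ∧ g 1 0 * p + g 1 1 * q = 0}

lemma mem_horizontalLattices_of_heckeRel {b : ℕ} (hb : 2 ≤ b) {k : ℕ} (hk : 0 < k)
    {x : LatticeSpace} {β : ℝ} (h : heckeRel b k x (unip β • x)) : x ∈ horizontalLattices := by
  have hβ : β ≠ 0 := by
    rintro rfl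
    exact not_heckeRel_self hb hk x (by simpa using h)
  obtain ⟨g, rfl, h⟩ := h
  refine ⟨g, rfl, ?_⟩
  by_cases hd : g 1 1 = 0
  · exact ⟨0, 1, by simp, by simp [hd]⟩
  rw [smul_mk, eq_comm, mk_eq_mk_iff] at h
  obtain ⟨γ, hγ⟩ := h
  set c := heckeScale b k with hc
  have hc0 : 0 < c := heckeScale_pos b k
  have hcc : c * c = (b : ℝ) ^ k := heckeScale_mul_self (by omega) k
  have hγ' : SpecialLinearGroup.map (Int.castRingHom ℝ) γ * dil b ^ k = g⁻¹ * unip (-β) * g := by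
    rw [hγ, unip_neg]; group
  have hdet := det_eq g
  have e00 : (γ 0 0 : ℝ) * c = 1 - β * (g 1 0 * g 1 1) := by
    have := congrArg (fun m : SLR => m 0 0) hγ'
    simp only [mul_apply_fin_two, dil_pow_eq] at this
    simp [diagMat, Matrix.adjugate_fin_two] at this
    rw [hc, heckeScale]
    linear_combination this + hdet
  have e01 : (γ 0 1 : ℝ) = - c * β * g 1 1 ^ 2 := by
    have := congrArg (fun m : SLR => m 0 1) hγ'
    simp only [mul_apply_fin_two, dil_pow_eq] at this
    simp [diagMat, Matrix.adjugate_fin_two] at this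
    have h3 : c * Real.exp (-(k * (Real.log b / 2))) = 1 := by
      rw [hc, heckeScale, ← Real.exp_add]; simp
    linear_combination (-(γ 0 1 : ℝ)) * h3 + c * this
  have e11 : (γ 1 1 : ℝ) = c * (1 + β * (g 1 0 * g 1 1)) := by
    have := congrArg (fun m : SLR => m 1 1) hγ'
    simp only [mul_apply_fin_two, dil_pow_eq] at this
    simp [diagMat, Matrix.adjugate_fin_two] at this
    have h3 : c * Real.exp (-(k * (Real.log b / 2))) = 1 := by
      rw [hc, heckeScale, ← Real.exp_add]; simp
    linear_combination (-(γ 1 1 : ℝ)) * h3 + c * this + c * hdet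
  have hT : (2 : ℝ) * c = ((b : ℤ) ^ k * γ 0 0 + γ 1 1 : ℤ) := by
    push_cast
    rw [← hcc]
    linear_combination (-c) * e00 - e11
  refine ⟨2 * γ 0 1, -(2 * ((b : ℤ) ^ k * γ 0 0) - ((b : ℤ) ^ k * γ 0 0 + γ 1 1)), Or.inl ?_, ?_⟩
  · intro h0
    have h1 : (γ 0 1 : ℝ) = 0 := by
      have : γ 0 1 = 0 := by omega
      exact_mod_cast this
    rw [e01] at h1
    have : c * β * g 1 1 ^ 2 ≠ 0 := by positivity
    exact this (by linarith)
  · push_cast at hT ⊢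
    rw [← hT, ← hcc, e01]
    linear_combination (-2 * c * g 1 1) * e00

lemma eventually_notMem_thick_of_horizontal {b : ℕ} (hb : 2 ≤ b) {x : LatticeSpace}
    (hx : x ∈ horizontalLattices) {δ : ℝ} (hδ : 0 < δ) :
    ∀ᶠ k : ℕ in atTop, (dil b ^ k)⁻¹ • x ∉ thick δ := by
  obtain ⟨g, rfl, p, q, hpq, h0⟩ := hx
  have hb1 : (1 : ℝ) < b := by exact_mod_cast (by omega : 1 < b)
  have hlim : Tendsto (fun k : ℕ => ((b : ℝ) ^ k)⁻¹ * (g 0 0 * p + g 0 1 * q) ^ 2) atTop (𝓝 0) := by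
    simpa using (tendsto_inv_atTop_zero.comp
      (tendsto_pow_atTop_atTop_of_one_lt hb1)).mul_const ((g 0 0 * p + g 0 1 * q) ^ 2)
  filter_upwards [hlim.eventually (gt_mem_nhds hδ)] with k hk hmem
  rw [smul_mk, mk_mem_thick_iff] at hmem
  have h1 := hmem p q hpq
  have h2 := sqLength_dil_unip (by omega : 0 < b) (-k) 0 g p q
  rw [unip_zero, one_mul, h0, _root_.zpow_neg, _root_.zpow_neg, zpow_natCast, zpow_natCast] at h2
  rw [h2] at h1
  simp only [mul_zero, add_zero, ne_eq, OfNat.ofNat_ne_zero, not_false_eq_true, zero_pow] at h1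
  linarith

lemma ae_notMem_horizontalLattices {b : ℕ} (hb : 2 ≤ b) {ρ : Measure (ℕ → LatticeSpace)}
    [IsProbabilityMeasure ρ]
    (hA : MeasurePreserving (fun w : ℕ → LatticeSpace => dil b • w) ρ ρ)
    (ht : ∀ η : ℝ, 0 < η → ∃ δ > 0, ρ.real {w | w 0 ∉ forwardThick b δ} ≤ η) :
    ∀ᵐ w ∂ρ, w 0 ∉ horizontalLattices := by
  have hA' : MeasurePreserving (fun w : ℕ → LatticeSpace => (dil b)⁻¹ • w) ρ ρ := by
    refine ⟨measurable_smul_seq _, ?_⟩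
    conv_lhs => rw [← hA.map_eq]
    rw [Measure.map_map (measurable_smul_seq _) (measurable_smul_seq _)]
    have : (fun w : ℕ → LatticeSpace => (dil b)⁻¹ • w) ∘ (fun w => dil b • w) = id := by
      ext w; simp
    rw [this, Measure.map_id]
  have hSm : ∀ m : ℕ, MeasurableSet {w : ℕ → LatticeSpace | w 0 ∈ thick (1 / (m + 1))} := fun m =>
    (isClosed_thick _).measurableSet.preimage (measurable_pi_apply 0)
  have h1 : ∀ᵐ w ∂ρ, ∀ m : ℕ, w 0 ∈ thick (1 / (m + 1)) →
      w 0 ∉ horizontalLattices := by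
    refine ae_all_iff.2 fun m => ?_
    filter_upwards [hA'.conservative.ae_mem_imp_frequently_image_mem (hSm m).nullMeasurableSet]
      with w hw hm hhor
    obtain ⟨k, hk1, hk2⟩ := ((hw hm).and_eventually (eventually_notMem_thick_of_horizontal hb hhor
      (show (0 : ℝ) < 1 / (m + 1) by positivity))).exists
    have hit : (fun w : ℕ → LatticeSpace => (dil b)⁻¹ • w)^[k] w = (dil b ^ k)⁻¹ • w := by
      rw [smul_iterate, inv_pow]
    rw [hit] at hk1
    exact hk2 hk1
  have h2 : ∀ᵐ w ∂ρ, ∃ m : ℕ, w 0 ∈ thick (1 / (m + 1)) := by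
    rw [ae_iff]
    by_contra hne
    have hpos : 0 < ρ.real {w : ℕ → LatticeSpace | ¬ ∃ m : ℕ, w 0 ∈ thick (1 / (m + 1))} :=
      ENNReal.toReal_pos hne (measure_ne_top _ _)
    obtain ⟨δ, hδ, h3⟩ := ht _ (half_pos hpos)
    obtain ⟨m, hm⟩ := exists_nat_one_div_lt hδ
    have h4 : ρ.real {w : ℕ → LatticeSpace | ¬ ∃ m : ℕ, w 0 ∈ thick (1 / (m + 1))} ≤
        ρ.real {w | w 0 ∉ forwardThick b δ} := by
      refine measureReal_mono fun w hw hmem => hw ⟨m, ?_⟩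
      exact thick_anti hm.le (forwardThick_subset b δ hmem)
    linarith
  filter_upwards [h1, h2] with w hw ⟨m, hm⟩ using hw m hm

end Hecke

section Scales

open Finset

lemma exists_scales {n : ℕ} (hn : 2 ≤ n) {A C : ℝ} (hA : 0 ≤ A) (hC : 0 ≤ C)
    (hAC : A ≠ 0 ∨ C ≠ 0) {M : ℕ} (hAM : (n : ℝ) ^ M * A ≤ 1) (hCM : (n : ℝ) ^ (2 * M) * C ≤ 1) :
    ∃ (I : ℕ) (i : ℕ → ℕ), M ≤ I ∧
      (∀ l, 2 * l ≤ I → I ≤ 2 * i l + 1 ∧ 2 * l + i l ≤ 2 * I ∧ (n : ℝ) ^ i l * A ≤ 1 ∧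
        (n : ℝ) ^ (2 * (i l + l)) * C ≤ 1 ∧
        (1 / (n : ℝ) ^ 2 ≤ (n : ℝ) ^ i l * A ∨
          1 / (n : ℝ) ^ 2 ≤ (n : ℝ) ^ (2 * (i l + l)) * C)) ∧
      ∀ l l', l < l' → 2 * l' ≤ I → 2 * l + i l < 2 * l' + i l' := by
  have hn1 : (1 : ℝ) < n := by exact_mod_cast (by omega : 1 < n)
  have hn0 : (0 : ℝ) < n := by linarith
  have key : ∀ x : ℝ, 1 < x → ∀ D : ℝ, 0 < D → x ^ M * D ≤ 1 →
      ∃ a, M ≤ a ∧ x ^ a * D ≤ 1 ∧ 1 / x ≤ x ^ a * D := by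
    intro x hx D hD hxM
    have h1 : x ^ M ≤ 1 / D := by rwa [le_div_iff₀ hD]
    obtain ⟨a, h2, h3⟩ := exists_nat_pow_near ((one_le_pow₀ hx.le).trans h1) hx
    refine ⟨a, ?_, by rwa [le_div_iff₀ hD] at h2, ?_⟩
    · have := (pow_lt_pow_iff_right₀ hx).1 (h1.trans_lt h3)
      omega
    · rw [div_lt_iff₀ hD] at h3
      rw [div_le_iff₀ (by linarith)]
      calc (1 : ℝ) ≤ x ^ (a + 1) * D := h3.le
        _ = _ := by ring
  have hn2 : 1 / (n : ℝ) ^ 2 ≤ 1 / n := by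
    apply one_div_le_one_div_of_le hn0; nlinarith
  have mono : ∀ {e e' : ℕ} {D : ℝ}, 0 ≤ D → e ≤ e' → (n : ℝ) ^ e' * D ≤ 1 →
      (n : ℝ) ^ e * D ≤ 1 := fun hD he h =>
    (mul_le_mul_of_nonneg_right (pow_le_pow_right₀ hn1.le he) hD).trans h
  have hC2 : 0 < C → ∃ c, M ≤ c ∧ (n : ℝ) ^ (2 * c) * C ≤ 1 ∧
      1 / (n : ℝ) ^ 2 ≤ (n : ℝ) ^ (2 * c) * C := by
    intro hC0
    obtain ⟨c, h1, h2, h3⟩ := key ((n : ℝ) ^ 2) (one_lt_pow₀ hn1 two_ne_zero) C hC0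
      (by rwa [← pow_mul])
    exact ⟨c, h1, by rwa [pow_mul], by rwa [pow_mul]⟩
  have main : ∃ a c, M ≤ a ∧ M ≤ c ∧ (n : ℝ) ^ a * A ≤ 1 ∧ (n : ℝ) ^ (2 * c) * C ≤ 1 ∧
      ((1 / (n : ℝ) ^ 2 ≤ (n : ℝ) ^ a * A ∧ 1 / (n : ℝ) ^ 2 ≤ (n : ℝ) ^ (2 * c) * C) ∨
       (1 / (n : ℝ) ^ 2 ≤ (n : ℝ) ^ a * A ∧ 2 * a ≤ c) ∨
       (1 / (n : ℝ) ^ 2 ≤ (n : ℝ) ^ (2 * c) * C ∧ c ≤ a)) := by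
    rcases hA.eq_or_lt with hA0 | hA0
    · have hC0 : 0 < C := lt_of_le_of_ne hC (by
        rcases hAC with h | h
        · exact absurd hA0.symm h
        · exact h.symm)
      obtain ⟨c, h1, h2, h3⟩ := hC2 hC0
      exact ⟨c, c, h1, h1, by simp [← hA0], h2, Or.inr (Or.inr ⟨h3, le_rfl⟩)⟩
    · obtain ⟨a, h1, h2, h3⟩ := key n hn1 A hA0 hAM
      rcases hC.eq_or_lt with hC0 | hC0
      · exact ⟨a, 2 * a, h1, by omega, h2, by simp [← hC0], Or.inr (Or.inl ⟨hn2.trans h3, le_rfl⟩)⟩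
      · obtain ⟨c, h1', h2', h3'⟩ := hC2 hC0
        exact ⟨a, c, h1, h1', h2, h2', Or.inl ⟨hn2.trans h3, h3'⟩⟩
  obtain ⟨a, c, ha, hc, hAa, hCc, hmax⟩ := main
  refine ⟨min a c, fun l => min a (c - l), by omega, fun l hl => ⟨by dsimp only; omega,
    by dsimp only; omega, mono hA (by dsimp only; omega) hAa,
    mono hC (by dsimp only; omega) hCc, ?_⟩, fun l l' hll hl' => by dsimp only; omega⟩
  dsimp only
  rcases hmax with ⟨h1, h2⟩ | ⟨h1, h2⟩ | ⟨h1, h2⟩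
  · rcases le_total a (c - l) with h | h
    · left; rwa [min_eq_left h]
    · right
      have : min a (c - l) + l = c := by omega
      rwa [this]
  · left
    have : min a (c - l) = a := by omega
    rwa [this]
  · right
    have : min a (c - l) + l = c := by omega
    rwa [this]

lemma exists_good_scale {I : ℕ} {q : ℕ → ℕ} (hq : ∀ l, 2 * l ≤ I → q l ≤ 2 * I)
    (hmono : ∀ l l', l < l' → 2 * l' ≤ I → q l < q l') {S₁ S₂ S₃ : Set ℕ}
    [DecidablePred (· ∈ S₁)] [DecidablePred (· ∈ S₂)] [DecidablePred (· ∈ S₃)]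
    (h₁ : ∀ k : ℕ, 10 * #{i ∈ range k | i ∈ S₁} ≤ k)
    (h₂ : ∀ k : ℕ, 10 * #{i ∈ range k | i ∈ S₂} ≤ k)
    (h₃ : ∀ k : ℕ, 10 * #{i ∈ range k | i ∈ S₃} ≤ k) :
    ∃ l, 2 * l ≤ I ∧ 2 * l ∉ S₁ ∧ 2 * l ∉ S₂ ∧ q l ∉ S₃ := by
  by_contra! hcon
  set R := range (I / 2 + 1) with hR
  have hRm : ∀ l ∈ R, 2 * l ≤ I := fun l hl => by rw [hR, mem_range] at hl; omega
  have h2 : ∀ (S : Set ℕ) [DecidablePred (· ∈ S)],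
      #{l ∈ R | 2 * l ∈ S} ≤ #{i ∈ range (I + 1) | i ∈ S} := by
    intro S _
    refine card_le_card_of_injOn (fun l => 2 * l) (fun l hl => ?_) (fun l _ l' _ h => by
      have : 2 * l = 2 * l' := h
      omega)
    have hl' := mem_filter.1 hl
    have := hRm l hl'.1
    exact mem_filter.2 ⟨mem_range.2 (by dsimp only; omega), hl'.2⟩
  have h3 : #{l ∈ R | q l ∈ S₃} ≤ #{i ∈ range (2 * I + 1) | i ∈ S₃} := by
    refine card_le_card_of_injOn q (fun l hl => ?_) (fun l hl l' hl' h => ?_)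
    · have hl' := mem_filter.1 hl
      have := hq l (hRm l hl'.1)
      exact mem_filter.2 ⟨mem_range.2 (by omega), hl'.2⟩
    · have h1 := hRm l (mem_filter.1 hl).1
      have h1' := hRm l' (mem_filter.1 hl').1
      rcases lt_trichotomy l l' with hlt | rfl | hlt
      · have := hmono l l' hlt h1'; omega
      · rfl
      · have := hmono l' l hlt h1; omega
  have hcov : R ⊆ ({l ∈ R | 2 * l ∈ S₁} ∪ {l ∈ R | 2 * l ∈ S₂}) ∪ {l ∈ R | q l ∈ S₃} := by
    intro l hl
    simp only [mem_union, mem_filter, hl, true_and]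
    have := hcon l (hRm l hl)
    tauto
  have hc := (card_le_card hcov).trans ((card_union_le _ _).trans
    (Nat.add_le_add_right (card_union_le _ _) _))
  have hcR : #R = I / 2 + 1 := card_range _
  have e1 := h2 S₁
  have e2 := h2 S₂
  have f1 := h₁ (I + 1)
  have f2 := h₂ (I + 1)
  have f3 := h₃ (2 * I + 1)
  omega

end Scales

section Quadratic

lemma quadratic_coeff_lt {b₀ b₁ b₂ θ c t₁ t₂ t₃ : ℝ} (hθ : 0 < θ) (hθ1 : θ ≤ 1)
    (h₁ : |t₁| ≤ 1) (h₂ : |t₂| ≤ 1) (h12 : θ < |t₂ - t₁|) (h13 : θ < |t₃ - t₁|)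
    (h23 : θ < |t₃ - t₂|)
    (q₁ : |b₀ + b₁ * t₁ + b₂ * t₁ ^ 2| < c) (q₂ : |b₀ + b₁ * t₂ + b₂ * t₂ ^ 2| < c)
    (q₃ : |b₀ + b₁ * t₃ + b₂ * t₃ ^ 2| < c) :
    |b₁| * θ ^ 2 < 11 * c ∧ |b₂| * θ ^ 2 < 11 * c := by
  have hc : 0 < c := (abs_nonneg _).trans_lt q₁
  have d12 : |b₁ + b₂ * (t₁ + t₂)| * θ ≤ 2 * c := by
    calc |b₁ + b₂ * (t₁ + t₂)| * θ ≤ |b₁ + b₂ * (t₁ + t₂)| * |t₂ - t₁| := by gcongr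
      _ = |(b₀ + b₁ * t₂ + b₂ * t₂ ^ 2) - (b₀ + b₁ * t₁ + b₂ * t₁ ^ 2)| := by
        rw [← abs_mul]; congr 1; ring
      _ ≤ _ := (abs_sub _ _).trans (by linarith)
  have d13 : |b₁ + b₂ * (t₁ + t₃)| * θ ≤ 2 * c := by
    calc |b₁ + b₂ * (t₁ + t₃)| * θ ≤ |b₁ + b₂ * (t₁ + t₃)| * |t₃ - t₁| := by gcongr
      _ = |(b₀ + b₁ * t₃ + b₂ * t₃ ^ 2) - (b₀ + b₁ * t₁ + b₂ * t₁ ^ 2)| := by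
        rw [← abs_mul]; congr 1; ring
      _ ≤ _ := (abs_sub _ _).trans (by linarith)
  have e2 : |b₂| * θ ^ 2 ≤ 4 * c := by
    calc |b₂| * θ ^ 2 = |b₂| * θ * θ := by ring
      _ ≤ |b₂| * |t₃ - t₂| * θ := by gcongr
      _ = |(b₁ + b₂ * (t₁ + t₃)) - (b₁ + b₂ * (t₁ + t₂))| * θ := by
        rw [← abs_mul]; congr 2; ring
      _ ≤ (|b₁ + b₂ * (t₁ + t₃)| + |b₁ + b₂ * (t₁ + t₂)|) * θ := by
        gcongr; exact abs_sub _ _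
      _ ≤ _ := by linarith
  refine ⟨?_, by linarith⟩
  have e1 : |b₁| ≤ |b₁ + b₂ * (t₁ + t₂)| + |b₂| * 2 := by
    have h3 : |t₁ + t₂| ≤ 2 := (abs_add_le _ _).trans (by linarith)
    have h4 : |b₂ * (t₁ + t₂)| ≤ |b₂| * 2 := by rw [abs_mul]; gcongr
    calc |b₁| = |(b₁ + b₂ * (t₁ + t₂)) - b₂ * (t₁ + t₂)| := by congr 1; ring
      _ ≤ _ := (abs_sub _ _).trans (by linarith)
  calc |b₁| * θ ^ 2 ≤ (|b₁ + b₂ * (t₁ + t₂)| + |b₂| * 2) * θ ^ 2 := by gcongr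
    _ = |b₁ + b₂ * (t₁ + t₂)| * θ * θ + 2 * (|b₂| * θ ^ 2) := by ring
    _ ≤ 2 * c * 1 + 2 * (4 * c) := by gcongr
    _ < 11 * c := by linarith

lemma measureReal_quadratic_le {Ω : Type*} [MeasurableSpace Ω] {m : Measure Ω}
    [IsProbabilityMeasure m] {t : Ω → ℝ} {θ : ℝ} (hθ : 0 < θ) (hθ1 : θ ≤ 1)
    (ht : ∀ ω, |t ω| ≤ 1) (hm : ∀ x, m.real {ω | |t ω - x| ≤ θ} ≤ 1 / 8)
    {b₀ b₁ b₂ c : ℝ} (hb : 11 * c ≤ |b₁| * θ ^ 2 ∨ 11 * c ≤ |b₂| * θ ^ 2) :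
    m.real {ω | |b₀ + b₁ * t ω + b₂ * t ω ^ 2| < c} ≤ 1 / 4 := by
  set S := {ω | |b₀ + b₁ * t ω + b₂ * t ω ^ 2| < c} with hS
  by_cases hne : S.Nonempty
  swap
  · rw [Set.not_nonempty_iff_eq_empty.1 hne]; simp
  obtain ⟨ω₁, h₁⟩ := hne
  by_cases hne2 : ∃ ω₂ ∈ S, θ < |t ω₂ - t ω₁|
  swap
  · push Not at hne2
    exact (measureReal_mono (fun ω hω => hne2 ω hω)).trans ((hm _).trans (by norm_num))
  obtain ⟨ω₂, h₂, h12⟩ := hne2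
  have hsub : S ⊆ {ω | |t ω - t ω₁| ≤ θ} ∪ {ω | |t ω - t ω₂| ≤ θ} := by
    intro ω₃ h₃
    by_contra hcon
    simp only [Set.mem_union, Set.mem_ofPred_eq, not_or, not_le] at hcon
    have := quadratic_coeff_lt hθ hθ1 (ht ω₁) (ht ω₂) h12 hcon.1 hcon.2 h₁ h₂ h₃
    rcases hb with hb | hb
    · linarith [this.1]
    · linarith [this.2]
  refine (measureReal_mono hsub).trans ((measureReal_union_le _ _).trans ?_)
  linarith [hm (t ω₁), hm (t ω₂)]

end Quadratic

section Nonatomic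

open Topology

lemma exists_uniform_ball_le {m : Measure ℝ} [IsFiniteMeasure m] (h01 : m (Set.Icc 0 1)ᶜ = 0)
    (hm : ∀ x, m {x} = 0) {ε : ENNReal} (hε : 0 < ε) :
    ∃ δ > 0, ∀ x, m (Metric.ball x δ) ≤ ε := by
  have h1 : ∀ x : ℝ, ∃ r > 0, m (Metric.closedBall x r) < ε := by
    intro x
    have hlim := tendsto_measure_biInter_gt (μ := m) (s := fun r => Metric.closedBall x r)
      (a := (0 : ℝ)) (fun r _ => Metric.isClosed_closedBall.measurableSet.nullMeasurableSet)
      (fun i j _ hij => Metric.closedBall_subset_closedBall hij) ⟨1, one_pos, measure_ne_top _ _⟩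
    have hinteg : ⋂ r, ⋂ (_ : r > (0 : ℝ)), Metric.closedBall x r = {x} := by
      ext y
      simp only [Set.mem_iInter, Metric.mem_closedBall, Set.mem_singleton_iff]
      refine ⟨fun h => dist_le_zero.1 (le_of_forall_pos_le_add fun r hr => by
        simpa using h r hr), fun h r hr => by rw [h, dist_self]; exact le_of_lt hr⟩
    rw [hinteg, hm x] at hlim
    obtain ⟨r, hr, hr0⟩ := ((hlim.eventually (gt_mem_nhds hε)).and self_mem_nhdsWithin).exists
    exact ⟨r, hr0, hr⟩
  choose r hr0 hr using h1
  obtain ⟨δ, hδ, hL⟩ := lebesgue_number_lemma_of_metric (s := Set.Icc (-1 : ℝ) 2) isCompact_Icc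
    (c := fun x => Metric.ball x (r x)) (fun x => Metric.isOpen_ball)
    (fun x _ => Set.mem_iUnion.2 ⟨x, Metric.mem_ball_self (hr0 x)⟩)
  refine ⟨min δ 1, by positivity, fun x => ?_⟩
  by_cases hx : x ∈ Set.Icc (-1 : ℝ) 2
  · obtain ⟨y, hy⟩ := hL x hx
    exact (measure_mono ((Metric.ball_subset_ball (min_le_left _ _)).trans
      (hy.trans Metric.ball_subset_closedBall))).trans (hr y).le
  · have : Metric.ball x (min δ 1) ⊆ (Set.Icc 0 1)ᶜ := by
      intro y hy hy'
      have h1 : |y - x| < 1 := (Metric.mem_ball.1 hy).trans_le (min_le_right _ _)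
      rw [abs_lt] at h1
      exact hx ⟨by linarith [hy'.1, hy'.2], by linarith [hy'.1, hy'.2]⟩
    rw [measure_mono_null this h01]
    exact zero_le

end Nonatomic

section Recurrence

open Topology

lemma ae_recurrence {Ω β : Type*} [MeasurableSpace Ω] [TopologicalSpace β]
    [SecondCountableTopology β] [MeasurableSpace β] [OpensMeasurableSpace β] {P : Measure Ω}
    [IsFiniteMeasure P] {T : Ω → Ω} (hT : MeasurePreserving T P P) {p : Ω → β}
    (hp : Measurable p) {Z : Set Ω} (hZ : MeasurableSet Z) :
    ∀ᵐ y ∂P, y ∈ Z → ∀ V ∈ 𝓝 (p y), ∃ j, 0 < j ∧ T^[j] y ∈ Z ∧ p (T^[j] y) ∈ V := by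
  have h1 : ∀ᵐ y ∂P, ∀ O ∈ TopologicalSpace.countableBasis β, y ∈ Z ∩ p ⁻¹' O →
      ∃ᶠ j in atTop, T^[j] y ∈ Z ∩ p ⁻¹' O := by
    rw [ae_ball_iff (TopologicalSpace.countable_countableBasis β)]
    intro O hO
    exact hT.conservative.ae_mem_imp_frequently_image_mem
      (hZ.inter (hp (TopologicalSpace.isOpen_of_mem_countableBasis hO).measurableSet)).nullMeasurableSet
  filter_upwards [h1] with y hy hyZ V hV
  obtain ⟨O, hO, hyO, hOV⟩ :=
    (TopologicalSpace.isBasis_countableBasis β).mem_nhds_iff.1 hV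
  obtain ⟨j, hj, hj0⟩ := ((hy O hO ⟨hyZ, hyO⟩).and_eventually (eventually_gt_atTop 0)).exists
  exact ⟨j, hj0, hj.1, hOV hj.2⟩

end Recurrence

section Displacement

open Topology LatticeSpace Matrix

/-- Lower triangular unipotent matrices. -/
def lowerUnip (r : ℝ) : SLR := ⟨!![1, 0; r, 1], by simp⟩

@[simp] lemma lowerUnip_apply_zero_zero (r : ℝ) : lowerUnip r 0 0 = 1 := rfl
@[simp] lemma lowerUnip_apply_zero_one (r : ℝ) : lowerUnip r 0 1 = 0 := rfl
@[simp] lemma lowerUnip_apply_one_zero (r : ℝ) : lowerUnip r 1 0 = r := rfl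
@[simp] lemma lowerUnip_apply_one_one (r : ℝ) : lowerUnip r 1 1 = 1 := rfl

/-- The lower triangular matrix with diagonal entries `a`, `a⁻¹` and lower left entry `c`, for
positive `a`. -/
noncomputable def lowerMat (a c : ℝ) : SLR :=
  diagMat (Real.log a) * lowerUnip (a * c)

lemma lowerMat_mul_unip {a : ℝ} (ha : 0 < a) (c τ : ℝ) :
    (lowerMat a c * unip τ) 0 0 = a ∧ (lowerMat a c * unip τ) 0 1 = a * τ ∧
    (lowerMat a c * unip τ) 1 0 = c ∧ (lowerMat a c * unip τ) 1 1 = c * τ + a⁻¹ := by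
  have := ha.ne'
  simp only [lowerMat, mul_apply_fin_two]
  simp [Real.exp_neg, Real.exp_log ha, this]

lemma exists_lowerMat_mem {U : Set SLR} (hU : U ∈ 𝓝 (1 : SLR)) :
    ∃ ε : ℝ, 0 < ε ∧ ε ≤ 1 / 2 ∧ ∀ a c : ℝ, |a - 1| < ε → |c| < ε → lowerMat a c ∈ U := by
  have hcont : ContinuousAt (fun p : ℝ × ℝ => lowerMat p.1 p.2) (1, 0) := by
    have h1 : Continuous lowerUnip := by
      refine continuous_of_entries fun i j => ?_
      fin_cases i <;> fin_cases j <;> simp [continuous_const, continuous_id']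
    have h2 : Continuous diagMat := by
      refine continuous_of_entries fun i j => ?_
      fin_cases i <;> fin_cases j <;> simp [diagMat] <;> fun_prop
    refine ContinuousAt.mul (h2.continuousAt.comp ?_) (h1.continuousAt.comp ?_)
    · exact (Real.continuousAt_log one_ne_zero).comp (x := ((1 : ℝ), (0 : ℝ))) continuousAt_fst
    · fun_prop
  have h1 : lowerMat 1 0 = 1 := by
    apply SLR_ext <;> simp only [lowerMat, mul_apply_fin_two] <;> simp
  have h2 : ∀ᶠ p : ℝ × ℝ in 𝓝 (1, 0), lowerMat p.1 p.2 ∈ U :=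
    hcont.eventually (by dsimp only; rw [h1]; exact hU)
  obtain ⟨ε, hε, h⟩ := Metric.eventually_nhds_iff.1 h2
  refine ⟨min ε (1 / 2), by positivity, min_le_right _ _, fun a c ha hc => ?_⟩
  refine h (y := (a, c)) ?_
  rw [Prod.dist_eq, max_lt_iff, Real.dist_eq, Real.dist_eq, sub_zero]
  exact ⟨ha.trans_le (min_le_left _ _), hc.trans_le (min_le_left _ _)⟩

lemma unip_mul_dil_mul {b : ℕ} (hb : 0 < b) (m : ℕ) (s : ℝ) (g : SLR)
    (ha : 0 < g 0 0 + s * ((b : ℝ) ^ m * g 1 0)) :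
    unip s * (dil b ^ m)⁻¹ * g =
      lowerMat (g 0 0 + s * ((b : ℝ) ^ m * g 1 0)) ((b : ℝ) ^ m * g 1 0) *
        unip ((((b : ℝ) ^ m)⁻¹ * g 0 1 + s * (g 1 1 - g 0 0) - s ^ 2 * ((b : ℝ) ^ m * g 1 0)) /
          (g 0 0 + s * ((b : ℝ) ^ m * g 1 0))) * (unip s * (dil b ^ m)⁻¹) := by
  set a := g 0 0 + s * ((b : ℝ) ^ m * g 1 0) with hadef
  set c := (b : ℝ) ^ m * g 1 0 with hc
  set num := ((b : ℝ) ^ m)⁻¹ * g 0 1 + s * (g 1 1 - g 0 0) - s ^ 2 * c with hnum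
  obtain ⟨e00, e01, e10, e11⟩ := dil_zpow_conj hb (-(m : ℤ)) g
  rw [_root_.zpow_neg, zpow_natCast, inv_inv] at e00 e01 e10 e11
  rw [_root_.zpow_neg, zpow_natCast] at e01 e10
  rw [inv_inv] at e10
  have hbm : ((b : ℝ) ^ m)⁻¹ * (b : ℝ) ^ m = 1 :=
    inv_mul_cancel₀ (pow_ne_zero _ (by exact_mod_cast hb.ne'))
  set G := (dil b ^ m)⁻¹ * g * dil b ^ m with hG
  have key : unip s * G * unip (-s) = lowerMat a c * unip (num / a) := by
    obtain ⟨f00, f01, f10, f11⟩ := lowerMat_mul_unip ha c (num / a)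
    have hdet := det_eq G
    have ha' := ha.ne'
    apply SLR_ext
    · rw [f00]
      simp only [mul_apply_fin_two]
      simp [e00, e10]
      rfl
    · rw [f01, mul_div_cancel₀ _ ha']
      simp only [mul_apply_fin_two]
      simp [e00, e01, e10, e11]
      rw [hnum, hc]; ring
    · rw [f10]
      simp only [mul_apply_fin_two]
      simp [e00, e10]
      rfl
    · rw [f11]
      simp only [mul_apply_fin_two]
      rw [e00, e01, e10, e11] at hdet
      simp [e10, e11]
      field_simp
      rw [hnum, hc] at *
      linear_combination hdet
  rw [unip_neg] at key
  rw [← key, hG]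
  group

end Displacement

section Resampling

open Topology LatticeSpace ProbabilityTheory

variable {b : ℕ}

/-- Prepend a term to a sequence. -/
def seqCons {α : Type*} (a : α) (f : ℕ → α) : ℕ → α
  | 0 => a
  | k + 1 => f k

/-- Drop the first term of a sequence. -/
def seqTail {α : Type*} (f : ℕ → α) : ℕ → α := fun k => f (k + 1)

lemma measurable_seqCons {α : Type*} [MeasurableSpace α] :
    Measurable fun p : α × (ℕ → α) => seqCons p.1 p.2 := by
  refine measurable_pi_lambda _ fun k => ?_
  cases k with
  | zero => exact measurable_fst
  | succ k => exact (measurable_pi_apply k).comp measurable_snd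

lemma measurable_seqTail {α : Type*} [MeasurableSpace α] :
    Measurable (seqTail : (ℕ → α) → ℕ → α) :=
  measurable_pi_lambda _ fun k => measurable_pi_apply (k + 1)

lemma ofDigits_seqCons (a : Fin b) (f : ℕ → Fin b) :
    Real.ofDigits (seqCons a f) = (b : ℝ)⁻¹ * ((a : ℕ) + Real.ofDigits f) := by
  rw [Real.ofDigits_eq_sum_add_ofDigits _ 1]
  have : (fun i => seqCons a f (i + 1)) = f := rfl
  rw [this]
  simp [Real.ofDigitsTerm, seqCons]
  ring

/-- States of the past: past digits together with a sequence of lattices. -/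
abbrev PastState (b : ℕ) : Type := (ℕ → Fin b) × (ℕ → LatticeSpace)

/-- Forget the most recent digit. -/
noncomputable def backState (u : PastState b) : PastState b :=
  (seqTail u.1, (dil b)⁻¹ • unip (-((u.1 0 : ℕ) : ℝ)) • u.2)

/-- Move the most recent digit to the future. -/
noncomputable def backMap (y : PastState b × (ℕ → Fin b)) : PastState b × (ℕ → Fin b) :=
  (backState y.1, seqCons (y.1.1 0) y.2)

/-- Shift the sequence of lattices. -/
def leftShift (y : PastState b × (ℕ → Fin b)) : PastState b × (ℕ → Fin b) :=
  ((y.1.1, seqShift y.1.2), y.2)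

/-- The sequence of lattices determined by a past state and future digits. -/
noncomputable def latSeq (y : PastState b × (ℕ → Fin b)) : ℕ → LatticeSpace :=
  unip (Real.ofDigits y.2) • y.1.2

/-- The action of unipotent matrices, as a function of two variables. -/
def unipSmul (p : ℝ × LatticeSpace) : LatticeSpace := unip p.1 • p.2

lemma continuous_unipSmul : Continuous unipSmul :=
  (continuous_unip.comp continuous_fst).smul continuous_snd

lemma measurable_unipSmul : Measurable unipSmul := continuous_unipSmul.measurable

lemma measurable_unip_smul_comp {α : Type*} [MeasurableSpace α] {f : α → ℝ}
    {g : α → ℕ → LatticeSpace} (hf : Measurable f) (hg : Measurable g) :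
    Measurable fun a => unip (f a) • g a := by
  refine measurable_pi_lambda _ fun k => ?_
  have h2 : Measurable fun a => (f a, g a k) := hf.prodMk ((measurable_pi_apply k).comp hg)
  have h3 : Measurable fun a => unipSmul (f a, g a k) := measurable_unipSmul.comp h2
  unfold unipSmul at h3
  exact h3

lemma measurable_ofDigits : Measurable (Real.ofDigits : (ℕ → Fin b) → ℝ) :=
  Real.continuous_ofDigits.measurable

lemma measurable_latSeq : Measurable (latSeq : PastState b × (ℕ → Fin b) → _) :=
  measurable_unip_smul_comp (measurable_ofDigits.comp measurable_snd)
    (measurable_snd.comp measurable_fst)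

lemma measurable_backState : Measurable (backState : PastState b → PastState b) := by
  refine (measurable_seqTail.comp measurable_fst).prodMk ?_
  refine (measurable_smul_seq _).comp (measurable_unip_smul_comp ?_ measurable_snd)
  exact (measurable_of_countable fun i : Fin b => -((i : ℕ) : ℝ)).comp
    ((measurable_pi_apply 0).comp measurable_fst)

lemma measurable_backMap : Measurable (backMap : PastState b × (ℕ → Fin b) → _) :=
  (measurable_backState.comp measurable_fst).prodMk (measurable_seqCons.comp
    ((((measurable_pi_apply 0).comp measurable_fst).comp measurable_fst).prodMk measurable_snd))

lemma measurable_leftShift : Measurable (leftShift : PastState b × (ℕ → Fin b) → _) :=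
  ((measurable_fst.comp measurable_fst).prodMk
    (measurable_seqShift.comp (measurable_snd.comp measurable_fst))).prodMk measurable_snd

lemma backMap_iterate_fst (i : ℕ) (y : PastState b × (ℕ → Fin b)) :
    (backMap^[i] y).1 = backState^[i] y.1 := by
  induction i with
  | zero => rfl
  | succ i ih => rw [Function.iterate_succ_apply', Function.iterate_succ_apply', ← ih]; rfl

lemma latSeq_backMap (hb : 0 < b) (y : PastState b × (ℕ → Fin b)) :
    latSeq (backMap y) = (dil b)⁻¹ • latSeq y := by
  simp only [latSeq, backMap, backState, ofDigits_seqCons]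
  have h := dil_zpow_mul_unip hb (-1) (Real.ofDigits y.2 + (y.1.1 0 : ℕ))
  rw [zpow_neg_one, zpow_neg_one] at h
  rw [add_comm, ← mul_smul, ← mul_smul, ← mul_smul, ← h, unip_add, unip_neg]
  congr 1
  group

lemma latSeq_backMap_iterate (hb : 0 < b) (i : ℕ) (y : PastState b × (ℕ → Fin b)) :
    latSeq (backMap^[i] y) = (dil b ^ i)⁻¹ • latSeq y := by
  induction i with
  | zero => simp
  | succ i ih =>
    rw [Function.iterate_succ_apply', latSeq_backMap hb, ih, ← mul_smul, ← mul_inv_rev, pow_succ]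

lemma latSeq_leftShift (y : PastState b × (ℕ → Fin b)) :
    latSeq (leftShift y) = seqShift (latSeq y) := rfl

lemma latSeq_leftShift_iterate (j : ℕ) (y : PastState b × (ℕ → Fin b)) :
    latSeq (leftShift^[j] y) = seqShift^[j] (latSeq y) := by
  induction j with
  | zero => rfl
  | succ j ih =>
    rw [Function.iterate_succ_apply', Function.iterate_succ_apply', latSeq_leftShift, ih]

lemma leftShift_iterate (j : ℕ) (y : PastState b × (ℕ → Fin b)) :
    leftShift^[j] y = ((y.1.1, seqShift^[j] y.1.2), y.2) := by
  induction j with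
  | zero => rfl
  | succ j ih => rw [Function.iterate_succ_apply', Function.iterate_succ_apply', ih]; rfl

lemma backState_iterate (i j : ℕ) (u : PastState b) :
    backState^[i] (u.1, seqShift^[j] u.2) =
      ((backState^[i] u).1, seqShift^[j] (backState^[i] u).2) := by
  induction i with
  | zero => rfl
  | succ i ih =>
    rw [Function.iterate_succ_apply', Function.iterate_succ_apply', ih]
    simp only [backState, seqShift_iterate_smul]

variable {Q : Measure (PastState b)} [IsProbabilityMeasure Q]
  {κ : Kernel (ℕ → Fin b) (ℕ → Fin b)} [IsMarkovKernel κ]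

/-- The joint law of a past state and of the future digits. -/
noncomputable abbrev jointLaw (Q : Measure (PastState b)) (κ : Kernel (ℕ → Fin b) (ℕ → Fin b)) :
    Measure (PastState b × (ℕ → Fin b)) :=
  Q ⊗ₘ κ.prodMkRight (ℕ → LatticeSpace)

/-- The conditional probability, given the past state, that the dilated sequence of lattices is
outside `Z`. -/
noncomputable def exitProb (κ : Kernel (ℕ → Fin b) (ℕ → Fin b)) (Z : Set (ℕ → LatticeSpace))
    (i : ℕ) (u : PastState b) : ENNReal :=
  κ u.1 {f | dil b ^ i • latSeq (u, f) ∉ Z}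

lemma measurableSet_exit {Z : Set (ℕ → LatticeSpace)} (hZ : MeasurableSet Z) (i : ℕ) :
    MeasurableSet {y : PastState b × (ℕ → Fin b) | dil b ^ i • latSeq y ∉ Z} :=
  (((measurable_smul_seq _).comp measurable_latSeq) hZ).compl

lemma measurable_exitProb {Z : Set (ℕ → LatticeSpace)} (hZ : MeasurableSet Z) (i : ℕ) :
    Measurable (exitProb κ Z i) :=
  Kernel.measurable_kernel_prodMk_left (κ := κ.prodMkRight (ℕ → LatticeSpace))
    (measurableSet_exit hZ i)

lemma jointLaw_fst {C : Set (PastState b)} (hC : MeasurableSet C) :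
    jointLaw Q κ {y | y.1 ∈ C} = Q C := by
  have : (jointLaw Q κ).fst = Q := Measure.fst_compProd _ _
  conv_rhs => rw [← this, Measure.fst_apply hC]
  rfl

lemma lintegral_exitProb_le (hB : MeasurePreserving backMap (jointLaw Q κ) (jointLaw Q κ))
    (hb : 0 < b) {Z : Set (ℕ → LatticeSpace)} (hZ : MeasurableSet Z) {C : Set (PastState b)}
    (hC : MeasurableSet C) {r : ENNReal} (i : ℕ) (hr : ∀ u ∈ C, r ≤ exitProb κ Z i u) :
    r * jointLaw Q κ {y | backState^[i] y.1 ∈ C} ≤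
      jointLaw Q κ ({y | backState^[i] y.1 ∈ C} ∩ {y | latSeq y ∉ Z}) := by
  have hBi := hB.iterate i
  have e1 : {y : PastState b × (ℕ → Fin b) | backState^[i] y.1 ∈ C} =
      backMap^[i] ⁻¹' {y | y.1 ∈ C} := by
    ext y; simp [backMap_iterate_fst]
  have e2 : {y : PastState b × (ℕ → Fin b) | backState^[i] y.1 ∈ C} ∩ {y | latSeq y ∉ Z} =
      backMap^[i] ⁻¹' ({y | y.1 ∈ C} ∩ {y | dil b ^ i • latSeq y ∉ Z}) := by
    ext y; simp [backMap_iterate_fst, latSeq_backMap_iterate hb]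
  have hC' : MeasurableSet {y : PastState b × (ℕ → Fin b) | y.1 ∈ C} := measurable_fst hC
  have hD := hC'.inter (measurableSet_exit hZ i)
  rw [e2, e1, hBi.measure_preimage hD.nullMeasurableSet,
    hBi.measure_preimage hC'.nullMeasurableSet, jointLaw_fst hC, Measure.compProd_apply hD]
  calc r * Q C = ∫⁻ u, C.indicator (fun _ => r) u ∂Q := by rw [lintegral_indicator_const hC]
    _ ≤ _ := by
      refine lintegral_mono fun u => ?_
      by_cases hu : u ∈ C
      · rw [Set.indicator_of_mem hu]
        refine (hr u hu).trans (le_of_eq ?_)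
        rw [exitProb, Kernel.prodMkRight_apply]
        congr 1
        ext f
        simp [hu]
      · rw [Set.indicator_of_notMem hu]; exact zero_le

/-- A maximal inequality for the conditional exit probabilities. -/
lemma maximal_exitProb (hB : MeasurePreserving backMap (jointLaw Q κ) (jointLaw Q κ))
    (hb : 0 < b) {Z : Set (ℕ → LatticeSpace)} (hZ : MeasurableSet Z) (r : ENNReal) :
    r * jointLaw Q κ {y | ∃ i, r ≤ exitProb κ Z i (backState^[i] y.1)} ≤
      jointLaw Q κ {y | latSeq y ∉ Z} := by
  have hbs := measurable_backState (b := b)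
  set C : ℕ → ℕ → Set (PastState b) := fun N i => {u | r ≤ exitProb κ Z i u ∧
    ∀ j ∈ Finset.Ioc i N, exitProb κ Z j (backState^[j - i] u) < r} with hCdef
  have hC : ∀ N i, MeasurableSet (C N i) := by
    intro N i
    have : C N i = {u | r ≤ exitProb κ Z i u} ∩
        ⋂ j ∈ Finset.Ioc i N, {u : PastState b | exitProb κ Z j (backState^[j - i] u) < r} := by
      ext u
      simp [C]
    rw [this]
    refine (measurableSet_le measurable_const (measurable_exitProb hZ i)).inter ?_
    refine Finset.measurableSet_biInter (Finset.Ioc i N) fun j _ => measurableSet_lt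
      ((measurable_exitProb hZ j).comp (hbs.iterate _)) measurable_const
  set E : ℕ → ℕ → Set (PastState b × (ℕ → Fin b)) := fun N i => {y | backState^[i] y.1 ∈ C N i}
    with hEdef
  have hEm : ∀ N i, MeasurableSet (E N i) := fun N i => (hbs.iterate i).comp measurable_fst (hC N i)
  have hE : ∀ N i y, y ∈ E N i ↔ r ≤ exitProb κ Z i (backState^[i] y.1) ∧
      ∀ j ∈ Finset.Ioc i N, exitProb κ Z j (backState^[j] y.1) < r := by
    intro N i y
    refine and_congr Iff.rfl (forall₂_congr fun j hj => ?_)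
    have h1 := (Finset.mem_Ioc.1 hj).1
    rw [← Function.iterate_add_apply]
    have : j - i + i = j := by omega
    rw [this]
  have hbad : MeasurableSet {y : PastState b × (ℕ → Fin b) | latSeq y ∉ Z} :=
    (measurable_latSeq hZ).compl
  have hfin : ∀ N, r * jointLaw Q κ {y | ∃ i ≤ N, r ≤ exitProb κ Z i (backState^[i] y.1)} ≤
      jointLaw Q κ {y | latSeq y ∉ Z} := by
    intro N
    have hcov : {y : PastState b × (ℕ → Fin b) |
        ∃ i ≤ N, r ≤ exitProb κ Z i (backState^[i] y.1)} ⊆ ⋃ i ∈ Finset.range (N + 1), E N i := by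
      rintro y ⟨i, hi, hir⟩
      set S := (Finset.range (N + 1)).filter fun i => r ≤ exitProb κ Z i (backState^[i] y.1)
      have hS : S.Nonempty := ⟨i, Finset.mem_filter.2 ⟨Finset.mem_range.2 (by omega), hir⟩⟩
      have hmax := Finset.mem_filter.1 (S.max'_mem hS)
      refine Set.mem_iUnion₂.2 ⟨S.max' hS, hmax.1, (hE _ _ _).2 ⟨hmax.2, fun j hj => ?_⟩⟩
      by_contra hcon
      have hj' := Finset.mem_Ioc.1 hj
      have := S.le_max' j (Finset.mem_filter.2 ⟨Finset.mem_range.2 (by omega), not_lt.1 hcon⟩)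
      omega
    have hdisj : ((Finset.range (N + 1) : Finset ℕ) : Set ℕ).PairwiseDisjoint
        fun i => E N i ∩ {y | latSeq y ∉ Z} := by
      intro i hi j hj hij
      have hi' := Finset.mem_range.1 (Finset.mem_coe.1 hi)
      have hj' := Finset.mem_range.1 (Finset.mem_coe.1 hj)
      refine Set.disjoint_left.2 fun y hy hy' => ?_
      have h1 := (hE _ _ _).1 hy.1
      have h2 := (hE _ _ _).1 hy'.1
      rcases lt_or_gt_of_ne hij with h | h
      · exact absurd h2.1 (not_le.2 (h1.2 j (Finset.mem_Ioc.2 ⟨h, by omega⟩)))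
      · exact absurd h1.1 (not_le.2 (h2.2 i (Finset.mem_Ioc.2 ⟨h, by omega⟩)))
    calc _ ≤ r * ∑ i ∈ Finset.range (N + 1), jointLaw Q κ (E N i) := by
          gcongr; exact (measure_mono hcov).trans (measure_biUnion_finset_le _ _)
      _ = ∑ i ∈ Finset.range (N + 1), r * jointLaw Q κ (E N i) := Finset.mul_sum _ _ _
      _ ≤ ∑ i ∈ Finset.range (N + 1), jointLaw Q κ (E N i ∩ {y | latSeq y ∉ Z}) :=
          Finset.sum_le_sum fun i _ => lintegral_exitProb_le hB hb hZ (hC N i) i fun u hu => hu.1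
      _ = jointLaw Q κ (⋃ i ∈ Finset.range (N + 1), E N i ∩ {y | latSeq y ∉ Z}) :=
          (measure_biUnion_finset hdisj fun i _ => (hEm N i).inter hbad).symm
      _ ≤ _ := measure_mono (Set.iUnion₂_subset fun i _ => Set.inter_subset_right)
  have hU : {y : PastState b × (ℕ → Fin b) | ∃ i, r ≤ exitProb κ Z i (backState^[i] y.1)} =
      ⋃ N, {y | ∃ i ≤ N, r ≤ exitProb κ Z i (backState^[i] y.1)} := by
    ext y
    simp only [Set.mem_iUnion, Set.mem_ofPred_eq]
    exact ⟨fun ⟨i, hi⟩ => ⟨i, i, le_rfl, hi⟩, fun ⟨N, i, _, hi⟩ => ⟨i, hi⟩⟩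
  have hmono : Monotone fun N => {y : PastState b × (ℕ → Fin b) |
      ∃ i ≤ N, r ≤ exitProb κ Z i (backState^[i] y.1)} :=
    fun N N' h y ⟨i, hi, hy⟩ => ⟨i, hi.trans h, hy⟩
  rw [hU, Monotone.measure_iUnion hmono,
    ENNReal.mul_iSup]
  exact iSup_le hfin

end Resampling

section Resampling

open Topology LatticeSpace ProbabilityTheory

variable {b : ℕ}

lemma resampling_inequality (hb : 2 ≤ b) {Z : Set (ℕ → LatticeSpace)} {N : ℕ} {U : Set SLR} {θ ε : ℝ}
    (hθ : 0 < θ) (hθ1 : θ ≤ 1) (hε : ε ≤ 1 / 2)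
    (hU : ∀ a c : ℝ, |a - 1| < ε → |c| < ε → lowerMat a c ∈ U)
    (hZ : ∀ w ∈ Z, ∀ j, seqShift^[j] w ∈ Z → ∀ h ∈ U, ∀ τ ∈
      {τ : ℝ | θ ^ 2 / (11 * b ^ 2) / 2 ≤ |τ| ∧ |τ| ≤ 6},
        ∃ k < N, w (j + k) ≠ (h * unip τ) • w k)
    {m : Measure (ℕ → Fin b)} [IsProbabilityMeasure m] {w v : ℕ → LatticeSpace} {l i j : ℕ} {x₀ : ℝ}
    (hx₀ : x₀ ∈ Set.Icc (0 : ℝ) 1) (hv : (dil b ^ (2 * l + i))⁻¹ • w = unip x₀ • v)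
    (h1 : m {f | dil b ^ i • unip (Real.ofDigits f) • v ∉ Z} < 16⁻¹)
    (h2 : m {f | dil b ^ i • unip (Real.ofDigits f) • seqShift^[j] v ∉ Z} < 16⁻¹)
    (hm : ∀ x : ℝ, m {f | |Real.ofDigits f - x| ≤ θ} ≤ 8⁻¹) {g : SLR}
    (hg : ∀ k < N, w (j + k) = g • w k) (g01 : |g 0 1| ≤ 1) (g00 : |g 0 0 - 1| < ε / 2)
    (hA : (b : ℝ) ^ i * |g 1 1 - g 0 0| ≤ 1) (hC : (b : ℝ) ^ (2 * (i + l)) * |g 1 0| ≤ 1)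
    (hi : ((b : ℝ) ^ i)⁻¹ < ε / 2)
    (hmax : 1 / (b : ℝ) ^ 2 ≤ (b : ℝ) ^ i * |g 1 1 - g 0 0| ∨
      1 / (b : ℝ) ^ 2 ≤ (b : ℝ) ^ (2 * (i + l)) * |g 1 0|) : False := by
  have hb0 : (0 : ℝ) < b := by exact_mod_cast (by omega : 0 < b)
  have hb1 : (1 : ℝ) ≤ b := by exact_mod_cast (by omega : 1 ≤ b)
  set c := θ ^ 2 / (11 * (b : ℝ) ^ 2) with hc
  have hc0 : 0 < c := by positivity
  set b₀ := ((b : ℝ) ^ (2 * l))⁻¹ * g 0 1 with hb₀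
  set b₁ := (b : ℝ) ^ i * (g 1 1 - g 0 0) with hb₁
  set b₂ := -((b : ℝ) ^ (2 * (i + l)) * g 1 0) with hb₂
  have ab₁ : |b₁| = (b : ℝ) ^ i * |g 1 1 - g 0 0| := by
    rw [hb₁, abs_mul, abs_of_pos (by positivity)]
  have ab₂ : |b₂| = (b : ℝ) ^ (2 * (i + l)) * |g 1 0| := by
    rw [hb₂, abs_neg, abs_mul, abs_of_pos (by positivity)]
  have ab₀ : |b₀| ≤ 1 := by
    rw [hb₀, abs_mul, abs_of_pos (by positivity)]
    exact mul_le_one₀ (inv_le_one_of_one_le₀ (one_le_pow₀ hb1)) (abs_nonneg _) g01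
  have ht : ∀ f : ℕ → Fin b, |Real.ofDigits f - x₀| ≤ 1 := fun f => by
    rw [abs_le]
    constructor <;> linarith [hx₀.1, hx₀.2, Real.ofDigits_nonneg f, Real.ofDigits_le_one f]
  have hquad := measureReal_quadratic_le (m := m) (t := fun f => Real.ofDigits f - x₀)
    (b₀ := b₀) (b₁ := b₁) (b₂ := b₂) (c := c) hθ hθ1 ht (fun x => by
      refine ENNReal.toReal_le_of_le_ofReal (by norm_num) ?_
      have := hm (x₀ + x)
      simp only [← sub_sub] at this
      refine this.trans (le_of_eq ?_)
      rw [one_div, ENNReal.ofReal_inv_of_pos (by norm_num)]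
      norm_num) (by
      rw [ab₁, ab₂]
      have e : 11 * c = 1 / (b : ℝ) ^ 2 * θ ^ 2 := by rw [hc]; field_simp
      rw [e]
      exact hmax.imp (fun h => mul_le_mul_of_nonneg_right h (by positivity))
        (fun h => mul_le_mul_of_nonneg_right h (by positivity)))
  have hex : ∃ f : ℕ → Fin b, dil b ^ i • unip (Real.ofDigits f) • v ∈ Z ∧
      dil b ^ i • unip (Real.ofDigits f) • seqShift^[j] v ∈ Z ∧
      c ≤ |b₀ + b₁ * (Real.ofDigits f - x₀) + b₂ * (Real.ofDigits f - x₀) ^ 2| := by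
    by_contra! hcon
    have hcov : (Set.univ : Set (ℕ → Fin b)) ⊆
        ({f | dil b ^ i • unip (Real.ofDigits f) • v ∉ Z} ∪
        {f | dil b ^ i • unip (Real.ofDigits f) • seqShift^[j] v ∉ Z}) ∪
        {f | |b₀ + b₁ * (Real.ofDigits f - x₀) + b₂ * (Real.ofDigits f - x₀) ^ 2| < c} := by
      intro f _
      by_cases hf1 : dil b ^ i • unip (Real.ofDigits f) • v ∈ Z
      · by_cases hf2 : dil b ^ i • unip (Real.ofDigits f) • seqShift^[j] v ∈ Z
        · exact Or.inr (hcon f hf1 hf2)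
        · exact Or.inl (Or.inr hf2)
      · exact Or.inl (Or.inl hf1)
    have r : ∀ S : Set (ℕ → Fin b), m S < 16⁻¹ → m.real S ≤ 1 / 16 := fun S hS => by
      refine ENNReal.toReal_le_of_le_ofReal (by norm_num) (hS.le.trans (le_of_eq ?_))
      rw [one_div, ENNReal.ofReal_inv_of_pos (by norm_num)]
      norm_num
    have := (measureReal_mono (μ := m) hcov).trans ((measureReal_union_le _ _).trans
      (add_le_add_left (measureReal_union_le _ _) _))
    rw [probReal_univ] at this
    linarith [r _ h1, r _ h2]
  obtain ⟨f, hf1, hf2, hf3⟩ := hex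
  set t := Real.ofDigits f - x₀ with htdef
  have ht1 : |t| ≤ 1 := ht f
  set s := (b : ℝ) ^ i * t with hs
  set a := g 0 0 + s * ((b : ℝ) ^ (2 * l) * g 1 0) with hadef
  have hib : 0 < ((b : ℝ) ^ i)⁻¹ := by positivity
  have hcc : |(b : ℝ) ^ (2 * l) * g 1 0| ≤ ((b : ℝ) ^ i)⁻¹ * ((b : ℝ) ^ i)⁻¹ := by
    rw [abs_mul, abs_of_pos (by positivity), ← mul_inv, ← one_div, le_div_iff₀ (by positivity)]
    calc _ = (b : ℝ) ^ (2 * (i + l)) * |g 1 0| := by ring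
      _ ≤ 1 := hC
  have hsc : |s * ((b : ℝ) ^ (2 * l) * g 1 0)| ≤ ((b : ℝ) ^ i)⁻¹ := by
    calc |s * ((b : ℝ) ^ (2 * l) * g 1 0)| = (b : ℝ) ^ i * |t| * |(b : ℝ) ^ (2 * l) * g 1 0| := by
          rw [abs_mul, hs, abs_mul, abs_of_pos (show (0 : ℝ) < (b : ℝ) ^ i by positivity)]
      _ ≤ (b : ℝ) ^ i * 1 * (((b : ℝ) ^ i)⁻¹ * ((b : ℝ) ^ i)⁻¹) := by gcongr
      _ = _ := by field_simp
  have hi1 : ((b : ℝ) ^ i)⁻¹ ≤ 1 := inv_le_one_of_one_le₀ (one_le_pow₀ hb1)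
  have ha1 : |a - 1| < ε := by
    calc |a - 1| = |(g 0 0 - 1) + s * ((b : ℝ) ^ (2 * l) * g 1 0)| := by congr 1; rw [hadef]; ring
      _ ≤ _ := abs_add_le _ _
      _ < ε := by linarith
  have hc1 : |(b : ℝ) ^ (2 * l) * g 1 0| < ε := by
    have : ((b : ℝ) ^ i)⁻¹ * ((b : ℝ) ^ i)⁻¹ ≤ ((b : ℝ) ^ i)⁻¹ * 1 := by gcongr
    linarith
  have ha2 := abs_lt.1 ha1
  have ha0 : 1 / 2 < a := by linarith
  have ha3 : a < 3 / 2 := by linarith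
  set num := ((b : ℝ) ^ (2 * l))⁻¹ * g 0 1 + s * (g 1 1 - g 0 0) -
    s ^ 2 * ((b : ℝ) ^ (2 * l) * g 1 0) with hnum
  have hnum' : num = b₀ + b₁ * t + b₂ * t ^ 2 := by
    rw [hnum, hb₀, hb₁, hb₂, hs, mul_add 2 i l, pow_add, two_mul i, pow_add]; ring
  have hnum3 : |num| ≤ 3 := by
    rw [hnum']
    have q1 : |b₁ * t| ≤ 1 := by
      rw [abs_mul, ab₁]; exact mul_le_one₀ hA (abs_nonneg _) ht1
    have q2 : |b₂ * t ^ 2| ≤ 1 := by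
      rw [abs_mul, ab₂, abs_pow]
      exact mul_le_one₀ hC (by positivity) (pow_le_one₀ (abs_nonneg _) ht1)
    have := abs_add_le (b₀ + b₁ * t) (b₂ * t ^ 2)
    have := abs_add_le b₀ (b₁ * t)
    linarith
  have hmain := unip_mul_dil_mul (by omega : 0 < b) (2 * l) s g (by linarith : 0 < a)
  have hvw : v = (unip x₀)⁻¹ • (dil b ^ (2 * l + i))⁻¹ • w := by
    rw [hv, inv_smul_smul]
  have hX : dil b ^ i * (unip (Real.ofDigits f) * ((unip x₀)⁻¹ * (dil b ^ (2 * l + i))⁻¹)) =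
      unip s * (dil b ^ (2 * l))⁻¹ := by
    have hh := dil_zpow_mul_unip (by omega : 0 < b) i t
    rw [zpow_natCast, zpow_natCast] at hh
    have h3 : unip t = unip (Real.ofDigits f) * (unip x₀)⁻¹ := by
      rw [← unip_neg, ← unip_add, htdef, sub_eq_add_neg]
    rw [hs, ← mul_assoc (unip (Real.ofDigits f)), ← h3, ← mul_assoc, hh, add_comm, pow_add]
    group
  have hw' : dil b ^ i • unip (Real.ofDigits f) • v = (unip s * (dil b ^ (2 * l))⁻¹) • w := by
    rw [hvw, ← hX]; simp only [mul_smul]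
  rw [← seqShift_iterate_smul, ← seqShift_iterate_smul] at hf2
  rw [hw'] at hf1 hf2
  obtain ⟨k, hk, hne⟩ := hZ _ hf1 j hf2 _ (hU a _ ha1 hc1) (num / a) ⟨by
    rw [abs_div, abs_of_pos (by linarith : 0 < a), le_div_iff₀ (by linarith), hnum']
    nlinarith, by
    rw [abs_div, abs_of_pos (by linarith : 0 < a), div_le_iff₀ (by linarith)]
    linarith⟩
  apply hne
  rw [Pi.smul_apply, Pi.smul_apply, hg k hk, ← mul_smul, ← mul_smul, hmain]

end Resampling

section Resampling

open Topology LatticeSpace ProbabilityTheory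

variable {b : ℕ}

variable {Q : Measure (PastState b)} [IsProbabilityMeasure Q]
  {κ : Kernel (ℕ → Fin b) (ℕ → Fin b)} [IsMarkovKernel κ]

lemma exists_good_past (hna : ∀ᵐ u ∂Q, ∀ x : ℝ, κ u.1 {f | Real.ofDigits f = x} = 0) {η : ENNReal}
    (hη : 0 < η) :
    ∃ θ : ℝ, 0 < θ ∧ θ ≤ 1 ∧ ∃ G : Set (PastState b), MeasurableSet G ∧ Q Gᶜ ≤ η ∧
      ∀ u ∈ G, ∀ x : ℝ, κ u.1 {f | |Real.ofDigits f - x| ≤ θ} ≤ 8⁻¹ := by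
  set A : ℕ → ℤ → Set (ℕ → Fin b) := fun m k =>
    {f | Real.ofDigits f ∈ Set.Icc ((k - 1) * ((m : ℝ) + 1)⁻¹) ((k + 2) * ((m : ℝ) + 1)⁻¹)} with hA
  have hAm : ∀ m k, MeasurableSet (A m k) := fun m k => measurable_ofDigits measurableSet_Icc
  set G : ℕ → Set (PastState b) := fun m => ⋂ k, {u | κ u.1 (A m k) ≤ 8⁻¹} with hG
  have hGm : ∀ m, MeasurableSet (G m) := fun m => .iInter fun k => measurableSet_le
    ((Kernel.measurable_coe κ (hAm m k)).comp measurable_fst) measurable_const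
  set s : ℕ → Set (PastState b) := fun M => ⋂ m, ⋂ (_ : M ≤ m), G m with hs
  have hsm : ∀ M, MeasurableSet (s M) := fun M => .iInter fun m => .iInter fun _ => hGm m
  have hmono : Monotone s := fun M M' h u hu => by
    simp only [hs, Set.mem_iInter] at hu ⊢
    exact fun m hm => hu m (h.trans hm)
  have hae : ∀ᵐ u ∂Q, u ∈ ⋃ M, s M := by
    filter_upwards [hna] with u hu
    have hm : IsFiniteMeasure ((κ u.1).map Real.ofDigits) := inferInstance
    obtain ⟨δ, hδ, h⟩ := exists_uniform_ball_le (m := (κ u.1).map Real.ofDigits) (ε := 8⁻¹) (by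
        rw [Measure.map_apply measurable_ofDigits measurableSet_Icc.compl]
        have : (Real.ofDigits : (ℕ → Fin b) → ℝ) ⁻¹' (Set.Icc 0 1)ᶜ = ∅ := by
          ext f
          simp [Real.ofDigits_nonneg, Real.ofDigits_le_one]
        rw [this, measure_empty]) (fun x => by
        rw [Measure.map_apply measurable_ofDigits (measurableSet_singleton x)]
        exact hu x) (by simp)
    obtain ⟨M, hM⟩ := exists_nat_gt (2 / δ)
    refine Set.mem_iUnion.2 ⟨M, ?_⟩
    simp only [hs, hG, Set.mem_iInter, Set.mem_ofPred_eq]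
    intro m hm k
    have hpos : (0 : ℝ) < (m : ℝ) + 1 := by positivity
    have hθ : 2 * ((m : ℝ) + 1)⁻¹ < δ := by
      rw [← div_eq_mul_inv, div_lt_iff₀ hpos]
      rw [div_lt_iff₀ hδ] at hM
      have : (M : ℝ) ≤ m := by exact_mod_cast hm
      nlinarith
    refine le_trans ?_ (h ((k + 1 / 2) * ((m : ℝ) + 1)⁻¹))
    rw [Measure.map_apply measurable_ofDigits Metric.isOpen_ball.measurableSet]
    refine measure_mono fun f hf => ?_
    rw [Set.mem_preimage, Metric.mem_ball, Real.dist_eq, abs_lt]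
    have h0 : 0 < ((m : ℝ) + 1)⁻¹ := by positivity
    constructor <;> nlinarith [hf.1, hf.2]
  have hlim := tendsto_measure_iInter_atTop (μ := Q) (s := fun M => (s M)ᶜ)
    (fun M => (hsm M).compl.nullMeasurableSet)
    (fun M M' h => Set.compl_subset_compl.2 (hmono h)) ⟨0, measure_ne_top _ _⟩
  rw [← Set.compl_iUnion] at hlim
  have h0 : Q (⋃ M, s M)ᶜ = 0 := hae
  rw [h0] at hlim
  obtain ⟨M, hM⟩ := (hlim.eventually (gt_mem_nhds hη)).exists
  have hpos : (0 : ℝ) < (M : ℝ) + 1 := by positivity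
  refine ⟨((M : ℝ) + 1)⁻¹, by positivity, inv_le_one_of_one_le₀ (by linarith [Nat.cast_nonneg (α := ℝ) M]),
    s M, hsm M, hM.le, fun u hu x => ?_⟩
  simp only [hs, hG, Set.mem_iInter, Set.mem_ofPred_eq] at hu
  refine le_trans (measure_mono fun f hf => ?_) (hu M le_rfl ⌊x * (M + 1)⌋)
  have h1 := Int.floor_le (x * (M + 1))
  have h2 := Int.lt_floor_add_one (x * (M + 1))
  rw [Set.mem_ofPred_eq, abs_le] at hf
  have h3 : x = x * (M + 1) * ((M : ℝ) + 1)⁻¹ := by field_simp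
  have h0 : 0 < ((M : ℝ) + 1)⁻¹ := by positivity
  have h4 := mul_le_mul_of_nonneg_right h1 h0.le
  have h5 := mul_lt_mul_of_pos_right h2 h0
  rw [← h3] at h4 h5
  constructor <;> nlinarith [hf.1, hf.2]

lemma card_le_of_notMem_frequentSet {α : Type*} {T : α → α} {S : Set α} {y : α}
    (hy : y ∉ frequentSet T S (1 / 10)) (p : ℕ → Prop) [DecidablePred p] (hp : ∀ i, p i ↔ T^[i] y ∈ S)
    (k : ℕ) : 10 * (Finset.card {i ∈ Finset.range k | p i}) ≤ k := by
  classical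
  have h1 : birkhoffSum T (S.indicator 1) k y ≤ 1 / 10 * (k : ℝ) := by
    by_contra h
    exact hy ⟨k, not_le.1 h⟩
  have h2 : birkhoffSum T (S.indicator (1 : α → ℝ)) k y =
      (Finset.card {i ∈ Finset.range k | p i} : ℝ) := by
    rw [birkhoffSum, Finset.card_filter, Nat.cast_sum]
    refine Finset.sum_congr rfl fun i _ => ?_
    by_cases h : T^[i] y ∈ S
    · simp [h, (hp i).2 h]
    · have : ¬ p i := fun h' => h ((hp i).1 h')
      simp [h, this]
  rw [h2] at h1
  have : (10 * (Finset.card {i ∈ Finset.range k | p i}) : ℝ) ≤ k := by linarith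
  exact_mod_cast this

lemma map_latSeq_leftShift (hF : MeasurePreserving leftShift (jointLaw Q κ) (jointLaw Q κ)) :
    MeasurePreserving seqShift ((jointLaw Q κ).map latSeq) ((jointLaw Q κ).map latSeq) := by
  refine ⟨measurable_seqShift, ?_⟩
  conv_rhs => rw [← hF.map_eq]
  rw [Measure.map_map measurable_seqShift measurable_latSeq,
    Measure.map_map measurable_latSeq measurable_leftShift]
  rfl

lemma map_latSeq_backMap (hb : 0 < b)
    (hB : MeasurePreserving backMap (jointLaw Q κ) (jointLaw Q κ)) :
    MeasurePreserving (fun w : ℕ → LatticeSpace => dil b • w)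
      ((jointLaw Q κ).map latSeq) ((jointLaw Q κ).map latSeq) := by
  refine ⟨measurable_smul_seq _, ?_⟩
  conv_lhs => rw [← hB.map_eq]
  rw [Measure.map_map measurable_latSeq measurable_backMap,
    Measure.map_map (measurable_smul_seq _) (measurable_latSeq.comp measurable_backMap)]
  congr 1
  funext y
  simp [latSeq_backMap hb]

lemma eventually_entries {ε r s : ℝ} (hε : 0 < ε) :
    ∀ᶠ g : SLR in 𝓝 1, |g 0 1| ≤ 1 ∧ |g 0 0 - 1| < ε ∧ r * |g 1 1 - g 0 0| ≤ 1 ∧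
      s * |g 1 0| ≤ 1 := by
  have hc : ∀ i j, Continuous fun g : SLR => g i j := fun i j => continuous_entry i j
  have h1 : ∀ᶠ g : SLR in 𝓝 1, |g 0 1| < 1 :=
    ((hc 0 1).abs.tendsto 1).eventually (gt_mem_nhds (by simp))
  have h2 : ∀ᶠ g : SLR in 𝓝 1, |g 0 0 - 1| < ε :=
    (((hc 0 0).sub continuous_const).abs.tendsto 1).eventually (gt_mem_nhds (by simpa))
  have h3 : ∀ᶠ g : SLR in 𝓝 1, r * |g 1 1 - g 0 0| < 1 :=
    ((((hc 1 1).sub (hc 0 0)).abs.const_mul r).tendsto 1).eventually (gt_mem_nhds (by simp))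
  have h4 : ∀ᶠ g : SLR in 𝓝 1, s * |g 1 0| < 1 :=
    (((hc 1 0).abs.const_mul s).tendsto 1).eventually (gt_mem_nhds (by simp))
  filter_upwards [h1, h2, h3, h4] with g h1 h2 h3 h4
  exact ⟨h1.le, h2, h3.le, h4.le⟩

/-- No invariant joint law with nonatomic conditional measures exists. -/
theorem resampling_contradiction (hb : 2 ≤ b)
    (hB : MeasurePreserving backMap (jointLaw Q κ) (jointLaw Q κ))
    (hF : MeasurePreserving leftShift (jointLaw Q κ) (jointLaw Q κ))
    (hna : ∀ᵐ u ∂Q, ∀ x : ℝ, κ u.1 {f | Real.ofDigits f = x} = 0)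
    (hrel : ∀ᵐ u ∂Q, ∀ i k, heckeRel b k (u.2 i) (u.2 (i + k)))
    (ht : ∀ η : ℝ, 0 < η → ∃ δ > 0, (jointLaw Q κ).real {y | latSeq y 0 ∉ forwardThick b δ} ≤ η) :
    False := by
  classical
  have hb0 : 0 < b := by omega
  have hbR : (1 : ℝ) < b := by exact_mod_cast (by omega : 1 < b)
  set P := jointLaw Q κ with hP
  set ρ := P.map latSeq with hρ
  have hρprob : IsProbabilityMeasure ρ := Measure.isProbabilityMeasure_map measurable_latSeq.aemeasurable
  have hFρ := map_latSeq_leftShift hF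
  have hAρ := map_latSeq_backMap hb0 hB
  rw [← hP, ← hρ] at hFρ hAρ
  have htρ : ∀ η : ℝ, 0 < η → ∃ δ > 0, ρ.real {w | w 0 ∉ forwardThick b δ} ≤ η := by
    intro η hη
    obtain ⟨δ, hδ, h⟩ := ht η hη
    refine ⟨δ, hδ, le_trans (le_of_eq ?_) h⟩
    have hm : MeasurableSet {w : ℕ → LatticeSpace | w 0 ∉ forwardThick b δ} :=
      (((measurable_pi_apply 0 : Measurable fun w : ℕ → LatticeSpace => w 0))
        (isClosed_forwardThick b δ).measurableSet).compl
    rw [hρ, measureReal_def, Measure.map_apply measurable_latSeq hm]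
    rfl
  obtain ⟨θ, hθ, hθ1, G, hGm, hG, hGθ⟩ := exists_good_past (κ := κ) hna (η := 100⁻¹) (by simp)
  set c := θ ^ 2 / (11 * (b : ℝ) ^ 2) / 2 with hc
  have hc0 : 0 < c := by positivity
  have hK : IsCompact {τ : ℝ | c ≤ |τ| ∧ |τ| ≤ 6} := by
    refine (isCompact_Icc (a := (-6 : ℝ)) (b := 6)).of_isClosed_subset
      ((isClosed_le continuous_const continuous_abs).inter
        (isClosed_le continuous_abs continuous_const)) fun τ hτ => abs_le.1 hτ.2
  obtain ⟨Z, hZm, hZ, N, U, hU, hdisp⟩ := exists_no_displacement hb hFρ hAρ htρ hK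
    (by simp [hc0]) (η := 1 / 1600) (by norm_num)
  obtain ⟨ε, hε, hε2, hεU⟩ := exists_lowerMat_mem hU
  obtain ⟨M, hM⟩ := exists_pow_lt_of_lt_one (half_pos hε) (inv_lt_one_of_one_lt₀ hbR)
  set M' := 2 * M + 1 with hM_eq
  -- the good set of exit probabilities
  set D : Set (PastState b × (ℕ → Fin b)) :=
    {y | ∃ i, 16⁻¹ ≤ exitProb κ Z i (backState^[i] y.1)} with hD
  have hDm : MeasurableSet D := by
    have : D = ⋃ i, {y | 16⁻¹ ≤ exitProb κ Z i (backState^[i] y.1)} := by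
      ext; simp [hD]
    rw [this]
    exact .iUnion fun i => measurableSet_le measurable_const ((measurable_exitProb hZm i).comp
      ((measurable_backState.iterate i).comp measurable_fst))
  have hDle : P.real D ≤ 1 / 100 := by
    have h1 := ENNReal.toReal_mono (measure_ne_top _ _) (maximal_exitProb hB hb0 hZm 16⁻¹)
    rw [ENNReal.toReal_mul, ENNReal.toReal_inv] at h1
    have h2 : (P {y | latSeq y ∉ Z}).toReal = ρ.real Zᶜ := by
      rw [hρ, measureReal_def, Measure.map_apply measurable_latSeq hZm.compl]
      rfl
    rw [← hP, h2] at h1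
    have h3 : (ENNReal.toReal 16)⁻¹ * P.real D ≤ ρ.real Zᶜ := h1
    norm_num at h3
    linarith
  set E : Set (PastState b × (ℕ → Fin b)) := {y | y.1 ∉ G} with hE
  have hEm : MeasurableSet E := (measurable_fst hGm).compl
  have hEle : P.real E ≤ 1 / 100 := by
    have h1 : P E = Q Gᶜ := jointLaw_fst hGm.compl
    rw [measureReal_def, h1]
    refine ENNReal.toReal_le_of_le_ofReal (by norm_num) (hG.trans (le_of_eq ?_))
    rw [one_div, ENNReal.ofReal_inv_of_pos (by norm_num)]
    norm_num
  have hfD := measureReal_frequentSet_le hB hDm (1 / 10)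
  have hfE := measureReal_frequentSet_le hB hEm (1 / 10)
  set Y := (frequentSet backMap D (1 / 10) ∪ frequentSet backMap E (1 / 10))ᶜ with hY
  have hYm : MeasurableSet Y := ((measurableSet_frequentSet measurable_backMap hDm _).union
    (measurableSet_frequentSet measurable_backMap hEm _)).compl
  have hYpos : P Y ≠ 0 := by
    intro h0
    have h1 : P.real (frequentSet backMap D (1 / 10) ∪ frequentSet backMap E (1 / 10)) = 1 := by
      rw [measureReal_def, (prob_compl_eq_zero_iff hYm.of_compl).1 h0]
      rfl
    have h2 := measureReal_union_le (μ := P) (frequentSet backMap D (1 / 10))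
      (frequentSet backMap E (1 / 10))
    linarith
  have hrelP : ∀ᵐ y ∂P, ∀ i k, heckeRel b k (latSeq y i) (latSeq y (i + k)) := by
    have h1 : ∀ᵐ u ∂P.fst, ∀ i k, heckeRel b k (u.2 i) (u.2 (i + k)) := by
      rw [hP, Measure.fst_compProd]
      exact hrel
    have h2 := ae_of_ae_map measurable_fst.aemeasurable h1
    filter_upwards [h2] with y hy i k
    exact (hy i k).smul _
  have hhor : ∀ᵐ y ∂P, latSeq y 0 ∉ horizontalLattices :=
    ae_of_ae_map measurable_latSeq.aemeasurable (ae_notMem_horizontalLattices hb hAρ htρ)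
  have hrec := ae_recurrence hF measurable_latSeq hYm
  obtain ⟨y, hyY, hyrel, hyhor, hyrec⟩ : ∃ y, y ∈ Y ∧
      (∀ i k, heckeRel b k (latSeq y i) (latSeq y (i + k))) ∧
      latSeq y 0 ∉ horizontalLattices ∧ (y ∈ Y → ∀ V ∈ 𝓝 (latSeq y), ∃ j, 0 < j ∧
        leftShift^[j] y ∈ Y ∧ latSeq (leftShift^[j] y) ∈ V) := by
    have h1 : ∃ᵐ y ∂P, y ∈ Y := frequently_ae_mem_iff.2 hYpos
    exact (h1.and_eventually (hrelP.and (hhor.and hrec))).exists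
  set w := latSeq y with hw
  have hV := eventually_entries (ε := ε / 2) (r := (b : ℝ) ^ M') (s := (b : ℝ) ^ (2 * M'))
    (half_pos hε)
  obtain ⟨j, hj, hjY, hjV⟩ := hyrec hyY _ (exists_displacement_of_heckeRel hb0 w (N + 1) hV)
  rw [latSeq_leftShift_iterate, ← hw] at hjV
  obtain ⟨g, ⟨g01, g00, gA, gC⟩, hg⟩ := hjV (fun k => by
    rw [seqShift_iterate, seqShift_iterate]; exact hyrel (j + 0) k)
  simp only [seqShift_iterate] at hg
  have hAC : |g 1 1 - g 0 0| ≠ 0 ∨ |g 1 0| ≠ 0 := by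
    by_contra! hcon
    obtain ⟨h1, h2⟩ := hcon
    rw [abs_eq_zero, sub_eq_zero] at h1
    rw [abs_eq_zero] at h2
    have hdet := det_eq g
    rw [h1, h2, mul_zero, sub_zero] at hdet
    rw [abs_lt] at g00
    have h3 : g 0 0 = 1 := by nlinarith
    have h4 : g = unip (g 0 1) := by
      apply SLR_ext <;> simp [h1, h2, h3]
    have h5 := hyrel 0 j
    have h6 := hg 0 (by omega)
    rw [add_zero] at h6
    rw [zero_add, h6, h4] at h5
    exact hyhor (mem_horizontalLattices_of_heckeRel hb hj h5)
  obtain ⟨I, i, hMI, hI, hmono⟩ := exists_scales hb (abs_nonneg _) (abs_nonneg _) hAC gA gC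
  have hfreq : ∀ y' ∈ Y, (∀ k : ℕ, 10 * (Finset.card {p ∈ Finset.range k |
      p ∈ {p | backMap^[p] y' ∈ D}}) ≤ k) ∧ ∀ k : ℕ, 10 * (Finset.card {p ∈ Finset.range k |
      p ∈ {p | backMap^[p] y' ∈ E}}) ≤ k := fun y' hy' =>
    ⟨card_le_of_notMem_frequentSet (fun h => hy' (Or.inl h)) _ fun i => Iff.rfl,
      card_le_of_notMem_frequentSet (fun h => hy' (Or.inr h)) _ fun i => Iff.rfl⟩
  obtain ⟨l, hl, hl1, hl2, hl3⟩ := exists_good_scale (I := I) (q := fun l => 2 * l + i l)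
    (fun l hl => (hI l hl).2.1) hmono (hfreq _ hyY).1 (hfreq _ hjY).1 (hfreq _ hyY).2
  obtain ⟨hi1, hi2, hiA, hiC, himax⟩ := hI l hl
  simp only [Set.mem_ofPred_eq, hD, hE, not_not, not_exists, not_le, backMap_iterate_fst,
    ← Function.iterate_add_apply] at hl1 hl2 hl3
  have e1 : i l + 2 * l = 2 * l + i l := add_comm _ _
  have h1 := hl1 (i l)
  have h2 := hl2 (i l)
  rw [e1] at h1 h2
  rw [leftShift_iterate] at h2
  have e2 := backState_iterate (2 * l + i l) j y.1
  simp only at h2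
  rw [e2] at h2
  set u := backState^[2 * l + i l] y.1 with hu
  have hMi : M ≤ i l := by omega
  refine resampling_inequality hb hθ hθ1 hε2 hεU hdisp (m := κ u.1) (w := w) (v := u.2) (l := l)
    (i := i l) (j := j) (x₀ := Real.ofDigits (backMap^[2 * l + i l] y).2)
    ⟨Real.ofDigits_nonneg _, Real.ofDigits_le_one _⟩ ?_ h1 h2 (hGθ u hl3)
    (fun k hk => hg k (by omega)) g01 g00 hiA hiC ?_ himax
  · rw [hw, ← latSeq_backMap_iterate hb0, latSeq, backMap_iterate_fst]
  · rw [← inv_pow]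
    exact (pow_le_pow_of_le_one (by positivity) (inv_lt_one_of_one_lt₀ hbR).le hMi).trans_lt hM

end Resampling

section Cesaro

open Topology BoundedContinuousFunction

variable {Ω : Type*} [TopologicalSpace Ω] [MeasurableSpace Ω] [BorelSpace Ω] [T2Space Ω]
  [HasOuterApproxClosed Ω]

/-- Cesàro averages of a sequence of measures. -/
noncomputable def cesaroMeasure (P : ℕ → Measure Ω) (N : ℕ) : Measure Ω :=
  ((N : ENNReal) + 1)⁻¹ • ∑ L ∈ Finset.range (N + 1), P L

lemma le_cesaroMeasure {P : ℕ → Measure Ω} {C : Set Ω} {r : ENNReal} (h : ∀ L, r ≤ P L C) (N : ℕ) :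
    r ≤ cesaroMeasure P N C := by
  rw [cesaroMeasure, Measure.smul_apply, Measure.finsetSum_apply, smul_eq_mul]
  have h1 : ((N : ENNReal) + 1) * r ≤ ∑ L ∈ Finset.range (N + 1), P L C := by
    have := Finset.card_nsmul_le_sum (Finset.range (N + 1)) (fun L => P L C) r fun L _ => h L
    simpa using this
  calc r = ((N : ENNReal) + 1)⁻¹ * (((N : ENNReal) + 1) * r) := by
        rw [← mul_assoc, ENNReal.inv_mul_cancel (by simp) (by simp), one_mul]
    _ ≤ _ := by gcongr

lemma cesaroMeasure_le {P : ℕ → Measure Ω} {C : Set Ω} {r : ENNReal} (h : ∀ L, P L C ≤ r) (N : ℕ) :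
    cesaroMeasure P N C ≤ r := by
  rw [cesaroMeasure, Measure.smul_apply, Measure.finsetSum_apply, smul_eq_mul]
  have h1 : ∑ L ∈ Finset.range (N + 1), P L C ≤ ((N : ENNReal) + 1) * r := by
    have := Finset.sum_le_card_nsmul (Finset.range (N + 1)) (fun L => P L C) r fun L _ => h L
    simpa using this
  calc _ ≤ ((N : ENNReal) + 1)⁻¹ * (((N : ENNReal) + 1) * r) := by gcongr
    _ = r := by
        rw [← mul_assoc, ENNReal.inv_mul_cancel (by simp) (by simp), one_mul]

instance (P : ℕ → Measure Ω) [∀ L, IsProbabilityMeasure (P L)] (N : ℕ) :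
    IsProbabilityMeasure (cesaroMeasure P N) :=
  ⟨le_antisymm (cesaroMeasure_le (fun _ => measure_univ.le) N)
    (le_cesaroMeasure (fun _ => measure_univ.ge) N)⟩

lemma integral_cesaroMeasure (P : ℕ → Measure Ω) [∀ L, IsProbabilityMeasure (P L)] (N : ℕ)
    (f : Ω →ᵇ ℝ) : ∫ x, f x ∂(cesaroMeasure P N) =
      ((N : ℝ) + 1)⁻¹ * ∑ L ∈ Finset.range (N + 1), ∫ x, f x ∂(P L) := by
  rw [cesaroMeasure, integral_smul_measure, integral_finsetSum_measure fun L _ => f.integrable _]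
  rw [ENNReal.toReal_inv, ENNReal.toReal_add (by simp) (by simp)]
  simp

/-- A weak limit of the Cesàro averages of a tight sequence of probability measures. -/
theorem exists_cesaro_limit (P : ℕ → Measure Ω) [∀ L, IsProbabilityMeasure (P L)]
    (ht : ∀ ε : ENNReal, 0 < ε → ∃ K, IsCompact K ∧ ∀ L, P L Kᶜ ≤ ε) :
    ∃ (ρ : Measure Ω) (l : Filter ℕ), IsProbabilityMeasure ρ ∧ l.NeBot ∧ l ≤ atTop ∧
      (∀ f : Ω →ᵇ ℝ, Tendsto (fun N : ℕ => ((N : ℝ) + 1)⁻¹ *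
        ∑ L ∈ Finset.range (N + 1), ∫ x, f x ∂(P L)) l (𝓝 (∫ x, f x ∂ρ))) ∧
      ∀ C, IsClosed C → ∀ r : ENNReal, (∀ L, r ≤ P L C) → r ≤ ρ C := by
  set A : ℕ → ProbabilityMeasure Ω := fun N => ⟨cesaroMeasure P N, inferInstance⟩ with hA
  have htight : IsTightMeasureSet {((μ : ProbabilityMeasure Ω) : Measure Ω) | μ ∈ Set.range A} := by
    rw [isTightMeasureSet_iff_exists_isCompact_measure_compl_le]
    intro ε hε
    obtain ⟨K, hK, h⟩ := ht ε hε
    refine ⟨K, hK, ?_⟩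
    rintro _ ⟨_, ⟨N, rfl⟩, rfl⟩
    exact cesaroMeasure_le h N
  have hcomp := isCompact_closure_of_isTightMeasureSet htight
  obtain ⟨ρ, -, hR⟩ := hcomp.ultrafilter_le_nhds' ((hyperfilter ℕ).map A) (by
    rw [Ultrafilter.mem_map]
    exact Filter.mem_of_superset univ_mem fun N _ => subset_closure ⟨N, rfl⟩)
  have hR' : Tendsto A (hyperfilter ℕ) (𝓝 ρ) := hR
  refine ⟨ρ, hyperfilter ℕ, inferInstance, inferInstance, Nat.hyperfilter_le_atTop, fun f => ?_,
    fun C hC r hr => ?_⟩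
  · have := (ProbabilityMeasure.tendsto_iff_forall_integral_tendsto.1 hR') f
    simpa only [hA, ProbabilityMeasure.coe_mk, integral_cesaroMeasure] using this
  · refine le_trans ?_ (ProbabilityMeasure.limsup_measure_closed_le_of_tendsto hR' hC)
    refine le_limsup_of_frequently_le' ?_
    exact (Eventually.of_forall fun N => le_cesaroMeasure hr N).frequently

lemma tendsto_cesaro_sub {a a' : ℕ → ℝ} {c : ℝ} (ha : ∀ L, |a L| ≤ c)
    (h : (∀ L, a' L = a (L + 1)) ∨ ∀ L, a' (L + 1) = a L) (ha' : ∀ L, |a' L| ≤ c) :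
    Tendsto (fun N : ℕ => ((N : ℝ) + 1)⁻¹ * ∑ L ∈ Finset.range (N + 1), a L -
      ((N : ℝ) + 1)⁻¹ * ∑ L ∈ Finset.range (N + 1), a' L) atTop (𝓝 0) := by
  have hlim : Tendsto (fun N : ℕ => 2 * c * (1 / ((N : ℝ) + 1))) atTop (𝓝 0) := by
    simpa using (tendsto_one_div_add_atTop_nhds_zero_nat (𝕜 := ℝ)).const_mul (2 * c)
  refine squeeze_zero_norm (fun N => ?_) hlim
  have hpos : (0 : ℝ) < N + 1 := by positivity
  have key : |∑ L ∈ Finset.range (N + 1), a L - ∑ L ∈ Finset.range (N + 1), a' L| ≤ 2 * c := by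
    rcases h with h | h
    · have e : ∑ L ∈ Finset.range (N + 1), a' L = ∑ L ∈ Finset.range (N + 1), a (L + 1) :=
        Finset.sum_congr rfl fun L _ => h L
      have e2 := Finset.sum_range_sub a (N + 1)
      rw [Finset.sum_sub_distrib] at e2
      rw [e]
      have : |a 0 - a (N + 1)| ≤ 2 * c := by
        refine (abs_sub _ _).trans ?_
        linarith [ha 0, ha (N + 1)]
      convert this using 2
      linarith
    · rw [Finset.sum_range_succ a, Finset.sum_range_succ' a']
      have e : ∑ L ∈ Finset.range N, a' (L + 1) = ∑ L ∈ Finset.range N, a L :=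
        Finset.sum_congr rfl fun L _ => h L
      rw [e]
      have : |a N - a' 0| ≤ 2 * c := by
        refine (abs_sub _ _).trans ?_
        linarith [ha N, ha' 0]
      convert this using 2
      ring
  rw [← mul_sub, Real.norm_eq_abs, abs_mul, abs_of_pos (inv_pos.2 hpos), mul_comm, one_div]
  gcongr

lemma map_eq_of_cesaro_limit {P : ℕ → Measure Ω} [∀ L, IsProbabilityMeasure (P L)] {ρ : Measure Ω}
    [IsProbabilityMeasure ρ] {l : Filter ℕ} [l.NeBot] (hl : l ≤ atTop)
    (hR : ∀ f : Ω →ᵇ ℝ, Tendsto (fun N : ℕ => ((N : ℝ) + 1)⁻¹ *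
        ∑ L ∈ Finset.range (N + 1), ∫ x, f x ∂(P L)) l (𝓝 (∫ x, f x ∂ρ)))
    {T : Ω → Ω} (hT : Continuous T)
    (h : (∀ L, (P L).map T = P (L + 1)) ∨ ∀ L, (P (L + 1)).map T = P L) : ρ.map T = ρ := by
  have : IsProbabilityMeasure (ρ.map T) := Measure.isProbabilityMeasure_map hT.aemeasurable
  refine ext_of_forall_integral_eq_of_IsFiniteMeasure fun f => ?_
  rw [integral_map hT.aemeasurable f.continuous.aestronglyMeasurable]
  set f' : Ω →ᵇ ℝ := f.compContinuous ⟨T, hT⟩ with hf'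
  have h1 := hR f
  have h2 := hR f'
  have hb : ∀ (μ : Measure Ω) [IsProbabilityMeasure μ] (F : Ω →ᵇ ℝ), |∫ x, F x ∂μ| ≤ ‖F‖ := by
    intro μ _ F
    exact F.norm_integral_le_norm μ
  have hi : ∀ L, ∫ x, f' x ∂(P L) = ∫ x, f x ∂((P L).map T) := fun L => by
    rw [integral_map hT.aemeasurable f.continuous.aestronglyMeasurable]; rfl
  have h3 := tendsto_cesaro_sub (a := fun L => ∫ x, f x ∂(P L)) (a' := fun L => ∫ x, f' x ∂(P L))
    (c := max ‖f‖ ‖f'‖) (fun L => (hb _ _).trans (le_max_left _ _))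
    (h.imp (fun h L => by simp only [hi, h]) (fun h L => by simp only [hi, h]))
    (fun L => (hb _ _).trans (le_max_right _ _))
  have h4 := tendsto_nhds_unique (h1.sub h2) (h3.mono_left hl)
  have : ∫ x, f (T x) ∂ρ = ∫ x, f' x ∂ρ := rfl
  rw [this]
  linarith

end Cesaro

section NaturalExtension

open Topology BoundedContinuousFunction ProbabilityTheory

variable {b : ℕ}

/-- Move the first future digit to the past. -/
def fwdShift (p : (ℕ → Fin b) × (ℕ → Fin b)) : (ℕ → Fin b) × (ℕ → Fin b) :=
  (seqCons (p.2 0) p.1, seqTail p.2)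

lemma continuous_seqCons {α : Type*} [TopologicalSpace α] :
    Continuous fun p : α × (ℕ → α) => seqCons p.1 p.2 := by
  refine continuous_pi fun k => ?_
  cases k with
  | zero => exact continuous_fst
  | succ k => exact (continuous_apply k).comp continuous_snd

lemma continuous_seqTail {α : Type*} [TopologicalSpace α] :
    Continuous (seqTail : (ℕ → α) → ℕ → α) :=
  continuous_pi fun k => continuous_apply (k + 1)

lemma continuous_fwdShift : Continuous (fwdShift : (ℕ → Fin b) × (ℕ → Fin b) → _) :=
  (continuous_seqCons.comp (((continuous_apply 0).comp continuous_snd).prodMk continuous_fst)).prodMk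
    (continuous_seqTail.comp continuous_snd)

lemma measurable_fwdShift : Measurable (fwdShift : (ℕ → Fin b) × (ℕ → Fin b) → _) :=
  (measurable_seqCons.comp (((measurable_pi_apply 0).comp measurable_snd).prodMk measurable_fst)).prodMk
    (measurable_seqTail.comp measurable_snd)

lemma fwdShift_iterate_snd (L : ℕ) (p : (ℕ → Fin b) × (ℕ → Fin b)) :
    (fwdShift^[L] p).2 = seqTail^[L] p.2 := by
  induction L with
  | zero => rfl
  | succ L ih => rw [Function.iterate_succ_apply', Function.iterate_succ_apply', ← ih]; rfl

lemma seqTail_iterate {α : Type*} (L : ℕ) (f : ℕ → α) (k : ℕ) : seqTail^[L] f k = f (L + k) := by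
  induction L generalizing k with
  | zero => simp
  | succ L ih => rw [Function.iterate_succ_apply', seqTail, ih]; congr 1; omega

lemma fwdShift_iterate_fst (L : ℕ) (p : (ℕ → Fin b) × (ℕ → Fin b)) {k : ℕ} (hk : k < L) :
    (fwdShift^[L] p).1 k = p.2 (L - 1 - k) := by
  induction L generalizing k with
  | zero => omega
  | succ L ih =>
    rw [Function.iterate_succ_apply']
    cases k with
    | zero =>
      change (fwdShift^[L] p).2 0 = _
      rw [fwdShift_iterate_snd, seqTail_iterate]
      congr 1
    | succ k =>
      change (fwdShift^[L] p).1 k = _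
      have e : L - 1 - k = L + 1 - 1 - (k + 1) := by omega
      rw [ih (by omega), e]

/-- Existence of the natural extension of an invariant measure of the one-sided shift. -/
theorem exists_natural_extension {m₀ : Measure (ℕ → Fin b)} [IsProbabilityMeasure m₀]
    (hm₀ : MeasurePreserving seqTail m₀ m₀) :
    ∃ ν : Measure ((ℕ → Fin b) × (ℕ → Fin b)), IsProbabilityMeasure ν ∧
      MeasurePreserving fwdShift ν ν ∧ ν.map Prod.snd = m₀ := by
  obtain ⟨z⟩ : Nonempty (ℕ → Fin b) := nonempty_of_isProbabilityMeasure m₀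
  have hmeas : ∀ L, Measurable fun f : ℕ → Fin b => fwdShift^[L] (z, f) := fun L =>
    (measurable_fwdShift.iterate L).comp measurable_prodMk_left
  set P : ℕ → Measure ((ℕ → Fin b) × (ℕ → Fin b)) := fun L =>
    m₀.map fun f => fwdShift^[L] (z, f) with hP
  have hprob : ∀ L, IsProbabilityMeasure (P L) := fun L =>
    Measure.isProbabilityMeasure_map (hmeas L).aemeasurable
  obtain ⟨ν, l, hν, hl0, hl, hlim, -⟩ := exists_cesaro_limit P fun ε _ =>
    ⟨Set.univ, isCompact_univ, by simp⟩
  have h1 : ν.map fwdShift = ν := map_eq_of_cesaro_limit hl hlim continuous_fwdShift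
    (Or.inl fun L => by
      rw [hP]
      dsimp only
      rw [Measure.map_map measurable_fwdShift (hmeas L)]
      congr 1
      funext f
      rw [Function.iterate_succ_apply']
      rfl)
  refine ⟨ν, hν, ⟨measurable_fwdShift, h1⟩, ?_⟩
  have : IsProbabilityMeasure (ν.map Prod.snd) :=
    Measure.isProbabilityMeasure_map measurable_snd.aemeasurable
  refine ext_of_forall_integral_eq_of_IsFiniteMeasure fun f => ?_
  rw [integral_map measurable_snd.aemeasurable f.continuous.aestronglyMeasurable]
  have h2 := hlim (f.compContinuous ⟨Prod.snd, continuous_snd⟩)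
  refine tendsto_nhds_unique h2 (tendsto_const_nhds.congr fun N => ?_)
  have h3 : ∀ L, ∫ x, (f.compContinuous ⟨Prod.snd, continuous_snd⟩) x ∂(P L) = ∫ x, f x ∂m₀ := by
    intro L
    rw [hP]
    dsimp only
    rw [integral_map (hmeas L).aemeasurable
      (f.compContinuous ⟨Prod.snd, continuous_snd⟩).continuous.aestronglyMeasurable]
    have h4 := hm₀.iterate L
    conv_rhs => rw [← h4.map_eq, integral_map h4.measurable.aemeasurable
      f.continuous.aestronglyMeasurable]
    refine integral_congr_ae (Eventually.of_forall fun x => ?_)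
    change f (fwdShift^[L] (z, x)).2 = _
    rw [fwdShift_iterate_snd]
  rw [Finset.sum_congr rfl fun L _ => h3 L]
  have hpos : (0 : ℝ) < N + 1 := by positivity
  simp
  field_simp

end NaturalExtension

section Predictable

open Topology

variable {b : ℕ}

/-- The cylinder of depth `K` around a sequence. -/
def cyl (K : ℕ) (d : ℕ → Fin b) : Set (ℕ → Fin b) := {d' | ∀ i < K, d' i = d i}

lemma measurableSet_cyl (K : ℕ) (d : ℕ → Fin b) : MeasurableSet (cyl K d) := by
  have : cyl K d = ⋂ i, ⋂ (_ : i < K), (fun f : ℕ → Fin b => f i) ⁻¹' {d i} := by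
    ext f; simp [cyl]
  rw [this]
  exact MeasurableSet.iInter fun i => MeasurableSet.iInter fun _ =>
    measurable_pi_apply i (measurableSet_singleton _)

lemma cyl_congr {K : ℕ} {d d' : ℕ → Fin b} (h : ∀ i < K, d i = d' i) : cyl K d = cyl K d' := by
  ext f
  exact forall₂_congr fun i hi => by rw [h i hi]

/-- The sequence starting with a given word, padded by a constant. -/
def padWord (z : Fin b) {K : ℕ} (w : Fin K → Fin b) : ℕ → Fin b :=
  fun k => if h : k < K then w ⟨k, h⟩ else z

lemma padWord_cons (z a : Fin b) {K : ℕ} (w : Fin K → Fin b) :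
    padWord z (Fin.cons a w : Fin (K + 1) → Fin b) = seqCons a (padWord z w) := by
  funext k
  cases k with
  | zero => simp [padWord, seqCons]
  | succ k =>
    by_cases h : k < K
    · simp only [padWord, seqCons, h, add_lt_add_iff_right, dite_true]
      exact Fin.cons_succ (α := fun _ => Fin b) a w ⟨k, h⟩
    · simp [padWord, seqCons, h]

lemma padWord_restrict (z : Fin b) (K : ℕ) (d : ℕ → Fin b) {i : ℕ} (hi : i < K) :
    padWord z (fun j : Fin K => d j) i = d i := by
  simp [padWord, hi]

/-- The number of the first `L` digits which differ from the prediction `r` made from the digits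
following them. -/
def misses (r : (ℕ → Fin b) → Fin b) : ℕ → (ℕ → Fin b) → ℕ
  | 0, _ => 0
  | L + 1, d => (if d 0 = r (seqTail d) then 0 else 1) + misses r L (seqTail d)

lemma misses_congr {r : (ℕ → Fin b) → Fin b} {M : ℕ}
    (hr : ∀ d d' : ℕ → Fin b, (∀ i < M, d i = d' i) → r d = r d') (L : ℕ) {d d' : ℕ → Fin b}
    (h : ∀ i < M + L, d i = d' i) : misses r L d = misses r L d' := by
  induction L generalizing d d' with
  | zero => rfl
  | succ L ih =>
    have h1 : r (seqTail d) = r (seqTail d') := hr _ _ fun i hi => h (i + 1) (by omega)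
    have h2 : misses r L (seqTail d) = misses r L (seqTail d') :=
      ih fun i hi => h (i + 1) (by omega)
    simp only [misses, h1, h2, h 0 (by omega)]

lemma sum_pow_misses (r : (ℕ → Fin b) → Fin b) (z : Fin b) (t : ℝ) (M L : ℕ) :
    ∑ w : Fin (M + L) → Fin b, t ^ misses r L (padWord z w) =
      (b : ℝ) ^ M * (1 + (b - 1) * t) ^ L := by
  induction L with
  | zero => simp [misses]
  | succ L ih =>
    have h1 : ∑ w : Fin (M + (L + 1)) → Fin b, t ^ misses r (L + 1) (padWord z w) =
        ∑ p : Fin b × (Fin (M + L) → Fin b),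
          t ^ misses r (L + 1) (padWord z (Fin.cons p.1 p.2 : Fin (M + L + 1) → Fin b)) :=
      (Fintype.sum_equiv (Fin.consEquiv fun _ : Fin (M + L + 1) => Fin b) _ _ fun p => rfl).symm
    rw [h1, Fintype.sum_prod_type, Finset.sum_comm, pow_succ, ← mul_assoc, ← ih, Finset.sum_mul]
    refine Finset.sum_congr rfl fun w _ => ?_
    have h2 : ∀ a : Fin b, t ^ misses r (L + 1) (padWord z (Fin.cons a w : Fin (M + L + 1) → Fin b))
        = t ^ misses r L (padWord z w) * (if a = r (padWord z w) then 1 else t) := by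
      intro a
      rw [padWord_cons]
      change t ^ ((if a = r (padWord z w) then 0 else 1) + misses r L (padWord z w)) = _
      split_ifs <;> simp [pow_add, mul_comm]
    simp only
    rw [Finset.sum_congr rfl fun a _ => h2 a, ← Finset.mul_sum]
    congr 1
    have h3 : ∀ a : Fin b, (if a = r (padWord z w) then (1 : ℝ) else t) =
        t + if a = r (padWord z w) then 1 - t else 0 := by
      intro a; split_ifs <;> ring
    rw [Finset.sum_congr rfl fun a _ => h3 a, Finset.sum_add_distrib]
    simp
    ring

lemma integral_misses_le {P : Measure (ℕ → Fin b)} [IsFiniteMeasure P]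
    (hP : MeasurePreserving seqTail P P) {r : (ℕ → Fin b) → Fin b} (hr : Measurable r) {s : ℝ}
    (hs : P.real {d | d 0 ≠ r (seqTail d)} ≤ s) (L : ℕ) :
    Integrable (fun d => (misses r L d : ℝ)) P ∧ ∫ d, (misses r L d : ℝ) ∂P ≤ L * s := by
  have hm : MeasurableSet {d : ℕ → Fin b | d 0 ≠ r (seqTail d)} :=
    (measurableSet_eq_fun (measurable_pi_apply 0) (hr.comp measurable_seqTail)).compl
  induction L with
  | zero => simp [misses]
  | succ L ih =>
    have e : (fun d => (misses r (L + 1) d : ℝ)) = fun d =>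
        Set.indicator {d : ℕ → Fin b | d 0 ≠ r (seqTail d)} (fun _ => (1 : ℝ)) d +
          (misses r L (seqTail d) : ℝ) := by
      funext d
      by_cases h : d 0 = r (seqTail d) <;> simp [misses, h, Set.indicator]
    have i1 : Integrable (Set.indicator {d : ℕ → Fin b | d 0 ≠ r (seqTail d)}
        (fun _ => (1 : ℝ))) P := (integrable_const _).indicator hm
    have i2 : Integrable (fun d => (misses r L (seqTail d) : ℝ)) P :=
      hP.integrable_comp_of_integrable ih.1
    rw [e]
    refine ⟨i1.add i2, ?_⟩
    rw [integral_add i1 i2, show ∫ d, Set.indicator {d : ℕ → Fin b | d 0 ≠ r (seqTail d)}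
        (fun _ => (1 : ℝ)) d ∂P = P.real {d | d 0 ≠ r (seqTail d)} from integral_indicator_one hm]
    have h3 : ∫ d, (misses r L (seqTail d) : ℝ) ∂P = ∫ d, (misses r L d : ℝ) ∂P := by
      conv_rhs => rw [← hP.map_eq, integral_map hP.measurable.aemeasurable
        (by rw [hP.map_eq]; exact ih.1.aestronglyMeasurable)]
    rw [h3]
    push_cast
    linarith [ih.2]

/-- An invariant measure dominated by a measure with exponentially small cylinders, for which the
first digit can be predicted from finitely many others, vanishes. -/
theorem eq_zero_of_predictable (hb : 2 ≤ b) {P P' : Measure (ℕ → Fin b)} [IsProbabilityMeasure P]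
    (hle : P' ≤ P) (hP' : MeasurePreserving seqTail P' P') {q : ℝ} (hq0 : 0 < q) (hq : q < 1)
    (hdec : Tendsto (fun K => P.real {d | q ^ K < P.real (cyl K d)}) atTop (𝓝 0))
    (hpred : ∀ s : ℝ, 0 < s → ∃ (M : ℕ) (r : (ℕ → Fin b) → Fin b), Measurable r ∧
      (∀ d d' : ℕ → Fin b, (∀ i < M, d i = d' i) → r d = r d') ∧
      P'.real {d | d 0 ≠ r (seqTail d)} ≤ s) : P' = 0 := by
  have hfin : IsFiniteMeasure P' := ⟨(hle _).trans_lt (measure_lt_top _ _)⟩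
  have hb1 : (1 : ℝ) ≤ b - 1 := by
    have : (2 : ℝ) ≤ b := by exact_mod_cast hb
    linarith
  -- choice of the parameters
  obtain ⟨t, ht0, ht1, htq⟩ : ∃ t : ℝ, 0 < t ∧ t < 1 ∧ (1 + (b - 1) * t) * q < 1 := by
    have hc : Tendsto (fun t : ℝ => (1 + (b - 1) * t) * q) (𝓝[>] 0) (𝓝 ((1 + (b - 1) * 0) * q)) :=
      (Continuous.tendsto (by fun_prop) 0).mono_left nhdsWithin_le_nhds
    have h1 := hc.eventually (gt_mem_nhds (show (1 + ((b : ℝ) - 1) * 0) * q < 1 by simpa using hq))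
    have h2 : ∀ᶠ t : ℝ in 𝓝[>] 0, t ∈ Set.Ioo (0 : ℝ) 1 := Ioo_mem_nhdsGT one_pos
    obtain ⟨t, h, h'⟩ := (h1.and h2).exists
    exact ⟨t, h'.1, h'.2, h⟩
  obtain ⟨n, hn0, hn⟩ : ∃ n : ℕ, 0 < n ∧ ((1 + (b - 1) * t) * q) ^ n < t := by
    obtain ⟨n, hn⟩ := exists_pow_lt_of_lt_one ht0 htq
    refine ⟨n + 1, n.succ_pos, lt_of_le_of_lt ?_ hn⟩
    exact pow_le_pow_of_le_one (by positivity) htq.le n.le_succ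
  set Q : ℝ := ((1 + (b - 1) * t) * q) ^ n / t with hQ
  have hQ0 : 0 ≤ Q := by positivity
  have hQ1 : Q < 1 := by rw [hQ, div_lt_one ht0]; exact hn
  suffices h : ∀ η : ℝ, 0 < η → P'.real Set.univ ≤ η by
    have h0 : P'.real Set.univ = 0 := le_antisymm (le_of_forall_pos_le_add fun η hη => by
      simpa using h η hη) measureReal_nonneg
    exact Measure.measure_univ_eq_zero.1 ((measureReal_eq_zero_iff).1 h0)
  intro η hη
  obtain ⟨M, r, hrm, hr, hs⟩ := hpred (η / n) (by positivity)
  -- a bound along `L = n * j`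
  have key : ∀ j : ℕ, 0 < j → P'.real Set.univ ≤
      η + P.real {d | q ^ (M + n * j) < P.real (cyl (M + n * j) d)} + ((b : ℝ) * q) ^ M * Q ^ j := by
    intro j hj
    set L := n * j with hL
    obtain ⟨hinteg, hle1⟩ := integral_misses_le hP' hrm hs L
    have hj0 : (0 : ℝ) < j := by exact_mod_cast hj
    have hn0' : (0 : ℝ) < n := by exact_mod_cast hn0
    have hmk := mul_meas_ge_le_integral_of_nonneg
      (Eventually.of_forall fun d => (Nat.cast_nonneg (misses r L d) : (0:ℝ) ≤ _)) hinteg (j : ℝ)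
    have h1 : P'.real {d | (j : ℝ) ≤ misses r L d} ≤ η := by
      have h2 : (j : ℝ) * P'.real {d | (j : ℝ) ≤ misses r L d} ≤ j * η := by
        refine hmk.trans (hle1.trans (le_of_eq ?_))
        rw [hL]; push_cast; field_simp
      exact le_of_mul_le_mul_left h2 hj0
    obtain ⟨z⟩ : Nonempty (Fin b) := ⟨⟨0, by omega⟩⟩
    set K := M + L with hK
    set B : Set (ℕ → Fin b) := {d | q ^ K < P.real (cyl K d)} with hB
    set F : Finset (Fin K → Fin b) := Finset.univ.filter fun w =>
      misses r L (padWord z w) < j ∧ P.real (cyl K (padWord z w)) ≤ q ^ K with hF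
    have hcov : (Set.univ : Set (ℕ → Fin b)) ⊆ {d | (j : ℝ) ≤ misses r L d} ∪ (B ∪
        ⋃ w ∈ F, cyl K (padWord z w)) := by
      intro d _
      by_cases hd1 : (j : ℝ) ≤ misses r L d
      · exact Or.inl hd1
      by_cases hd2 : d ∈ B
      · exact Or.inr (Or.inl hd2)
      refine Or.inr (Or.inr (Set.mem_biUnion (x := fun i : Fin K => d i) ?_ ?_))
      · have e : ∀ i < K, padWord z (fun i : Fin K => d i) i = d i := fun i hi =>
          padWord_restrict z K d hi
        rw [hF, Finset.coe_filter]
        refine ⟨Finset.mem_univ _, ?_, ?_⟩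
        · rw [misses_congr hr L e]
          exact_mod_cast not_le.1 hd1
        · rw [cyl_congr e]
          exact not_lt.1 hd2
      · intro i hi
        exact (padWord_restrict z K d hi).symm
    have hP'P : ∀ S, P'.real S ≤ P.real S := fun S =>
      ENNReal.toReal_mono (measure_ne_top _ _) (hle S)
    have h3 : P.real (⋃ w ∈ F, cyl K (padWord z w)) ≤ ((b : ℝ) * q) ^ M * Q ^ j := by
      calc P.real (⋃ w ∈ F, cyl K (padWord z w))
          ≤ ∑ w ∈ F, P.real (cyl K (padWord z w)) := measureReal_biUnion_finset_le _ _
        _ ≤ ∑ w ∈ F, (t ^ j)⁻¹ * q ^ K * t ^ misses r L (padWord z w) := by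
            refine Finset.sum_le_sum fun w hw => ?_
            have hw' := (Finset.mem_filter.1 hw).2
            refine hw'.2.trans ?_
            have : t ^ j ≤ t ^ misses r L (padWord z w) :=
              pow_le_pow_of_le_one ht0.le ht1.le hw'.1.le
            have h5 : 1 ≤ (t ^ j)⁻¹ * t ^ misses r L (padWord z w) := by
              rw [inv_mul_eq_div, one_le_div (by positivity)]; exact this
            have h6 : 0 < q ^ K := by positivity
            nlinarith
        _ ≤ ∑ w, (t ^ j)⁻¹ * q ^ K * t ^ misses r L (padWord z w) :=
            Finset.sum_le_sum_of_subset_of_nonneg (Finset.subset_univ _) fun _ _ _ => by positivity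
        _ = ((b : ℝ) * q) ^ M * Q ^ j := by
            rw [← Finset.mul_sum, sum_pow_misses, hQ, div_pow, hK, hL, ← pow_mul, mul_pow, mul_pow,
              pow_add]
            field_simp
    calc P'.real Set.univ ≤ P'.real ({d | (j : ℝ) ≤ misses r L d} ∪ (B ∪
          ⋃ w ∈ F, cyl K (padWord z w))) := measureReal_mono hcov
      _ ≤ _ := measureReal_union_le _ _
      _ ≤ η + P'.real (B ∪ ⋃ w ∈ F, cyl K (padWord z w)) := by gcongr
      _ ≤ η + P.real (B ∪ ⋃ w ∈ F, cyl K (padWord z w)) := by gcongr; exact hP'P _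
      _ ≤ η + (P.real B + P.real (⋃ w ∈ F, cyl K (padWord z w))) := by
          gcongr; exact measureReal_union_le _ _
      _ ≤ _ := by linarith
  have hlim : Tendsto (fun j : ℕ => η + P.real {d | q ^ (M + n * j) < P.real (cyl (M + n * j) d)} +
      ((b : ℝ) * q) ^ M * Q ^ j) atTop (𝓝 (η + 0 + ((b : ℝ) * q) ^ M * 0)) := by
    refine (tendsto_const_nhds.add (hdec.comp ?_)).add
      ((tendsto_pow_atTop_nhds_zero_of_lt_one hQ0 hQ1).const_mul _)
    refine tendsto_atTop_mono (fun j => ?_) tendsto_id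
    simp only [id]
    nlinarith
  simpa using ge_of_tendsto hlim ((eventually_gt_atTop 0).mono key)

end Predictable

section Approximation

open Topology BoundedContinuousFunction

variable {b : ℕ}

/-- Keep the first `M` digits, pad by a constant. -/
def truncSeq (z : Fin b) (M : ℕ) (d : ℕ → Fin b) : ℕ → Fin b := fun k => if k < M then d k else z

lemma tendsto_truncSeq (z : Fin b) (d : ℕ → Fin b) :
    Tendsto (fun M => truncSeq z M d) atTop (𝓝 d) := by
  refine tendsto_pi_nhds.2 fun k => tendsto_const_nhds.congr' ?_
  filter_upwards [eventually_gt_atTop k] with M hM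
  simp [truncSeq, hM]

lemma measurable_truncSeq (z : Fin b) (M : ℕ) : Measurable (truncSeq z M) := by
  refine measurable_pi_lambda _ fun k => ?_
  by_cases h : k < M
  · simpa [truncSeq, h] using measurable_pi_apply k
  · simp [truncSeq, h]

lemma exists_finite_range_approx (hb : 2 ≤ b) (P : Measure (ℕ → Fin b)) [IsProbabilityMeasure P]
    {E : Fin b → Set (ℕ → Fin b)} (hE : ∀ a, MeasurableSet (E a))
    (hdisj : ∀ a a' d, d ∈ E a → d ∈ E a' → a = a') {s : ℝ} (hs : 0 < s) :
    ∃ (M : ℕ) (r : (ℕ → Fin b) → Fin b), Measurable r ∧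
      (∀ d d' : ℕ → Fin b, (∀ i < M, d i = d' i) → r d = r d') ∧
      P.real {d | ∃ a, d ∈ E a ∧ r d ≠ a} ≤ s := by
  have : NeZero b := ⟨by omega⟩
  set z : Fin b := 0
  set R : (ℕ → Fin b) → ℝ := fun d => ∑ a, (E a).indicator (fun _ => ((a : ℕ) : ℝ)) d with hR
  have hRE : ∀ a, ∀ d ∈ E a, R d = (a : ℕ) := by
    intro a d hd
    rw [hR]
    dsimp only
    rw [Finset.sum_eq_single a, Set.indicator_of_mem hd]
    · intro a' _ h
      exact Set.indicator_of_notMem (fun h' => h (hdisj _ _ _ h' hd)) _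
    · simp
  have hRint : Integrable R P :=
    integrable_finsetSum _ fun a _ => (integrable_const _).indicator (hE a)
  obtain ⟨g, hg, hgint⟩ := hRint.exists_boundedContinuous_integral_sub_le
    (show (0 : ℝ) < s / 4 by positivity)
  have htr : ∀ M, Integrable (fun d => g (truncSeq z M d)) P := fun M =>
    Integrable.of_bound ((g.continuous.measurable.comp
      (measurable_truncSeq z M)).aestronglyMeasurable) ‖g‖
      (Eventually.of_forall fun d => g.norm_coe_le_norm _)
  have hlim : Tendsto (fun M => ∫ d, ‖g (truncSeq z M d) - g d‖ ∂P) atTop (𝓝 0) := by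
    have h0 : (0 : ℝ) = ∫ d : ℕ → Fin b, ‖g d - g d‖ ∂P := by simp
    rw [h0]
    refine tendsto_integral_of_dominated_convergence (fun _ => 2 * ‖g‖) (fun M =>
      ((htr M).sub hgint).norm.aestronglyMeasurable) (integrable_const _) (fun M => ?_) ?_
    · refine Eventually.of_forall fun d => ?_
      rw [norm_norm]
      refine (norm_sub_le _ _).trans ?_
      linarith [g.norm_coe_le_norm (truncSeq z M d), g.norm_coe_le_norm d]
    · refine Eventually.of_forall fun d => ?_
      exact (((g.continuous.tendsto d).comp (tendsto_truncSeq z d)).sub tendsto_const_nhds).norm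
  obtain ⟨M, hM⟩ := (hlim.eventually (gt_mem_nhds (show (0:ℝ) < s / 4 by positivity))).exists
  set r : (ℕ → Fin b) → Fin b := fun d => Fin.ofNat b ⌊g (truncSeq z M d) + 1 / 2⌋₊ with hr
  refine ⟨M, r, ?_, ?_, ?_⟩
  · have h1 : Measurable fun d : ℕ → Fin b => ⌊g (truncSeq z M d) + 1 / 2⌋₊ :=
      Nat.measurable_floor.comp ((g.continuous.measurable.comp (measurable_truncSeq z M)).add_const _)
    exact (measurable_of_countable (Fin.ofNat b)).comp h1
  · intro d d' h
    have : truncSeq z M d = truncSeq z M d' := by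
      funext k
      by_cases hk : k < M
      · simp [truncSeq, hk, h k hk]
      · simp [truncSeq, hk]
    simp only [hr, this]
  · have hinteg : Integrable (fun d => ‖g (truncSeq z M d) - R d‖) P := ((htr M).sub hRint).norm
    have hsub : {d | ∃ a, d ∈ E a ∧ r d ≠ a} ⊆ {d | 1 / 2 ≤ ‖g (truncSeq z M d) - R d‖} := by
      rintro d ⟨a, hd, hne⟩
      change 1 / 2 ≤ ‖g (truncSeq z M d) - R d‖
      by_contra! h
      rw [hRE a d hd, Real.norm_eq_abs, abs_lt] at h
      apply hne
      have : ⌊g (truncSeq z M d) + 1 / 2⌋₊ = (a : ℕ) := by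
        rw [Nat.floor_eq_iff (by linarith [(Nat.cast_nonneg (a : ℕ) : (0:ℝ) ≤ _), h.1])]
        constructor <;> linarith [h.1, h.2]
      rw [hr]
      dsimp only
      rw [this]
      exact Fin.ext (Nat.mod_eq_of_lt a.2)
    have h2 := mul_meas_ge_le_integral_of_nonneg
      (Eventually.of_forall fun d => norm_nonneg (g (truncSeq z M d) - R d)) hinteg (1 / 2)
    have h3 : ∫ d, ‖g (truncSeq z M d) - R d‖ ∂P ≤
        (∫ d, ‖g (truncSeq z M d) - g d‖ ∂P) + ∫ d, ‖R d - g d‖ ∂P := by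
      have i1 : Integrable (fun d => ‖g (truncSeq z M d) - g d‖) P := ((htr M).sub hgint).norm
      have i2 : Integrable (fun d => ‖R d - g d‖) P := (hRint.sub hgint).norm
      rw [← integral_add i1 i2]
      refine integral_mono hinteg (i1.add i2) fun d => ?_
      change ‖g (truncSeq z M d) - R d‖ ≤ ‖g (truncSeq z M d) - g d‖ + ‖R d - g d‖
      rw [norm_sub_rev (R d)]
      exact norm_sub_le_norm_sub_add_norm_sub _ _ _
    refine (measureReal_mono hsub).trans ?_
    linarith

end Approximation

lemma measurableSet_head_eq {b : ℕ} (a : Fin b) : MeasurableSet {f : ℕ → Fin b | f 0 = a} :=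
  measurableSet_eq_fun (measurable_pi_apply 0) measurable_const

section Disintegration

open Topology ProbabilityTheory

variable {b : ℕ} {ν : Measure ((ℕ → Fin b) × (ℕ → Fin b))} [IsProbabilityMeasure ν]
  {κ : Kernel (ℕ → Fin b) (ℕ → Fin b)} [IsMarkovKernel κ]

lemma kernel_fwdShift_identity (hν : MeasurePreserving fwdShift ν ν) (hκ : ν.fst ⊗ₘ κ = ν)
    (a : Fin b) {B : Set (ℕ → Fin b)} (hB : MeasurableSet B) :
    ∀ᵐ d ∂ν.fst, κ d {f | f 0 = a ∧ seqTail f ∈ B} = κ d {f | f 0 = a} * κ (seqCons a d) B := by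
  have hm0 := measurableSet_head_eq a
  have hm1 : MeasurableSet {f : ℕ → Fin b | f 0 = a ∧ seqTail f ∈ B} :=
    hm0.inter (measurable_seqTail hB)
  have hmc : Measurable fun d : ℕ → Fin b => seqCons a d :=
    measurable_seqCons.comp measurable_prodMk_left
  have hh : Measurable fun d => κ d B := κ.measurable_coe hB
  refine ae_eq_of_forall_setLIntegral_eq_of_sigmaFinite (κ.measurable_coe hm1)
    ((κ.measurable_coe hm0).mul (hh.comp hmc)) fun E hE _ => ?_
  set D : Set (ℕ → Fin b) := {d | d 0 = a ∧ seqTail d ∈ E} with hD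
  have hmD : MeasurableSet D := hm0.inter (measurable_seqTail hE)
  have hL : ∫⁻ d in E, κ d {f | f 0 = a ∧ seqTail f ∈ B} ∂ν.fst =
      ν (E ×ˢ {f | f 0 = a ∧ seqTail f ∈ B}) := by
    conv_rhs => rw [← hκ]
    rw [Measure.compProd_apply_prod hE hm1]
  have hR : ∫⁻ d in E, κ d {f | f 0 = a} * κ (seqCons a d) B ∂ν.fst =
      ∫⁻ p, D.indicator (fun d => κ d B) (fwdShift p).1 ∂ν := by
    have hmeas : Measurable fun p : (ℕ → Fin b) × (ℕ → Fin b) =>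
        D.indicator (fun d => κ d B) (fwdShift p).1 :=
      (hh.indicator hmD).comp (measurable_fst.comp measurable_fwdShift)
    conv_rhs => rw [← hκ]
    rw [Measure.lintegral_compProd hmeas, ← lintegral_indicator hE]
    refine lintegral_congr fun d => ?_
    by_cases hd : d ∈ E
    · rw [Set.indicator_of_mem hd, mul_comm, ← lintegral_indicator_const hm0]
      refine lintegral_congr fun f => ?_
      by_cases hf : f 0 = a
      · have h1 : (fwdShift (d, f)).1 ∈ D := ⟨hf, hd⟩
        rw [Set.indicator_of_mem h1, Set.indicator_of_mem (show f ∈ {f : ℕ → Fin b | f 0 = a} from hf)]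
        simp [fwdShift, hf]
      · have h1 : (fwdShift (d, f)).1 ∉ D := fun h => hf h.1
        rw [Set.indicator_of_notMem h1,
          Set.indicator_of_notMem (show f ∉ {f : ℕ → Fin b | f 0 = a} from hf)]
    · rw [Set.indicator_of_notMem hd]
      refine (lintegral_eq_zero_of_ae_eq_zero (Eventually.of_forall fun f => ?_)).symm
      exact Set.indicator_of_notMem (fun h => hd h.2) _
  rw [hL, hR]
  have h1 : ∫⁻ p, D.indicator (fun d => κ d B) (fwdShift p).1 ∂ν =
      ∫⁻ p, D.indicator (fun d => κ d B) p.1 ∂ν :=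
    hν.lintegral_comp ((hh.indicator hmD).comp measurable_fst)
  have h2 : ∫⁻ p, D.indicator (fun d => κ d B) p.1 ∂ν = ν (D ×ˢ B) := by
    have : ∫⁻ p, D.indicator (fun d => κ d B) p.1 ∂ν = ∫⁻ d, D.indicator (fun d => κ d B) d ∂ν.fst :=
      (lintegral_map (hh.indicator hmD) measurable_fst).symm
    rw [this, lintegral_indicator hmD]
    conv_rhs => rw [← hκ]
    rw [Measure.compProd_apply_prod hmD hB]
  rw [h1, h2, ← hν.measure_preimage (hmD.prod hB).nullMeasurableSet]
  congr 1
  ext p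
  constructor
  · rintro ⟨h, h', h''⟩
    exact ⟨⟨h', h⟩, h''⟩
  · rintro ⟨⟨h', h⟩, h''⟩
    exact ⟨h, h', h''⟩

lemma measurable_kernel_cyl (hb : 2 ≤ b) (K : ℕ) :
    Measurable fun p : (ℕ → Fin b) × (ℕ → Fin b) => κ p.1 (cyl K p.2) := by
  set z : Fin b := ⟨0, by omega⟩
  have h1 : Measurable fun q : (ℕ → Fin b) × (Fin K → Fin b) => κ q.1 (cyl K (padWord z q.2)) :=
    measurable_from_prod_countable_left fun w => κ.measurable_coe (measurableSet_cyl K (padWord z w))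
  have h2 : Measurable fun p : (ℕ → Fin b) × (ℕ → Fin b) => (p.1, fun i : Fin K => p.2 i) :=
    measurable_fst.prodMk (measurable_pi_lambda _ fun i =>
      (measurable_pi_apply (i : ℕ)).comp measurable_snd)
  have e : (fun p : (ℕ → Fin b) × (ℕ → Fin b) => κ p.1 (cyl K p.2)) =
      (fun q : (ℕ → Fin b) × (Fin K → Fin b) => κ q.1 (cyl K (padWord z q.2))) ∘
        fun p => (p.1, fun i : Fin K => p.2 i) := by
    funext p
    exact congrArg (κ p.1) (cyl_congr fun i hi => (padWord_restrict z K p.2 hi).symm)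
  rw [e]
  exact h1.comp h2

lemma kernel_cyl_succ (hb : 2 ≤ b) (hν : MeasurePreserving fwdShift ν ν) (hκ : ν.fst ⊗ₘ κ = ν) :
    ∀ᵐ p ∂ν, ∀ K, κ p.1 (cyl (K + 1) p.2) =
      κ p.1 {f | f 0 = p.2 0} * κ (fwdShift p).1 (cyl K (fwdShift p).2) := by
  set z : Fin b := ⟨0, by omega⟩
  have h1 : ∀ᵐ d ∂ν.fst, ∀ (a : Fin b) (K : ℕ) (w : Fin K → Fin b),
      κ d {f | f 0 = a ∧ seqTail f ∈ cyl K (padWord z w)} =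
        κ d {f | f 0 = a} * κ (seqCons a d) (cyl K (padWord z w)) := by
    simp only [ae_all_iff]
    exact fun a K w => kernel_fwdShift_identity hν hκ a (measurableSet_cyl _ _)
  have h2 : ∀ᵐ p ∂ν, ∀ (a : Fin b) (K : ℕ) (w : Fin K → Fin b),
      κ p.1 {f | f 0 = a ∧ seqTail f ∈ cyl K (padWord z w)} =
        κ p.1 {f | f 0 = a} * κ (seqCons a p.1) (cyl K (padWord z w)) :=
    ae_of_ae_map measurable_fst.aemeasurable h1
  filter_upwards [h2] with p hp K
  have e : cyl K (padWord z fun i : Fin K => seqTail p.2 i) = cyl K (seqTail p.2) :=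
    cyl_congr fun i hi => padWord_restrict z K (seqTail p.2) hi
  have := hp (p.2 0) K fun i : Fin K => seqTail p.2 i
  rw [e] at this
  refine Eq.trans ?_ this
  congr 1
  ext f
  constructor
  · intro h
    exact ⟨h 0 (by omega), fun i hi => h (i + 1) (by omega)⟩
  · rintro ⟨h, h'⟩ i hi
    cases i with
    | zero => exact h
    | succ i => exact h' i (by omega)

/-- If past cylinders decay exponentially, the conditional measures of the future given the past
have no atoms. -/
theorem kernel_singleton_eq_zero (hb : 2 ≤ b) (hν : MeasurePreserving fwdShift ν ν)
    (hκ : ν.fst ⊗ₘ κ = ν) {q : ℝ} (hq0 : 0 < q) (hq : q < 1)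
    (hdec : Tendsto (fun K => ν.fst.real {d | q ^ K < ν.fst.real (cyl K d)}) atTop (𝓝 0)) :
    ∀ᵐ d ∂ν.fst, ∀ f, κ d {f} = 0 := by
  have : IsProbabilityMeasure ν.fst := inferInstance
  set α : (ℕ → Fin b) × (ℕ → Fin b) → ENNReal := fun p => ⨅ K, κ p.1 (cyl K p.2) with hα
  have hαm : Measurable α := Measurable.iInf fun K => measurable_kernel_cyl hb K
  have hα1 : ∀ p, α p ≤ 1 := fun p => (iInf_le _ 0).trans prob_le_one
  have hsucc := kernel_cyl_succ hb hν hκ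
  have hanti : ∀ p : (ℕ → Fin b) × (ℕ → Fin b), Antitone fun K => κ p.1 (cyl K p.2) :=
    fun p i j hij => measure_mono fun f hf k hk => hf k (hk.trans_le hij)
  have hmul : ∀ᵐ p ∂ν, α p = κ p.1 {f | f 0 = p.2 0} * α (fwdShift p) := by
    filter_upwards [hsucc] with p hp
    have h1 : α p = ⨅ K, κ p.1 (cyl (K + 1) p.2) := ((hanti p).iInf_nat_add 1).symm
    rw [h1, hα, ENNReal.mul_iInf (fun h => absurd h (measure_ne_top _ _))]
    exact iInf_congr hp
  have hle : α ≤ᵐ[ν] α ∘ fwdShift := by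
    filter_upwards [hmul] with p hp
    rw [hp]
    exact mul_le_of_le_one_left zero_le prob_le_one
  have heq : α =ᵐ[ν] α ∘ fwdShift := by
    refine ae_eq_of_ae_le_of_lintegral_le hle ?_ (hαm.comp measurable_fwdShift).aemeasurable
      (hν.lintegral_comp hαm).le
    refine ne_top_of_le_ne_top ENNReal.one_ne_top ((lintegral_mono hα1).trans ?_)
    simp
  set A : Set ((ℕ → Fin b) × (ℕ → Fin b)) := {p | α p ≠ 0} with hA
  have hAm : MeasurableSet A := (measurableSet_eq_fun hαm measurable_const).compl
  have hAinv : fwdShift ⁻¹' A =ᵐ[ν] A := by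
    filter_upwards [heq] with p hp
    exact propext (show α (fwdShift p) ≠ 0 ↔ α p ≠ 0 by rw [hp]; rfl)
  have hpA : ∀ᵐ p ∂ν, p ∈ A → κ p.1 {f | f 0 = p.2 0} = 1 := by
    filter_upwards [hmul, heq] with p h1 h2 hp
    change α p = α (fwdShift p) at h2
    rw [← h2] at h1
    have h3 : κ p.1 {f | f 0 = p.2 0} * α p = 1 * α p := by rw [one_mul]; exact h1.symm
    exact (ENNReal.mul_left_inj hp (ne_top_of_le_ne_top ENNReal.one_ne_top (hα1 p))).1 h3
  have hAF : MeasurePreserving fwdShift (ν.restrict A) (ν.restrict A) := by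
    have := hν.restrict_preimage hAm
    rwa [Measure.restrict_congr_set hAinv] at this
  set P' := (ν.restrict A).map Prod.fst with hP'
  have hmfst : Measurable (Prod.fst : (ℕ → Fin b) × (ℕ → Fin b) → _) := measurable_fst
  have hP'0 : P' = 0 := by
    refine eq_zero_of_predictable hb (P := ν.fst) (Measure.map_mono Measure.restrict_le_self hmfst)
      ⟨measurable_seqTail, ?_⟩ hq0 hq hdec fun s hs => ?_
    · conv_lhs => rw [hP', ← hAF.map_eq]
      rw [Measure.map_map hmfst measurable_fwdShift,
        Measure.map_map measurable_seqTail (hmfst.comp measurable_fwdShift)]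
      rfl
    · obtain ⟨M, r, hrm, hr, hs'⟩ := exists_finite_range_approx hb ν.fst
        (E := fun a => {d | κ d {f | f 0 = a} = 1})
        (fun a => measurableSet_eq_fun (κ.measurable_coe
          (measurableSet_head_eq a)) measurable_const)
        (fun a a' d h h' => by
          by_contra hne
          have hd : Disjoint {f : ℕ → Fin b | f 0 = a} {f | f 0 = a'} :=
            Set.disjoint_left.2 fun f hf hf' => hne (hf.symm.trans hf')
          have h2 := measure_union (μ := κ d) hd
            (measurableSet_head_eq a')
          have h3 : κ d ({f : ℕ → Fin b | f 0 = a} ∪ {f | f 0 = a'}) ≤ 1 := prob_le_one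
          rw [h2, show κ d {f | f 0 = a} = 1 from h, show κ d {f | f 0 = a'} = 1 from h'] at h3
          norm_num at h3) hs
      refine ⟨M, r, hrm, hr, le_trans ?_ hs'⟩
      have hmS : MeasurableSet {d : ℕ → Fin b | d 0 ≠ r (seqTail d)} :=
        (measurableSet_eq_fun (measurable_pi_apply 0) (hrm.comp measurable_seqTail)).compl
      refine ENNReal.toReal_mono (measure_ne_top _ _) ?_
      rw [hP', Measure.map_apply hmfst hmS, ← hAF.measure_preimage (hmfst hmS).nullMeasurableSet,
        Measure.restrict_apply (measurable_fwdShift (hmfst hmS))]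
      refine (measure_mono_ae ?_).trans (Measure.le_map_apply hmfst.aemeasurable _)
      filter_upwards [hpA] with p hp hpS
      exact ⟨p.2 0, hp hpS.2, fun h => hpS.1 h.symm⟩
  have hA0 : ν A = 0 := by
    have : P' Set.univ = 0 := by rw [hP'0]; rfl
    rwa [hP', Measure.map_apply hmfst MeasurableSet.univ, Set.preimage_univ,
      Measure.restrict_apply_univ] at this
  have hfin : ∀ᵐ p ∂(ν.fst ⊗ₘ κ), α p = 0 := by
    rw [hκ]
    exact measure_mono_null (fun p hp => hp) hA0
  filter_upwards [Measure.ae_ae_of_ae_compProd hfin] with d hd f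
  by_contra h
  have h1 : κ d {f | ¬ α (d, f) = 0} = 0 := hd
  have h2 : f ∈ {f | ¬ α (d, f) = 0} := by
    intro h3
    refine h (le_antisymm (h3 ▸ le_iInf fun K => measure_mono ?_) zero_le)
    rintro _ rfl i _
    rfl
  exact h (measure_mono_null (Set.singleton_subset_iff.2 h2) h1)

end Disintegration

section DigitFibres

variable {b : ℕ}

lemma ofDigits_eq_head (hb : 0 < b) (f : ℕ → Fin b) :
    (b : ℝ) * Real.ofDigits f = (f 0 : ℕ) + Real.ofDigits (seqTail f) := by
  have h := ofDigits_seqCons (f 0) (seqTail f)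
  have e : seqCons (f 0) (seqTail f) = f := by
    funext k; cases k <;> rfl
  have : (b : ℝ) ≠ 0 := by exact_mod_cast hb.ne'
  rw [e] at h
  rw [h]
  field_simp

lemma ofDigits_tail_of_extreme (hb : 0 < b) {h : ℕ → Fin b} {e : ℝ} (he : e = 0 ∨ e = 1)
    (hh : Real.ofDigits h = e) :
    Real.ofDigits (seqTail h) = e ∧ ((h 0 : ℕ) : ℝ) = (b - 1) * e := by
  have h1 := ofDigits_eq_head hb h
  have h4 := Real.ofDigits_nonneg (seqTail h)
  have h5 := Real.ofDigits_le_one (seqTail h)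
  have h6 : (0 : ℝ) ≤ (h 0 : ℕ) := Nat.cast_nonneg _
  have h7 : ((h 0 : ℕ) : ℝ) ≤ b - 1 := by
    have : ((h 0 : ℕ) : ℝ) + 1 ≤ b := by exact_mod_cast (h 0).2
    linarith
  rcases he with rfl | rfl <;> rw [hh] at h1 <;> constructor <;> linarith

lemma const_of_ofDigits_extreme (hb : 0 < b) {h : ℕ → Fin b} {e : ℝ} (he : e = 0 ∨ e = 1)
    (hh : Real.ofDigits h = e) (i : ℕ) : h i = h 0 := by
  have h0 : ∀ k, Real.ofDigits (seqTail^[k] h) = e := by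
    intro k
    induction k with
    | zero => exact hh
    | succ k ih =>
      rw [Function.iterate_succ_apply']
      exact (ofDigits_tail_of_extreme hb he ih).1
  have h1 : ∀ k, ((h k : ℕ) : ℝ) = (b - 1) * e := by
    intro k
    have := (ofDigits_tail_of_extreme hb he (h0 k)).2
    rwa [seqTail_iterate, add_zero] at this
  refine Fin.ext ?_
  exact_mod_cast (h1 i).trans (h1 0).symm

lemma countable_ofDigits_fibre (hb : 0 < b) (x : ℝ) :
    {f : ℕ → Fin b | Real.ofDigits f = x}.Countable := by
  rcases Set.eq_empty_or_nonempty {f : ℕ → Fin b | Real.ofDigits f = x} with h | ⟨f, hf⟩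
  · rw [h]; exact Set.countable_empty
  have hf' : Real.ofDigits f = x := hf
  refine Set.Countable.mono (s₂ := {f} ∪
    Set.range fun p : Fin b × (Σ k : ℕ, (Fin k → Fin b)) => padWord p.1 p.2.2) ?_
    ((Set.countable_singleton f).union (Set.countable_range _))
  intro g hg
  have hg' : Real.ofDigits g = x := hg
  by_cases hgf : g = f
  · exact Or.inl hgf
  right
  obtain ⟨k, hk, hmin⟩ : ∃ k, f k ≠ g k ∧ ∀ i < k, f i = g i := by
    have hex : ∃ k, f k ≠ g k := by
      by_contra! h
      exact hgf (funext fun k => (h k).symm)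
    classical
    exact ⟨Nat.find hex, Nat.find_spec hex, fun i hi => not_not.1 (Nat.find_min hex hi)⟩
  have hpow : ((b : ℝ) ^ k)⁻¹ ≠ 0 := by
    have : (b : ℝ) ≠ 0 := by exact_mod_cast hb.ne'
    positivity
  have h1 : Real.ofDigits (fun i => f (i + k)) = Real.ofDigits (fun i => g (i + k)) := by
    have e := Real.ofDigits_eq_sum_add_ofDigits f k
    have e' := Real.ofDigits_eq_sum_add_ofDigits g k
    have es : ∑ i ∈ Finset.range k, Real.ofDigitsTerm f i =
        ∑ i ∈ Finset.range k, Real.ofDigitsTerm g i :=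
      Finset.sum_congr rfl fun i hi => by
        simp [Real.ofDigitsTerm, hmin i (Finset.mem_range.1 hi)]
    rw [hf', es] at e
    rw [hg'] at e'
    exact mul_left_cancel₀ hpow (by linarith)
  have e := ofDigits_eq_head hb fun i => f (i + k)
  have e' := ofDigits_eq_head hb fun i => g (i + k)
  simp only [zero_add] at e e'
  rw [h1] at e
  set y := Real.ofDigits (seqTail fun i => f (i + k))
  set y' := Real.ofDigits (seqTail fun i => g (i + k)) with hy'
  have b1 : 0 ≤ y := Real.ofDigits_nonneg _
  have b2 : y ≤ 1 := Real.ofDigits_le_one _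
  have b3 : 0 ≤ y' := Real.ofDigits_nonneg _
  have b4 : y' ≤ 1 := Real.ofDigits_le_one _
  have hey : y' = 0 ∨ y' = 1 := by
    rcases lt_or_gt_of_ne (fun h => hk (Fin.ext h) : (f k : ℕ) ≠ g k) with hlt | hlt
    · left
      have : ((f k : ℕ) : ℝ) + 1 ≤ (g k : ℕ) := by exact_mod_cast hlt
      linarith
    · right
      have : ((g k : ℕ) : ℝ) + 1 ≤ (f k : ℕ) := by exact_mod_cast hlt
      linarith
  have hconst := const_of_ofDigits_extreme hb hey hy'.symm
  refine ⟨(g (k + 1), ⟨k + 1, fun i => g i⟩), ?_⟩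
  funext i
  by_cases hi : i < k + 1
  · simp [padWord, hi]
  · have h2 := hconst (i - (k + 1))
    simp only [seqTail] at h2
    rw [show i - (k + 1) + 1 + k = i by omega, show 0 + 1 + k = k + 1 by omega] at h2
    simp [padWord, hi, h2]

end DigitFibres

section PastCylinders

open Topology ProbabilityTheory

variable {b : ℕ} {ν : Measure ((ℕ → Fin b) × (ℕ → Fin b))} [IsProbabilityMeasure ν]

lemma measurableSet_cyl_large (P : Measure (ℕ → Fin b)) [IsProbabilityMeasure P] (K : ℕ) (c : ℝ) :
    MeasurableSet {d : ℕ → Fin b | c < P.real (cyl K d)} := by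
  rcases isEmpty_or_nonempty (Fin b) with h | ⟨⟨z⟩⟩
  · have : IsEmpty (ℕ → Fin b) := inferInstance
    rw [Set.eq_empty_of_isEmpty {d : ℕ → Fin b | c < P.real (cyl K d)}]
    exact MeasurableSet.empty
  have h2 : Measurable fun d : ℕ → Fin b => (fun i : Fin K => d i) :=
    measurable_pi_lambda _ fun i => measurable_pi_apply (i : ℕ)
  have e : {d : ℕ → Fin b | c < P.real (cyl K d)} =
      (fun d : ℕ → Fin b => (fun i : Fin K => d i)) ⁻¹'
        {w | c < P.real (cyl K (padWord z w))} := by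
    ext d
    change c < P.real (cyl K d) ↔ c < P.real (cyl K (padWord z fun i : Fin K => d i))
    rw [cyl_congr (d := padWord z fun i : Fin K => d i) fun i hi => padWord_restrict z K d hi]
  rw [e]
  exact h2 (Set.toFinite _).measurableSet

lemma past_cyl_eq (hν : MeasurePreserving fwdShift ν ν) (K : ℕ) (d f : ℕ → Fin b)
    (h : ∀ i < K, f i = d (K - 1 - i)) : ν.fst (cyl K d) = ν.snd (cyl K f) := by
  have hm := measurableSet_cyl K d
  rw [Measure.fst_apply hm, Measure.snd_apply (measurableSet_cyl K f),
    ← (hν.iterate K).measure_preimage (measurable_fst hm).nullMeasurableSet]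
  congr 1
  ext p
  constructor
  · intro hp i hi
    have := hp (K - 1 - i) (by omega)
    rw [fwdShift_iterate_fst K p (by omega)] at this
    rw [h i hi, ← this, show K - 1 - (K - 1 - i) = i by omega]
  · intro hp i hi
    rw [fwdShift_iterate_fst K p hi, hp _ (by omega), h _ (by omega),
      show K - 1 - (K - 1 - i) = i by omega]

lemma past_cyl_decay (hν : MeasurePreserving fwdShift ν ν) {q : ℝ}
    (hdec : Tendsto (fun K => ν.snd.real {f | q ^ K < ν.snd.real (cyl K f)}) atTop (𝓝 0)) :
    Tendsto (fun K => ν.fst.real {d | q ^ K < ν.fst.real (cyl K d)}) atTop (𝓝 0) := by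
  refine hdec.congr fun K => ?_
  have hm1 := measurableSet_cyl_large ν.fst K (q ^ K)
  have hm2 := measurableSet_cyl_large ν.snd K (q ^ K)
  rw [measureReal_def, measureReal_def, Measure.fst_apply hm1, Measure.snd_apply hm2]
  rw [← (hν.iterate K).measure_preimage (measurable_fst hm1).nullMeasurableSet]
  congr 2
  ext p
  change q ^ K < ν.snd.real (cyl K p.2) ↔ q ^ K < ν.fst.real (cyl K (fwdShift^[K] p).1)
  rw [measureReal_def, measureReal_def, past_cyl_eq hν K (fwdShift^[K] p).1 p.2]
  intro i hi
  rw [fwdShift_iterate_fst K p (by omega), show K - 1 - (K - 1 - i) = i by omega]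

/-- Under exponential decay of cylinders, the conditional laws of the future have no atoms after
evaluating base `b` expansions. -/
theorem condKernel_ofDigits_fibre_eq_zero (hb : 2 ≤ b) (hν : MeasurePreserving fwdShift ν ν)
    {κ : Kernel (ℕ → Fin b) (ℕ → Fin b)} [IsMarkovKernel κ]
    (hκ : ν.fst ⊗ₘ κ = ν) {q : ℝ} (hq0 : 0 < q) (hq : q < 1)
    (hdec : Tendsto (fun K => ν.snd.real {f | q ^ K < ν.snd.real (cyl K f)}) atTop (𝓝 0)) :
    ∀ᵐ d ∂ν.fst, ∀ x : ℝ, κ d {f | Real.ofDigits f = x} = 0 := by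
  filter_upwards [kernel_singleton_eq_zero hb hν hκ hq0 hq (past_cyl_decay hν hdec)] with d hd x
  have hc := countable_ofDigits_fibre (b := b) (by omega) x
  rw [← Set.biUnion_of_singleton {f : ℕ → Fin b | Real.ofDigits f = x},
    measure_biUnion_null_iff hc]
  exact fun f _ => hd f

end PastCylinders

section PastLattices

open Topology LatticeSpace

variable {b : ℕ}

/-- The set of real numbers which are badly approximable with constant `ε`. -/
def badlyApproximable (ε : ℝ) : Set ℝ :=
  {x | ∀ (m : ℤ) (k : ℕ), 0 < k → ε / k ≤ |(k : ℝ) * x - m|}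

/-- The integer written in base `b` with the first `L` digits of `d`, least significant first. -/
def pastInt (L : ℕ) (d : ℕ → Fin b) : ℕ := ∑ i ∈ Finset.range L, (d i : ℕ) * b ^ i

lemma pastInt_succ (L : ℕ) (d : ℕ → Fin b) :
    pastInt (L + 1) d = pastInt L d + (d L : ℕ) * b ^ L := Finset.sum_range_succ _ _

lemma pastInt_seqCons (L : ℕ) (a : Fin b) (d : ℕ → Fin b) :
    pastInt (L + 1) (seqCons a d) = a + b * pastInt L d := by
  rw [pastInt, Finset.sum_range_succ', pastInt, Finset.mul_sum, add_comm]
  congr 1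
  · simp [seqCons]
  · refine Finset.sum_congr rfl fun i _ => ?_
    change (d i : ℕ) * b ^ (i + 1) = _
    ring

/-- The past lattices attached to the digit sequence `d`, truncated at `L` digits. -/
noncomputable def pastSeq (L : ℕ) (d : ℕ → Fin b) (j : ℕ) : LatticeSpace :=
  LatticeSpace.mk (unip (pastInt L d) * dil b ^ ((L : ℤ) - j))

/-- A pair of past and future digits together with the truncated past lattices. -/
noncomputable def withPast (L : ℕ) (p : (ℕ → Fin b) × (ℕ → Fin b)) :
    PastState b × (ℕ → Fin b) := ((p.1, pastSeq L p.1), p.2)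

/-- The inverse of `backMap`. -/
noncomputable def fwdMap (y : PastState b × (ℕ → Fin b)) : PastState b × (ℕ → Fin b) :=
  ((seqCons (y.2 0) y.1.1, fun j => unip ((y.2 0 : ℕ) : ℝ) • dil b • y.1.2 j), seqTail y.2)

lemma heckeRel_pastSeq (L : ℕ) (d : ℕ → Fin b) (i k : ℕ) :
    heckeRel b k (pastSeq L d i) (pastSeq L d (i + k)) := by
  refine ⟨_, rfl, ?_⟩
  rw [pastSeq, mul_assoc, ← zpow_natCast, ← _root_.zpow_neg, ← zpow_add]
  congr 3
  push_cast; ring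

lemma pastSeq_succ_succ (hb : 0 < b) (L : ℕ) (d : ℕ → Fin b) (j : ℕ) :
    pastSeq (L + 1) d (j + 1) = pastSeq L d j := by
  have hb' : (b : ℝ) ≠ 0 := by exact_mod_cast hb.ne'
  have e1 : ((L + 1 : ℕ) : ℤ) - ((j + 1 : ℕ) : ℤ) = (L : ℤ) - j := by push_cast; ring
  have e2 : (pastInt (L + 1) d : ℝ) = pastInt L d +
      (b : ℝ) ^ ((L : ℤ) - j) * (((d L : ℕ) * b ^ j : ℕ) : ℤ) := by
    rw [pastInt_succ]
    push_cast
    rw [zpow_sub₀ hb', zpow_natCast, zpow_natCast]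
    field_simp
  rw [pastSeq, pastSeq, e1, e2, unip_add, mul_assoc, ← dil_zpow_mul_unip hb, ← mul_assoc]
  exact LatticeSpace.mk_mul_of_mem _ (unip_intCast_mem _)

lemma unip_smul_dil_smul_pastSeq (hb : 0 < b) (L : ℕ) (a : Fin b) (d : ℕ → Fin b) (j : ℕ) :
    unip ((a : ℕ) : ℝ) • dil b • pastSeq L d j = pastSeq (L + 1) (seqCons a d) j := by
  have h := dil_zpow_mul_unip hb 1 (pastInt L d)
  rw [zpow_one, zpow_one] at h
  have e : ((L + 1 : ℕ) : ℤ) - j = 1 + ((L : ℤ) - j) := by push_cast; ring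
  have e2 : (pastInt (L + 1) (seqCons a d) : ℝ) = ((a : ℕ) : ℝ) + b * pastInt L d := by
    rw [pastInt_seqCons]
    push_cast
    rfl
  rw [pastSeq, pastSeq, LatticeSpace.smul_mk, LatticeSpace.smul_mk, e, e2, zpow_add, zpow_one,
    unip_add, ← mul_assoc (dil b), h, mul_assoc, mul_assoc]

lemma leftShift_withPast (hb : 0 < b) (L : ℕ) (p : (ℕ → Fin b) × (ℕ → Fin b)) :
    leftShift (withPast (L + 1) p) = withPast L p :=
  congrArg (fun v : ℕ → LatticeSpace => (((p.1, v), p.2) : PastState b × (ℕ → Fin b)))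
    (funext fun j => pastSeq_succ_succ hb L p.1 j)

lemma backMap_fwdMap (y : PastState b × (ℕ → Fin b)) : backMap (fwdMap y) = y := by
  obtain ⟨⟨d, v⟩, f⟩ := y
  refine Prod.ext (Prod.ext rfl (funext fun j => ?_)) ?_
  · change (dil b)⁻¹ • unip (-((f 0 : ℕ) : ℝ)) • unip ((f 0 : ℕ) : ℝ) • dil b • v j = v j
    rw [unip_neg, inv_smul_smul, inv_smul_smul]
  · funext k
    cases k <;> rfl

lemma fwdMap_withPast (hb : 0 < b) (L : ℕ) (p : (ℕ → Fin b) × (ℕ → Fin b)) :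
    fwdMap (withPast L p) = withPast (L + 1) (fwdShift p) :=
  congrArg (fun v : ℕ → LatticeSpace =>
      (((seqCons (p.2 0) p.1, v), seqTail p.2) : PastState b × (ℕ → Fin b)))
    (funext fun j => unip_smul_dil_smul_pastSeq hb L (p.2 0) p.1 j)

lemma continuous_pastInt (L : ℕ) : Continuous fun d : ℕ → Fin b => ((pastInt L d : ℕ) : ℝ) := by
  simp only [pastInt, Nat.cast_sum, Nat.cast_mul]
  refine continuous_finsetSum _ fun i _ => Continuous.mul ?_ continuous_const
  exact (continuous_of_discreteTopology (f := fun a : Fin b => ((a : ℕ) : ℝ))).comp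
    (continuous_apply i)

lemma continuous_withPast (L : ℕ) :
    Continuous (withPast L : (ℕ → Fin b) × (ℕ → Fin b) → PastState b × (ℕ → Fin b)) := by
  refine (continuous_fst.prodMk (continuous_pi fun j => ?_)).prodMk continuous_snd
  have h1 : Continuous fun p : (ℕ → Fin b) × (ℕ → Fin b) => ((pastInt L p.1 : ℕ) : ℝ) :=
    (continuous_pastInt L).comp continuous_fst
  exact continuous_unipSmul.comp
    (h1.prodMk (continuous_const (y := LatticeSpace.mk (dil b ^ ((L : ℤ) - j)))))

lemma continuous_fwdMap :
    Continuous (fwdMap : PastState b × (ℕ → Fin b) → PastState b × (ℕ → Fin b)) := by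
  have h0 : Continuous fun y : PastState b × (ℕ → Fin b) => y.2 0 :=
    (continuous_apply 0).comp continuous_snd
  have h1 : Continuous fun y : PastState b × (ℕ → Fin b) => ((y.2 0 : ℕ) : ℝ) :=
    (continuous_of_discreteTopology (f := fun a : Fin b => ((a : ℕ) : ℝ))).comp h0
  refine ((continuous_seqCons.comp (h0.prodMk (continuous_fst.comp continuous_fst))).prodMk
    (continuous_pi fun j => ?_)).prodMk (continuous_seqTail.comp continuous_snd)
  have h2 : Continuous fun y : PastState b × (ℕ → Fin b) => y.1.2 j :=
    (continuous_apply j).comp (continuous_snd.comp continuous_fst)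
  have h3 : Continuous fun y : PastState b × (ℕ → Fin b) => dil b • y.1.2 j :=
    (continuous_const_smul (dil b)).comp h2
  have h4 : Continuous fun y : PastState b × (ℕ → Fin b) =>
      unipSmul (((y.2 0 : ℕ) : ℝ), dil b • y.1.2 j) := continuous_unipSmul.comp (h1.prodMk h3)
  exact h4

lemma continuous_leftShift :
    Continuous (leftShift : PastState b × (ℕ → Fin b) → PastState b × (ℕ → Fin b)) := by
  refine ((continuous_fst.comp continuous_fst).prodMk (continuous_pi fun j => ?_)).prodMk
    continuous_snd
  exact (continuous_apply (j + 1)).comp (continuous_snd.comp continuous_fst)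

lemma ofDigits_add_pastInt (hb : 0 < b) (L : ℕ) (p : (ℕ → Fin b) × (ℕ → Fin b)) :
    Real.ofDigits (fwdShift^[L] p).2 + pastInt L (fwdShift^[L] p).1 =
      (b : ℝ) ^ L * Real.ofDigits p.2 := by
  induction L with
  | zero => simp [pastInt]
  | succ L ih =>
    rw [Function.iterate_succ_apply']
    set q := fwdShift^[L] p
    have h := ofDigits_eq_head hb q.2
    change Real.ofDigits (seqTail q.2) + (pastInt (L + 1) (seqCons (q.2 0) q.1) : ℕ) = _
    rw [pastInt_seqCons, pow_succ]
    push_cast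
    linear_combination (b : ℝ) * ih - h

lemma latSeq_withPast_iterate (hb : 0 < b) (L : ℕ) (p : (ℕ → Fin b) × (ℕ → Fin b)) (j : ℕ) :
    latSeq (withPast L (fwdShift^[L] p)) j =
      LatticeSpace.mk (dil b ^ (L : ℤ) * (unip (Real.ofDigits p.2) * dil b ^ (-(j : ℤ)))) := by
  change unip (Real.ofDigits (fwdShift^[L] p).2) • pastSeq L (fwdShift^[L] p).1 j = _
  rw [pastSeq, LatticeSpace.smul_mk, ← mul_assoc, ← unip_add, ofDigits_add_pastInt hb,
    ← mul_assoc, dil_zpow_mul_unip hb, zpow_natCast, mul_assoc, sub_eq_add_neg, zpow_add,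
    zpow_natCast]

lemma le_sqLength_of_mem_badlyApproximable (hb : 1 ≤ b) {ε x : ℝ}
    (hx : x ∈ badlyApproximable ε) (m j : ℕ) {p q : ℤ} (hpq : p ≠ 0 ∨ q ≠ 0) :
    ((b : ℝ) ^ j)⁻¹ * min 1 (2 * ε) ≤
      sqLength (dil b ^ (m : ℤ) * (unip x * dil b ^ (-(j : ℤ)))) p q := by
  have hb0 : (0 : ℝ) < b := by exact_mod_cast hb
  have hj : (0 : ℝ) < (b : ℝ) ^ j := by positivity
  have hm : (0 : ℝ) < (b : ℝ) ^ m := by positivity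
  set a := Real.exp (((-(j : ℤ) : ℤ) : ℝ) * (Real.log b / 2)) with ha
  have ha2 : a * a = ((b : ℝ) ^ j)⁻¹ := by
    rw [ha, exp_mul_log_half hb, _root_.zpow_neg, zpow_natCast]
  have ha0 : 0 < a := Real.exp_pos _
  rw [sqLength_dil_unip hb, dil_zpow, zpow_natCast]
  have e00 : diagMat (((-(j : ℤ) : ℤ) : ℝ) * (Real.log b / 2)) 0 0 = a := rfl
  have e01 : diagMat (((-(j : ℤ) : ℤ) : ℝ) * (Real.log b / 2)) 0 1 = 0 := rfl
  have e10 : diagMat (((-(j : ℤ) : ℤ) : ℝ) * (Real.log b / 2)) 1 0 = 0 := rfl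
  have e11 : diagMat (((-(j : ℤ) : ℤ) : ℝ) * (Real.log b / 2)) 1 1 = a⁻¹ := by
    rw [ha, ← Real.exp_neg]; rfl
  rw [e00, e01, e10, e11]
  have hja : (b : ℝ) ^ j = a⁻¹ * a⁻¹ := by
    rw [← mul_inv, ha2, inv_inv]
  by_cases hq : q = 0
  · have hp : p ≠ 0 := by tauto
    have hp2 : (1 : ℝ) ≤ (p : ℝ) ^ 2 := by
      have : 1 ≤ p ^ 2 := by
        have := sq_pos_of_ne_zero hp
        omega
      exact_mod_cast this
    have hm1 : (1 : ℝ) ≤ (b : ℝ) ^ m := one_le_pow₀ (by exact_mod_cast hb)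
    subst hq
    have : (b : ℝ) ^ m * (a * (p : ℝ) + 0 * ((0 : ℤ) : ℝ) + x * (0 * (p : ℝ) + a⁻¹ * ((0 : ℤ) : ℝ))) ^ 2 +
        ((b : ℝ) ^ m)⁻¹ * (0 * (p : ℝ) + a⁻¹ * ((0 : ℤ) : ℝ)) ^ 2 = (a * a) * ((b : ℝ) ^ m * (p : ℝ) ^ 2) := by
      simp; ring
    rw [this, ha2]
    refine mul_le_mul_of_nonneg_left ((min_le_left _ _).trans ?_) (by positivity)
    nlinarith
  · have hqn : 0 < q.natAbs := Int.natAbs_pos.2 hq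
    have hK : 0 < b ^ j * q.natAbs := by positivity
    have hq0 : (0 : ℝ) < |(q : ℝ)| := by positivity
    have hcast : ((b ^ j * q.natAbs : ℕ) : ℝ) = (b : ℝ) ^ j * |(q : ℝ)| := by
      push_cast
      rw [Nat.cast_natAbs, Int.cast_abs]
    have hbad : ε / ((b : ℝ) ^ j * |(q : ℝ)|) ≤ |(p : ℝ) + x * ((b : ℝ) ^ j * q)| := by
      rcases le_or_gt 0 q with h | h
      · have h2 := hx (-p) _ hK
        rw [hcast] at h2
        have hqr : (0 : ℝ) ≤ q := by exact_mod_cast h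
        refine h2.trans_eq ?_
        rw [abs_of_nonneg hqr]
        push_cast
        congr 1; ring
      · have h2 := hx p _ hK
        rw [hcast] at h2
        have hqr : (q : ℝ) < 0 := by exact_mod_cast h
        refine h2.trans_eq ?_
        rw [abs_of_neg hqr, ← abs_neg]
        congr 1; ring
    set A := |(p : ℝ) + x * ((b : ℝ) ^ j * q)| with hA
    have hprod : ε ≤ A * ((b : ℝ) ^ j * |(q : ℝ)|) := (div_le_iff₀ (by positivity)).1 hbad
    have e1 : (b : ℝ) ^ m * (a * (p : ℝ) + 0 * (q : ℝ) + x * (0 * (p : ℝ) + a⁻¹ * (q : ℝ))) ^ 2 +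
        ((b : ℝ) ^ m)⁻¹ * (0 * (p : ℝ) + a⁻¹ * (q : ℝ)) ^ 2 =
        ((b : ℝ) ^ j)⁻¹ * ((b : ℝ) ^ m * A ^ 2 +
          ((b : ℝ) ^ m)⁻¹ * ((b : ℝ) ^ j * |(q : ℝ)|) ^ 2) := by
      rw [hA, sq_abs, mul_pow, sq_abs, ← ha2, hja]
      field_simp
      ring
    rw [e1]
    refine mul_le_mul_of_nonneg_left ((min_le_right _ _).trans ?_) (by positivity)
    set B := (b : ℝ) ^ j * |(q : ℝ)|
    have e2 : (b : ℝ) ^ m * A ^ 2 + ((b : ℝ) ^ m)⁻¹ * B ^ 2 - 2 * (A * B) =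
        ((b : ℝ) ^ m)⁻¹ * ((b : ℝ) ^ m * A - B) ^ 2 := by
      field_simp
      ring
    have e3 : 0 ≤ ((b : ℝ) ^ m)⁻¹ * ((b : ℝ) ^ m * A - B) ^ 2 := by positivity
    linarith

/-- The thickness of the past lattices attached to a badly approximable number. -/
noncomputable def pastThickness (b : ℕ) (ε : ℝ) (j : ℕ) : ℝ := ((b : ℝ) ^ j)⁻¹ * min 1 (2 * ε)

lemma pastThickness_pos (hb : 0 < b) {ε : ℝ} (hε : 0 < ε) (j : ℕ) : 0 < pastThickness b ε j := by
  have : (0 : ℝ) < b := by exact_mod_cast hb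
  rw [pastThickness]
  positivity

lemma latSeq_withPast_iterate_mem (hb : 0 < b) {ε : ℝ}
    {p : (ℕ → Fin b) × (ℕ → Fin b)} (hp : Real.ofDigits p.2 ∈ badlyApproximable ε) (L j : ℕ) :
    latSeq (withPast L (fwdShift^[L] p)) j ∈ forwardThick b (pastThickness b ε j) := by
  intro k
  rw [latSeq_withPast_iterate hb, LatticeSpace.smul_mk, ← mul_assoc, ← zpow_natCast, ← zpow_add]
  rw [mk_mem_thick_iff]
  intro p' q' h
  have := le_sqLength_of_mem_badlyApproximable hb hp (k + L) j h
  rw [Nat.cast_add] at this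
  exact this

end PastLattices

section LimitDisintegration

open Topology LatticeSpace ProbabilityTheory BoundedContinuousFunction

variable {b : ℕ}

lemma measurable_withPast (L : ℕ) :
    Measurable (withPast L : (ℕ → Fin b) × (ℕ → Fin b) → PastState b × (ℕ → Fin b)) :=
  (continuous_withPast L).measurable

lemma integral_withPast_mul (L : ℕ) {α : Measure (ℕ → Fin b)} [IsProbabilityMeasure α]
    {κ : Kernel (ℕ → Fin b) (ℕ → Fin b)} [IsMarkovKernel κ] (φ : PastState b →ᵇ ℝ)
    (h : (ℕ → Fin b) →ᵇ ℝ) :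
    ∫ y, φ y.1 * h y.2 ∂((α ⊗ₘ κ).map (withPast L)) =
      ∫ d, φ (d, pastSeq L d) * ∫ f, h f ∂(κ d) ∂α := by
  have hc : Continuous fun y : PastState b × (ℕ → Fin b) => φ y.1 * h y.2 :=
    (φ.continuous.comp continuous_fst).mul (h.continuous.comp continuous_snd)
  have hb : ∀ y : PastState b × (ℕ → Fin b), ‖φ y.1 * h y.2‖ ≤ ‖φ‖ * ‖h‖ := fun y => by
    rw [norm_mul]
    gcongr
    exacts [φ.norm_coe_le_norm _, h.norm_coe_le_norm _]
  rw [integral_map (measurable_withPast L).aemeasurable hc.aestronglyMeasurable,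
    Measure.integral_compProd (f := fun p => φ (withPast L p).1 * h (withPast L p).2)
      (Integrable.of_bound (hc.comp (continuous_withPast L)).aestronglyMeasurable (‖φ‖ * ‖h‖)
        (Eventually.of_forall fun p => hb _))]
  refine integral_congr_ae (Eventually.of_forall fun d => ?_)
  exact integral_const_mul (φ (d, pastSeq L d)) fun f => h f

lemma abs_integral_kernel_le {κ : Kernel (ℕ → Fin b) (ℕ → Fin b)} [IsMarkovKernel κ]
    (h : (ℕ → Fin b) →ᵇ ℝ) (d : ℕ → Fin b) : ‖∫ f, h f ∂(κ d)‖ ≤ ‖h‖ :=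
  h.norm_integral_le_norm _

lemma stronglyMeasurable_integral_kernel {κ : Kernel (ℕ → Fin b) (ℕ → Fin b)} [IsMarkovKernel κ]
    (h : (ℕ → Fin b) →ᵇ ℝ) : StronglyMeasurable fun d => ∫ f, h f ∂(κ d) :=
  h.continuous.stronglyMeasurable.integral_kernel

lemma map_past_eq_of_cesaro_limit {α : Measure (ℕ → Fin b)} [IsProbabilityMeasure α]
    {κ : Kernel (ℕ → Fin b) (ℕ → Fin b)} [IsMarkovKernel κ]
    {ρ : Measure (PastState b × (ℕ → Fin b))} [IsProbabilityMeasure ρ] {l : Filter ℕ} [l.NeBot]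
    (hlim : ∀ f : PastState b × (ℕ → Fin b) →ᵇ ℝ, Tendsto (fun N : ℕ => ((N : ℝ) + 1)⁻¹ *
      ∑ L ∈ Finset.range (N + 1), ∫ x, f x ∂((α ⊗ₘ κ).map (withPast L))) l (𝓝 (∫ x, f x ∂ρ))) :
    ρ.map (fun y => y.1.1) = α := by
  have hc : Continuous fun y : PastState b × (ℕ → Fin b) => y.1.1 :=
    continuous_fst.comp continuous_fst
  have : IsProbabilityMeasure (ρ.map fun y => y.1.1) :=
    Measure.isProbabilityMeasure_map hc.aemeasurable
  refine ext_of_forall_integral_eq_of_IsFiniteMeasure fun f => ?_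
  rw [integral_map hc.aemeasurable f.continuous.aestronglyMeasurable]
  refine tendsto_nhds_unique (hlim (f.compContinuous ⟨_, hc⟩))
    (tendsto_const_nhds.congr fun N => ?_)
  have h3 : ∀ L, ∫ x, (f.compContinuous ⟨_, hc⟩) x ∂((α ⊗ₘ κ).map (withPast L)) = ∫ d, f d ∂α := by
    intro L
    rw [integral_map (measurable_withPast L).aemeasurable
      (f.compContinuous ⟨_, hc⟩).continuous.aestronglyMeasurable]
    have h4 : (α ⊗ₘ κ).map Prod.fst = α := Measure.fst_compProd _ _
    conv_rhs => rw [← h4, integral_map measurable_fst.aemeasurable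
      f.continuous.aestronglyMeasurable]
    rfl
  rw [Finset.sum_congr rfl fun L _ => h3 L]
  have hpos : (0 : ℝ) < N + 1 := by positivity
  simp
  field_simp

/-- The conditional law of the future given the past survives in Cesàro limits, since it only
depends on the digits of the past, whose law does not change along the sequence. -/
theorem eq_jointLaw_of_cesaro_limit {α : Measure (ℕ → Fin b)} [IsProbabilityMeasure α]
    {κ : Kernel (ℕ → Fin b) (ℕ → Fin b)} [IsMarkovKernel κ]
    {ρ : Measure (PastState b × (ℕ → Fin b))} [IsProbabilityMeasure ρ] {l : Filter ℕ} [l.NeBot]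
    (hlim : ∀ f : PastState b × (ℕ → Fin b) →ᵇ ℝ, Tendsto (fun N : ℕ => ((N : ℝ) + 1)⁻¹ *
      ∑ L ∈ Finset.range (N + 1), ∫ x, f x ∂((α ⊗ₘ κ).map (withPast L))) l (𝓝 (∫ x, f x ∂ρ))) :
    ρ = jointLaw ρ.fst κ := by
  have hρ := map_past_eq_of_cesaro_limit hlim
  refine Measure.ext_of_integral_mul_boundedContinuousFunction fun φ h => ?_
  set H : (ℕ → Fin b) → ℝ := fun d => ∫ f, h f ∂(κ d) with hH
  have hHm : StronglyMeasurable H := stronglyMeasurable_integral_kernel h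
  have hHi : Integrable H α := Integrable.of_bound hHm.aestronglyMeasurable ‖h‖
    (Eventually.of_forall fun d => abs_integral_kernel_le h d)
  have hm11 : Measurable fun y : PastState b × (ℕ → Fin b) => y.1.1 :=
    measurable_fst.comp measurable_fst
  have hc : Continuous fun y : PastState b × (ℕ → Fin b) => φ y.1 * h y.2 :=
    (φ.continuous.comp continuous_fst).mul (h.continuous.comp continuous_snd)
  have hb : ∀ y : PastState b × (ℕ → Fin b), ‖φ y.1 * h y.2‖ ≤ ‖φ‖ * ‖h‖ := fun y => by
    rw [norm_mul]
    gcongr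
    exacts [φ.norm_coe_le_norm _, h.norm_coe_le_norm _]
  have e1 : ∫ y, φ y.1 * h y.2 ∂(jointLaw ρ.fst κ) = ∫ y, φ y.1 * H y.1.1 ∂ρ := by
    have hm : StronglyMeasurable fun u : PastState b => φ u * H u.1 :=
      φ.continuous.stronglyMeasurable.mul (hHm.comp_measurable measurable_fst)
    rw [Measure.integral_compProd (Integrable.of_bound hc.aestronglyMeasurable (‖φ‖ * ‖h‖)
      (Eventually.of_forall hb)), Measure.fst]
    have e : ∀ u : PastState b,
        ∫ f, φ u * h f ∂(κ.prodMkRight (ℕ → LatticeSpace) u) = φ u * H u.1 := fun u =>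
      integral_const_mul _ _
    simp only [e]
    exact integral_map measurable_fst.aemeasurable hm.aestronglyMeasurable
  rw [e1]
  refine eq_of_forall_dist_le fun ε hε => ?_
  obtain ⟨G, hG, hGi⟩ := hHi.exists_boundedContinuous_integral_sub_le
    (ε := ε / (2 * (‖φ‖ + 1))) (by positivity)
  set δ := ε / (2 * (‖φ‖ + 1)) with hδ
  have hδε : 2 * (‖φ‖ * δ) ≤ ε := by
    have : 2 * ((‖φ‖ + 1) * δ) = ε := by rw [hδ]; field_simp
    have h0 : 0 ≤ δ := by positivity
    nlinarith
  have hcG : Continuous fun y : PastState b × (ℕ → Fin b) => φ y.1 * G y.1.1 :=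
    (φ.continuous.comp continuous_fst).mul
      (G.continuous.comp (continuous_fst.comp continuous_fst))
  have hbG : ∀ y : PastState b × (ℕ → Fin b), ‖φ y.1 * G y.1.1‖ ≤ ‖φ‖ * ‖G‖ := fun y => by
    rw [norm_mul]
    gcongr
    exacts [φ.norm_coe_le_norm _, G.norm_coe_le_norm _]
  have hi1 : ∀ (P : Measure (PastState b × (ℕ → Fin b))) [IsProbabilityMeasure P],
      Integrable (fun y => φ y.1 * h y.2) P := fun P _ =>
    Integrable.of_bound hc.aestronglyMeasurable _ (Eventually.of_forall hb)
  have hi2 : ∀ (P : Measure (PastState b × (ℕ → Fin b))) [IsProbabilityMeasure P],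
      Integrable (fun y => φ y.1 * G y.1.1) P := fun P _ =>
    Integrable.of_bound hcG.aestronglyMeasurable _ (Eventually.of_forall hbG)
  have hHG : Integrable (fun d => ‖H d - G d‖) α := (hHi.sub hGi).norm
  have k1 : ∀ L, ‖∫ y, (φ y.1 * h y.2 - φ y.1 * G y.1.1) ∂((α ⊗ₘ κ).map (withPast L))‖ ≤
      ‖φ‖ * δ := by
    intro L
    have : IsProbabilityMeasure ((α ⊗ₘ κ).map (withPast L)) :=
      Measure.isProbabilityMeasure_map (measurable_withPast L).aemeasurable
    have hmp : Measurable fun d : ℕ → Fin b => ((d, pastSeq L d) : PastState b) := by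
      have := (measurable_withPast (b := b) L).fst
      exact this.comp (measurable_id.prodMk measurable_id)
    have hφm : AEStronglyMeasurable (fun d : ℕ → Fin b => φ (d, pastSeq L d)) α :=
      (φ.continuous.stronglyMeasurable.comp_measurable hmp).aestronglyMeasurable
    have hφb : ∀ᵐ d ∂α, ‖φ (d, pastSeq L d)‖ ≤ ‖φ‖ :=
      Eventually.of_forall fun d => φ.norm_coe_le_norm _
    rw [integral_sub (hi1 _) (hi2 _), integral_withPast_mul]
    have e2 : ∫ y, φ y.1 * G y.1.1 ∂((α ⊗ₘ κ).map (withPast L)) =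
        ∫ d, φ (d, pastSeq L d) * G d ∂α := by
      rw [integral_map (measurable_withPast L).aemeasurable hcG.aestronglyMeasurable]
      have h4 : (α ⊗ₘ κ).map Prod.fst = α := Measure.fst_compProd _ _
      conv_rhs => rw [← h4]
      rw [integral_map measurable_fst.aemeasurable]
      · rfl
      · rw [h4]
        exact hφm.mul G.continuous.aestronglyMeasurable
    rw [e2, ← integral_sub (hHi.bdd_mul hφm hφb) (hGi.bdd_mul hφm hφb)]
    refine (norm_integral_le_integral_norm _).trans ?_
    refine (integral_mono_of_nonneg (Eventually.of_forall fun d => norm_nonneg _)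
      (hHG.const_mul ‖φ‖) (Eventually.of_forall fun d => ?_)).trans ?_
    · dsimp only
      rw [← mul_sub, norm_mul]
      gcongr
      exact φ.norm_coe_le_norm _
    · rw [integral_const_mul]
      gcongr
  have k2 : ‖∫ y, (φ y.1 * h y.2 - φ y.1 * G y.1.1) ∂ρ‖ ≤ ‖φ‖ * δ := by
    have hl := hlim (BoundedContinuousFunction.ofNormedAddCommGroup
      (fun y : PastState b × (ℕ → Fin b) => φ y.1 * h y.2 - φ y.1 * G y.1.1) (hc.sub hcG)
      (‖φ‖ * ‖h‖ + ‖φ‖ * ‖G‖) fun y => (norm_sub_le _ _).trans (add_le_add (hb y) (hbG y)))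
    refine le_of_tendsto hl.norm (Eventually.of_forall fun N => ?_)
    have hpos : (0 : ℝ) < N + 1 := by positivity
    rw [norm_mul, norm_inv, Real.norm_of_nonneg hpos.le, inv_mul_le_iff₀ hpos]
    refine (norm_sum_le _ _).trans ?_
    refine (Finset.sum_le_card_nsmul _ _ (‖φ‖ * δ) fun L _ => k1 L).trans ?_
    simp
  have hφm : AEStronglyMeasurable (fun y : PastState b × (ℕ → Fin b) => φ y.1) ρ :=
    (φ.continuous.comp continuous_fst).aestronglyMeasurable
  have hφb : ∀ᵐ y ∂ρ, ‖φ y.1‖ ≤ ‖φ‖ := Eventually.of_forall fun y => φ.norm_coe_le_norm _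
  have hHρ : Integrable (fun y : PastState b × (ℕ → Fin b) => H y.1.1) ρ := by
    refine Integrable.comp_measurable (g := H) ?_ hm11
    rwa [hρ]
  have hHG' : ∫ y, ‖H y.1.1 - G y.1.1‖ ∂ρ ≤ δ := by
    refine le_trans (le_of_eq ?_) hG
    conv_rhs => rw [← hρ]
    rw [integral_map hm11.aemeasurable]
    rw [hρ]
    exact hHG.aestronglyMeasurable
  have hHGi : Integrable (fun y : PastState b × (ℕ → Fin b) => ‖H y.1.1 - G y.1.1‖) ρ := by
    refine Integrable.comp_measurable (g := fun d => ‖H d - G d‖) ?_ hm11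
    rwa [hρ]
  have k3 : ‖∫ y, (φ y.1 * G y.1.1 - φ y.1 * H y.1.1) ∂ρ‖ ≤ ‖φ‖ * δ := by
    refine (norm_integral_le_integral_norm _).trans ?_
    refine (integral_mono_of_nonneg (Eventually.of_forall fun d => norm_nonneg _)
      (hHGi.const_mul ‖φ‖) (Eventually.of_forall fun y => ?_)).trans ?_
    · dsimp only
      rw [← mul_sub, norm_mul, norm_sub_rev]
      gcongr
      exact φ.norm_coe_le_norm _
    · rw [integral_const_mul]
      gcongr
  rw [integral_sub (hi1 _) (hi2 _)] at k2
  rw [integral_sub (hi2 _) (hHρ.bdd_mul hφm hφb)] at k3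
  rw [dist_eq_norm]
  calc _ ≤ _ := norm_sub_le_norm_sub_add_norm_sub _ (∫ y, φ y.1 * G y.1.1 ∂ρ) _
    _ ≤ _ := by linarith

end LimitDisintegration

section LimitingArgument

open Topology LatticeSpace ProbabilityTheory BoundedContinuousFunction

variable {b : ℕ}

lemma continuous_latSeq_apply (j : ℕ) :
    Continuous fun y : PastState b × (ℕ → Fin b) => latSeq y j := by
  have h1 : Continuous fun y : PastState b × (ℕ → Fin b) => Real.ofDigits y.2 :=
    Real.continuous_ofDigits.comp continuous_snd
  have h2 : Continuous fun y : PastState b × (ℕ → Fin b) => y.1.2 j :=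
    (continuous_apply j).comp (continuous_snd.comp continuous_fst)
  have h3 : Continuous fun y : PastState b × (ℕ → Fin b) =>
      unipSmul (Real.ofDigits y.2, y.1.2 j) := continuous_unipSmul.comp (h1.prodMk h2)
  exact h3

/-- States all of whose lattices have a forward orbit of the prescribed thickness. -/
def thickStates (b : ℕ) (ε : ℝ) : Set (PastState b × (ℕ → Fin b)) :=
  {y | ∀ j, latSeq y j ∈ forwardThick b (pastThickness b ε j)}

lemma isClosed_thickStates (ε : ℝ) : IsClosed (thickStates b ε) := by
  have : thickStates b ε =
      ⋂ j, (fun y => latSeq y j) ⁻¹' forwardThick b (pastThickness b ε j) := by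
    ext y
    simp [thickStates]
  rw [this]
  exact isClosed_iInter fun j => (isClosed_forwardThick b _).preimage (continuous_latSeq_apply j)

lemma exists_isCompact_thickStates_subset (hb : 0 < b) {ε : ℝ} (hε : 0 < ε) :
    ∃ K : Set (PastState b × (ℕ → Fin b)), IsCompact K ∧ thickStates b ε ⊆ K := by
  set C : ℕ → Set LatticeSpace := fun j =>
    unipSmul '' (Set.Icc (-1) 0 ×ˢ forwardThick b (pastThickness b ε j))
  have hC : ∀ j, IsCompact (C j) := fun j =>
    (isCompact_Icc.prod (isCompact_forwardThick b (pastThickness_pos hb hε j))).image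
      continuous_unipSmul
  refine ⟨((Set.univ : Set (ℕ → Fin b)) ×ˢ Set.univ.pi C) ×ˢ (Set.univ : Set (ℕ → Fin b)),
    (isCompact_univ.prod (isCompact_univ_pi hC)).prod isCompact_univ, fun y hy => ?_⟩
  refine ⟨⟨trivial, fun j _ => ?_⟩, trivial⟩
  refine ⟨(-Real.ofDigits y.2, latSeq y j), ⟨⟨?_, ?_⟩, hy j⟩, ?_⟩
  · exact neg_le_neg (Real.ofDigits_le_one _)
  · exact neg_nonpos.2 (Real.ofDigits_nonneg _)
  · change unip (-Real.ofDigits y.2) • unip (Real.ofDigits y.2) • y.1.2 j = y.1.2 j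
    rw [unip_neg, inv_smul_smul]

variable {ν : Measure ((ℕ → Fin b) × (ℕ → Fin b))} [IsProbabilityMeasure ν]

lemma map_withPast_compl_thickStates_le (hb : 0 < b) (hν : MeasurePreserving fwdShift ν ν) {ε : ℝ}
    (L : ℕ) : ν.map (withPast L) (thickStates b ε)ᶜ ≤
      ν {p | Real.ofDigits p.2 ∉ badlyApproximable ε} := by
  have hG : MeasurableSet (thickStates b ε)ᶜ := (isClosed_thickStates ε).measurableSet.compl
  rw [Measure.map_apply (measurable_withPast L) hG,
    ← (hν.iterate L).measure_preimage ((measurable_withPast L) hG).nullMeasurableSet]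
  refine measure_mono fun p hp h => hp fun j => ?_
  exact latSeq_withPast_iterate_mem hb h L j

theorem false_of_badlyApproximable (hb : 2 ≤ b) (hν : MeasurePreserving fwdShift ν ν)
    {κ : Kernel (ℕ → Fin b) (ℕ → Fin b)} [IsMarkovKernel κ] (hκ : ν.fst ⊗ₘ κ = ν)
    (hna : ∀ᵐ d ∂ν.fst, ∀ x : ℝ, κ d {f | Real.ofDigits f = x} = 0)
    (hbad : ∀ η : ENNReal, 0 < η →
      ∃ ε : ℝ, 0 < ε ∧ ν {p | Real.ofDigits p.2 ∉ badlyApproximable ε} ≤ η) : False := by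
  have hb0 : 0 < b := by omega
  set P : ℕ → Measure (PastState b × (ℕ → Fin b)) := fun L =>
    (ν.fst ⊗ₘ κ).map (withPast L) with hP
  have hPν : ∀ L, P L = ν.map (withPast L) := fun L => by rw [hP]; dsimp only; rw [hκ]
  have hprob : ∀ L, IsProbabilityMeasure (P L) := fun L =>
    Measure.isProbabilityMeasure_map (measurable_withPast L).aemeasurable
  have hGle : ∀ (ε : ℝ) L, P L (thickStates b ε)ᶜ ≤
      ν {p | Real.ofDigits p.2 ∉ badlyApproximable ε} := fun ε L => by
    rw [hPν]
    exact map_withPast_compl_thickStates_le hb0 hν L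
  obtain ⟨ρ, l, hρ, hl0, hl, hlim, hclosed⟩ := exists_cesaro_limit P fun η hη => by
    obtain ⟨ε, hε, h⟩ := hbad η hη
    obtain ⟨K, hK, hGK⟩ := exists_isCompact_thickStates_subset hb0 hε
    exact ⟨K, hK, fun L => (measure_mono (Set.compl_subset_compl.2 hGK)).trans
      ((hGle ε L).trans h)⟩
  have hjoint : ρ = jointLaw ρ.fst κ := eq_jointLaw_of_cesaro_limit hlim
  have hF : MeasurePreserving leftShift ρ ρ := by
    refine ⟨continuous_leftShift.measurable,
      map_eq_of_cesaro_limit hl hlim continuous_leftShift (Or.inr fun L => ?_)⟩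
    rw [hP]
    dsimp only
    rw [Measure.map_map continuous_leftShift.measurable (measurable_withPast _)]
    congr 1
    exact funext fun p => leftShift_withPast hb0 L p
  have hfwd : ρ.map fwdMap = ρ := by
    refine map_eq_of_cesaro_limit hl hlim continuous_fwdMap (Or.inl fun L => ?_)
    rw [hPν, hPν, Measure.map_map continuous_fwdMap.measurable (measurable_withPast _)]
    conv_rhs => rw [← hν.map_eq]
    rw [Measure.map_map (measurable_withPast _) measurable_fwdShift]
    congr 1
    exact funext fun p => fwdMap_withPast hb0 L p
  have hB : MeasurePreserving backMap ρ ρ := by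
    refine ⟨measurable_backMap, ?_⟩
    conv_lhs => rw [← hfwd]
    rw [Measure.map_map measurable_backMap continuous_fwdMap.measurable]
    have e : backMap ∘ fwdMap = (id : PastState b × (ℕ → Fin b) → _) := funext backMap_fwdMap
    rw [e, Measure.map_id]
  have hQ : IsProbabilityMeasure ρ.fst := inferInstance
  refine resampling_contradiction (Q := ρ.fst) (κ := κ) hb (by rwa [← hjoint])
    (by rwa [← hjoint]) ?_ ?_ ?_
  · have h1 : ρ.fst.map Prod.fst = ν.fst := by
      rw [Measure.fst, Measure.map_map measurable_fst measurable_fst]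
      exact map_past_eq_of_cesaro_limit hlim
    rw [← h1] at hna
    exact ae_of_ae_map measurable_fst.aemeasurable hna
  · rw [ae_all_iff]
    intro i
    rw [ae_all_iff]
    intro k
    have hc : Continuous fun u : PastState b => (u.2 i, u.2 (i + k)) :=
      ((continuous_apply i).comp continuous_snd).prodMk
        ((continuous_apply (i + k)).comp continuous_snd)
    have hC : IsClosed {u : PastState b | heckeRel b k (u.2 i) (u.2 (i + k))} :=
      (isClosed_heckeRel hb0 k).preimage hc
    rw [Measure.fst, ae_map_iff measurable_fst.aemeasurable hC.measurableSet]
    have hC' := hC.preimage (continuous_fst (X := PastState b) (Y := ℕ → Fin b))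
    have h1 := hclosed _ hC' 1 fun L => by
      rw [hP]
      dsimp only
      rw [Measure.map_apply (measurable_withPast L) hC'.measurableSet]
      have : withPast L ⁻¹' (Prod.fst ⁻¹' {u : PastState b | heckeRel b k (u.2 i) (u.2 (i + k))}) =
          Set.univ := Set.eq_univ_of_forall fun p => heckeRel_pastSeq L p.1 i k
      rw [this, measure_univ]
    have h2 : ρ (Prod.fst ⁻¹' {u : PastState b | heckeRel b k (u.2 i) (u.2 (i + k))}) = 1 :=
      le_antisymm prob_le_one h1
    exact (prob_compl_eq_zero_iff hC'.measurableSet).2 h2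
  · intro η hη
    obtain ⟨ε, hε, h⟩ := hbad (ENNReal.ofReal η) (by simpa using hη)
    refine ⟨pastThickness b ε 0, pastThickness_pos hb0 hε 0, ?_⟩
    rw [← hjoint]
    have hG := (isClosed_thickStates (b := b) ε)
    have h1 := hclosed _ hG (1 - ENNReal.ofReal η) fun L => by
      rw [tsub_le_iff_right]
      calc (1 : ENNReal) = P L (thickStates b ε) + P L (thickStates b ε)ᶜ := by
            rw [measure_add_measure_compl hG.measurableSet, measure_univ]
        _ ≤ _ := by
          gcongr
          exact (hGle ε L).trans h
    refine ENNReal.toReal_le_of_le_ofReal hη.le ?_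
    refine (measure_mono (t := (thickStates b ε)ᶜ) ?_).trans ?_
    · intro y hy h'
      exact (hy : latSeq y 0 ∉ forwardThick b (pastThickness b ε 0)) (h' 0)
    rw [prob_compl_eq_one_sub hG.measurableSet]
    rw [tsub_le_iff_left] at h1 ⊢
    rwa [add_comm]

end LimitingArgument

section WellApproximable

open Topology

lemma isClosed_badlyApproximable (ε : ℝ) : IsClosed (badlyApproximable ε) := by
  have : badlyApproximable ε =
      ⋂ (m : ℤ) (k : ℕ) (_ : 0 < k), {x : ℝ | ε / k ≤ |(k : ℝ) * x - m|} := by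
    ext x
    simp [badlyApproximable]
  rw [this]
  refine isClosed_iInter fun m => isClosed_iInter fun k => isClosed_iInter fun _ => ?_
  exact isClosed_le continuous_const (by fun_prop)

lemma badlyApproximable_anti {ε ε' : ℝ} (h : ε ≤ ε') :
    badlyApproximable ε' ⊆ badlyApproximable ε := fun x hx m k hk =>
  le_trans (by gcongr) (hx m k hk)

lemma not_isWA_iff {x : ℝ} : ¬ IsWA x ↔ ∃ i : ℕ, x ∈ badlyApproximable (1 / ((i : ℝ) + 1)) := by
  constructor
  · intro h
    simp only [IsWA] at h
    push Not at h
    obtain ⟨ε, hε, h⟩ := h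
    obtain ⟨i, hi⟩ := exists_nat_one_div_lt hε
    exact ⟨i, badlyApproximable_anti hi.le h⟩
  · rintro ⟨i, hi⟩ h
    obtain ⟨m, k, hk, hlt⟩ := h (1 / ((i : ℝ) + 1)) (by positivity)
    exact absurd hlt (hi m k hk).not_gt

lemma IsWA.of_fract_mul {n : ℕ} (hn : 0 < n) {x : ℝ} (h : IsWA (Int.fract ((n : ℝ) * x))) :
    IsWA x := by
  intro ε hε
  have hn' : (0 : ℝ) < n := by exact_mod_cast hn
  obtain ⟨m, k, hk, hlt⟩ := h (ε / n) (by positivity)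
  refine ⟨k * ⌊(n : ℝ) * x⌋ + m, k * n, by positivity, ?_⟩
  have hk' : (0 : ℝ) < k := by exact_mod_cast hk
  convert hlt using 1
  · rw [Int.fract]
    push_cast
    congr 1
    ring
  · push_cast
    field_simp

lemma measurableSet_isWA : MeasurableSet {x : ℝ | IsWA x} := by
  have : {x : ℝ | IsWA x}ᶜ = ⋃ i : ℕ, badlyApproximable (1 / ((i : ℝ) + 1)) := by
    ext x
    simp only [Set.mem_compl_iff, Set.mem_ofPred_eq, not_isWA_iff, Set.mem_iUnion]
  rw [← compl_compl {x : ℝ | IsWA x}, this]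
  exact (MeasurableSet.iUnion fun i => (isClosed_badlyApproximable _).measurableSet).compl

/-- If almost every point fails to be well approximable, then up to arbitrarily small measure all
points are badly approximable with a uniform constant. -/
lemma exists_measure_compl_badlyApproximable_le {μ : Measure ℝ} [IsProbabilityMeasure μ]
    (h : ∀ᵐ x ∂μ, ¬ IsWA x) {η : ENNReal} (hη : 0 < η) :
    ∃ ε : ℝ, 0 < ε ∧ μ (badlyApproximable ε)ᶜ ≤ η := by
  have hanti : Antitone fun i : ℕ => (badlyApproximable (1 / ((i : ℝ) + 1)))ᶜ := by
    intro i j hij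
    refine Set.compl_subset_compl.2 (badlyApproximable_anti ?_)
    exact Nat.one_div_le_one_div hij
  have hlim := tendsto_measure_iInter_atTop (μ := μ)
    (fun i : ℕ => (isClosed_badlyApproximable (1 / ((i : ℝ) + 1))).measurableSet.compl.nullMeasurableSet)
    hanti ⟨0, measure_ne_top _ _⟩
  have h0 : μ (⋂ i : ℕ, (badlyApproximable (1 / ((i : ℝ) + 1)))ᶜ) = 0 := by
    refine measure_mono_null (fun x hx => ?_) h
    simp only [Set.mem_iInter, Set.mem_compl_iff] at hx
    intro hw
    obtain ⟨i, hi⟩ := not_isWA_iff.1 hw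
    exact hx i hi
  rw [h0] at hlim
  obtain ⟨i, hi⟩ := (hlim.eventually (gt_mem_nhds hη)).exists
  exact ⟨1 / ((i : ℝ) + 1), by positivity, hi.le⟩

end WellApproximable

section DigitCoding

open Topology

variable {n : ℕ} [NeZero n]

lemma measurable_digits : Measurable fun x : ℝ => Real.digits x n := by
  refine measurable_pi_lambda _ fun i => ?_
  exact (measurable_of_countable (Fin.ofNat n)).comp
    (Nat.measurable_floor.comp (measurable_id.mul_const _))

lemma seqTail_digits {x : ℝ} (hx : 0 ≤ x) :
    seqTail (Real.digits x n) = Real.digits (Int.fract ((n : ℝ) * x)) n := by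
  funext i
  have hnx : 0 ≤ (n : ℝ) * x := by positivity
  have h1 : x * (n : ℝ) ^ (i + 1 + 1) =
      Int.fract ((n : ℝ) * x) * (n : ℝ) ^ (i + 1) + (⌊(n : ℝ) * x⌋₊ * n ^ (i + 1) : ℕ) := by
    have h2 : (⌊(n : ℝ) * x⌋₊ : ℝ) = (n : ℝ) * x - Int.fract ((n : ℝ) * x) := by
      rw [natCast_floor_eq_intCast_floor hnx, Int.self_sub_fract]
    push_cast
    rw [h2]
    ring
  have h3 : ⌊x * (n : ℝ) ^ (i + 1 + 1)⌋₊ =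
      ⌊Int.fract ((n : ℝ) * x) * (n : ℝ) ^ (i + 1)⌋₊ + ⌊(n : ℝ) * x⌋₊ * n ^ (i + 1) := by
    rw [h1, Nat.floor_add_natCast (mul_nonneg (Int.fract_nonneg _) (by positivity))]
  apply Fin.ext
  change ⌊x * (n : ℝ) ^ (i + 1 + 1)⌋₊ % n = ⌊Int.fract ((n : ℝ) * x) * (n : ℝ) ^ (i + 1)⌋₊ % n
  rw [h3, pow_succ n i, ← mul_assoc, Nat.add_mul_mod_self_right]

variable {μ : Measure ℝ} [IsProbabilityMeasure μ]

lemma measurePreserving_seqTail_digits (hsupp : ∀ᵐ x ∂μ, x ∈ Set.Ico (0 : ℝ) 1)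
    (hT : MeasurePreserving (fun x : ℝ => Int.fract ((n : ℝ) * x)) μ μ) :
    MeasurePreserving seqTail (μ.map fun x => Real.digits x n) (μ.map fun x => Real.digits x n) := by
  refine ⟨measurable_seqTail, ?_⟩
  rw [Measure.map_map measurable_seqTail measurable_digits]
  conv_rhs => rw [← hT.map_eq, Measure.map_map measurable_digits hT.measurable]
  refine Measure.map_congr ?_
  filter_upwards [hsupp] with x hx
  exact seqTail_digits hx.1

lemma eventually_measure_ball_le {X : Type*} [MetricSpace X] [MeasurableSpace X] {μ : Measure X}
    {κ : ℝ} (hκ : 0 < κ) {x : X}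
    (h : Tendsto (fun r : ℝ => Real.log (μ (Metric.ball x r)).toReal / Real.log r)
      (𝓝[>] 0) (𝓝 κ)) :
    ∀ᶠ r : ℝ in 𝓝[>] 0, (μ (Metric.ball x r)).toReal ≤ r ^ (κ / 2) := by
  have h1 : ∀ᶠ r : ℝ in 𝓝[>] 0, r < 1 :=
    mem_nhdsWithin_of_mem_nhds (gt_mem_nhds one_pos)
  filter_upwards [h.eventually (lt_mem_nhds (half_lt_self hκ)), h1, self_mem_nhdsWithin]
    with r hr hr1 hr0
  have hr0' : 0 < r := hr0
  rcases (ENNReal.toReal_nonneg (a := μ (Metric.ball x r))).eq_or_lt with h0 | h0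
  · rw [← h0]
    positivity
  · have hlog : Real.log r < 0 := Real.log_neg hr0' hr1
    rw [lt_div_iff_of_neg hlog] at hr
    rw [← Real.log_le_log_iff h0 (by positivity), Real.log_rpow hr0']
    exact hr.le

lemma two_mul_pow_inv_rpow_le (hn : 2 ≤ n) {κ : ℝ} (hκ : 0 < κ) {K : ℕ} (hK : 2 ≤ K) :
    (2 * ((n : ℝ) ^ K)⁻¹) ^ (κ / 2) ≤ ((n : ℝ) ^ (-(κ / 4))) ^ K := by
  have hn0 : (0 : ℝ) < n := by positivity
  have hn2 : (2 : ℝ) ≤ n := by exact_mod_cast hn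
  have e : ((n : ℝ) ^ (-(κ / 4))) ^ K = ((((n : ℝ) ^ K)⁻¹) ^ ((1 : ℝ) / 2)) ^ (κ / 2) := by
    rw [← Real.rpow_natCast, ← Real.rpow_mul hn0.le, ← Real.rpow_natCast, ← Real.rpow_neg hn0.le,
      ← Real.rpow_mul hn0.le, ← Real.rpow_mul hn0.le]
    congr 1
    ring
  rw [e]
  refine Real.rpow_le_rpow (by positivity) ?_ (by positivity)
  rw [← Real.sqrt_eq_rpow]
  refine Real.le_sqrt_of_sq_le ?_
  have h4 : (4 : ℝ) ≤ (n : ℝ) ^ K := by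
    calc (4 : ℝ) = 2 ^ 2 := by norm_num
      _ ≤ (n : ℝ) ^ 2 := by gcongr
      _ ≤ (n : ℝ) ^ K := pow_le_pow_right₀ (by linarith) hK
  have h5 : (0 : ℝ) < (n : ℝ) ^ K := by positivity
  rw [mul_pow, inv_pow, ← div_eq_mul_inv, div_le_iff₀ (by positivity), sq ((n : ℝ) ^ K),
    inv_mul_cancel_left₀ h5.ne']
  linarith

lemma measure_cyl_digits_le (hn : 2 ≤ n) (hsupp : ∀ᵐ x ∂μ, x ∈ Set.Ico (0 : ℝ) 1) {x : ℝ}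
    (hx : x ∈ Set.Ico (0 : ℝ) 1) (K : ℕ) :
    (μ.map fun x => Real.digits x n).real (cyl K (Real.digits x n)) ≤
      (μ (Metric.ball x (2 * ((n : ℝ) ^ K)⁻¹))).toReal := by
  have hn1 : 1 < n := by omega
  rw [measureReal_def, Measure.map_apply measurable_digits (measurableSet_cyl _ _)]
  refine ENNReal.toReal_mono (measure_ne_top _ _) (measure_mono_ae ?_)
  filter_upwards [hsupp] with y hy hyc
  have h1 := Real.abs_ofDigits_sub_ofDigits_le (n := K) hyc
  rw [Real.ofDigits_digits hn1 hx, Real.ofDigits_digits hn1 hy] at h1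
  have hpos : (0 : ℝ) < ((n : ℝ) ^ K)⁻¹ := by positivity
  change dist y x < _
  rw [Real.dist_eq]
  linarith

lemma tendsto_measure_cyl_digits (hn : 2 ≤ n) (hsupp : ∀ᵐ x ∂μ, x ∈ Set.Ico (0 : ℝ) 1) {κ : ℝ}
    (hκ : 0 < κ) (hdim : ExactDimensional μ κ) :
    Tendsto (fun K : ℕ => (μ.map fun x => Real.digits x n).real
      {f | ((n : ℝ) ^ (-(κ / 4))) ^ K < (μ.map fun x => Real.digits x n).real (cyl K f)})
      atTop (𝓝 0) := by
  have hm0 : IsProbabilityMeasure (μ.map fun x => Real.digits x n) :=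
    Measure.isProbabilityMeasure_map measurable_digits.aemeasurable
  have hA : ∀ K : ℕ, MeasurableSet
      {f | ((n : ℝ) ^ (-(κ / 4))) ^ K < (μ.map fun x => Real.digits x n).real (cyl K f)} :=
    fun K => measurableSet_cyl_large _ _ _
  have key : ∀ᵐ x ∂μ, ∀ᶠ K : ℕ in atTop,
      (μ.map fun x => Real.digits x n).real (cyl K (Real.digits x n)) ≤
        ((n : ℝ) ^ (-(κ / 4))) ^ K := by
    filter_upwards [hsupp, hdim] with x hx hxd
    have hr : Tendsto (fun K : ℕ => 2 * ((n : ℝ) ^ K)⁻¹) atTop (𝓝[>] 0) := by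
      refine tendsto_nhdsWithin_iff.2 ⟨?_, Eventually.of_forall fun K => ?_⟩
      · have h1 : Tendsto (fun K : ℕ => ((n : ℝ) ^ K)⁻¹) atTop (𝓝 0) :=
          (tendsto_pow_atTop_atTop_of_one_lt (by exact_mod_cast hn)).inv_tendsto_atTop
        simpa using h1.const_mul 2
      · have : (0 : ℝ) < n := by positivity
        exact Set.mem_Ioi.2 (by positivity)
    filter_upwards [hr.eventually (eventually_measure_ball_le hκ hxd), eventually_ge_atTop 2]
      with K hK hK2
    exact (measure_cyl_digits_le hn hsupp hx K).trans
      (hK.trans (two_mul_pow_inv_rpow_le hn hκ hK2))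
  have hlim := tendsto_measure_of_ae_tendsto_indicator_of_isFiniteMeasure atTop
    (μ := μ) (A := ∅) (As := fun K : ℕ => (fun x => Real.digits x n) ⁻¹'
      {f | ((n : ℝ) ^ (-(κ / 4))) ^ K < (μ.map fun x => Real.digits x n).real (cyl K f)})
    MeasurableSet.empty (fun K => measurable_digits (hA K)) (by
      filter_upwards [key] with x hx
      filter_upwards [hx] with K hK
      simpa using hK)
  rw [measure_empty] at hlim
  have h2 := (ENNReal.tendsto_toReal ENNReal.zero_ne_top).comp hlim
  refine h2.congr fun K => ?_
  rw [measureReal_def, Measure.map_apply measurable_digits (hA K)]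
  rfl

end DigitCoding

/-- if `μ` is a probability measure on the circle (identified with `[0,1)`)
which is invariant and ergodic under `x ↦ n·x mod 1` (`n ≥ 2`) and exact dimensional of
some dimension `κ > 0`, then `μ`-almost every `x` is well approximable. -/
theorem stmt0 (n : ℕ) (hn : 2 ≤ n) (μ : Measure ℝ) [IsProbabilityMeasure μ]
    (hsupp : μ (Set.Ico (0 : ℝ) 1) = 1)
    (herg : Ergodic (fun x : ℝ => Int.fract ((n : ℝ) * x)) μ)
    (κ : ℝ) (hκ : 0 < κ) (hdim : ExactDimensional μ κ) :
    ∀ᵐ x ∂μ, IsWA x := by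
  have : NeZero n := ⟨by omega⟩
  have hn1 : 1 < n := by omega
  have hs : ∀ᵐ x ∂μ, x ∈ Set.Ico (0 : ℝ) 1 := (prob_compl_eq_zero_iff measurableSet_Ico).2 hsupp
  rcases herg.ae_empty_or_univ_of_preimage_ae_le measurableSet_isWA.nullMeasurableSet
    (Eventually.of_forall fun x hx => IsWA.of_fract_mul (by omega) hx) with h | h
  swap
  · filter_upwards [h] with x hx
    exact (hx.mpr trivial : IsWA x)
  exfalso
  have hnot : ∀ᵐ x ∂μ, ¬ IsWA x := by
    filter_upwards [h] with x hx hw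
    exact hx.mp hw
  have hm0 : IsProbabilityMeasure (μ.map fun x => Real.digits x n) :=
    Measure.isProbabilityMeasure_map measurable_digits.aemeasurable
  obtain ⟨ν, hν1, hν, hsnd⟩ := exists_natural_extension
    (measurePreserving_seqTail_digits hs herg.toMeasurePreserving)
  have hn' : (1 : ℝ) < n := by exact_mod_cast hn1
  refine false_of_badlyApproximable hn hν (κ := ν.condKernel) (ν.disintegrate ν.condKernel)
    (condKernel_ofDigits_fibre_eq_zero hn hν (ν.disintegrate ν.condKernel)
      (q := (n : ℝ) ^ (-(κ / 4))) (by positivity)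
      (Real.rpow_lt_one_of_one_lt_of_neg hn' (by linarith)) ?_) fun η hη => ?_
  · have : ν.snd = μ.map fun x => Real.digits x n := hsnd
    rw [this]
    exact tendsto_measure_cyl_digits hn hs hκ hdim
  · obtain ⟨ε, hε, hle⟩ := exists_measure_compl_badlyApproximable_le hnot hη
    refine ⟨ε, hε, le_trans (le_of_eq ?_) hle⟩
    have hC : MeasurableSet {f : ℕ → Fin n | Real.ofDigits f ∉ badlyApproximable ε} :=
      measurable_ofDigits (isClosed_badlyApproximable ε).measurableSet.compl
    calc ν {p | Real.ofDigits p.2 ∉ badlyApproximable ε}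
        = ν.map Prod.snd {f | Real.ofDigits f ∉ badlyApproximable ε} :=
          (Measure.map_apply measurable_snd hC).symm
      _ = μ ((fun x => Real.digits x n) ⁻¹' {f | Real.ofDigits f ∉ badlyApproximable ε}) := by
          rw [hsnd, Measure.map_apply measurable_digits hC]
      _ = μ (badlyApproximable ε)ᶜ := by
          refine measure_congr ?_
          filter_upwards [hs] with x hx
          change (Real.ofDigits (Real.digits x n) ∉ badlyApproximable ε) =
            (x ∉ badlyApproximable ε)
          rw [Real.ofDigits_digits hn1 hx]
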